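/- arXiv:1008.3095 — 2 statements merged into one kernel-verified Lean document; each statement's English description precedes it below -/
import Mathlib

section
/- (Corollary 4.8.) Fix γ ∈ (0,∞) and assume W is continuous and satisfies (H1)–(H4) and the normalization of the wells. Then K*_γ ≥ K_γ. -/
open MeasureTheory Filter Topology ENNReal NNReal Set

noncomputable section

/-- Vectors in ℝ³. -/
abbrev V3 := Fin 3 → ℝ

/-- 3×3 matrices, represented as the triple of their columns. -/
abbrev M33 := Fin 3 → V3

/-- Euclidean norm on ℝ³. -/
def vnorm (v : V3) : ℝ := Real.sqrt (∑ i, (v i) ^ 2)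

/-- Frobenius (Euclidean) norm on 3×3 matrices. -/
def mnorm (ξ : M33) : ℝ := Real.sqrt (∑ j, ∑ i, (ξ j i) ^ 2)

/-- dist(ξ,{A,B}). -/
def mdist (A B ξ : M33) : ℝ := min (mnorm (ξ - A)) (mnorm (ξ - B))

/-- Spatial points of ℝ³ = ℝ × ℝ × ℝ. -/
abbrev Pt := ℝ × ℝ × ℝ

/-- Directional partial derivative of a map `u : ℝ³ → ℝ³`. -/
def pd (e : Pt) (u : Pt → V3) (x : Pt) : V3 := fderiv ℝ u x e

def e1 : Pt := (1, 0, 0)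
def e2 : Pt := (0, 1, 0)
def e3 : Pt := (0, 0, 1)

/-- Rescaled gradient ∇_h u = (∂₁u, ∂₂u, h⁻¹ ∂₃u), as a 3×3 matrix of columns. -/
def gradh (h : ℝ) (u : Pt → V3) (x : Pt) : M33 :=
  ![pd e1 u x, pd e2 u x, h⁻¹ • pd e3 u x]

/-- Squared rescaled Hessian |∇²_h u|². -/
def hessh (h : ℝ) (u : Pt → V3) (x : Pt) : ℝ :=
  (vnorm (pd e1 (pd e1 u) x)) ^ 2 + (vnorm (pd e2 (pd e2 u) x)) ^ 2
    + (h⁻¹) ^ 4 * (vnorm (pd e3 (pd e3 u) x)) ^ 2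
    + 2 * (vnorm (pd e2 (pd e1 u) x)) ^ 2
    + 2 * (h⁻¹) ^ 2 * (vnorm (pd e3 (pd e1 u) x)) ^ 2
    + 2 * (h⁻¹) ^ 2 * (vnorm (pd e3 (pd e2 u) x)) ^ 2

/-- The energy F^h_ε(u, S) = ∫_S (1/ε) W(∇_h u) + ε |∇²_h u|², valued in [0,∞]. -/
def F (W : M33 → ℝ) (h ε : ℝ) (u : Pt → V3) (S : Set Pt) : ℝ≥0∞ :=
  ∫⁻ x in S, ENNReal.ofReal (ε⁻¹ * W (gradh h u x) + ε * hessh h u x)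

/-- Hypothesis (H1): W ≥ 0, {W = 0} = {A, B}, A ≠ B, and A' − B' = 2 a ⊗ ν̄ for
some a ∈ ℝ³ and a unit vector ν̄ ∈ ℝ². -/
def H1 (W : M33 → ℝ) (A B : M33) : Prop :=
  (∀ ξ, 0 ≤ W ξ) ∧ (∀ ξ, W ξ = 0 ↔ ξ = A ∨ ξ = B) ∧ A ≠ B ∧
    ∃ (a : V3) (ν : ℝ × ℝ), ν.1 ^ 2 + ν.2 ^ 2 = 1 ∧
      A 0 - B 0 = (2 * ν.1) • a ∧ A 1 - B 1 = (2 * ν.2) • a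

/-- Hypothesis (H2): p-growth from above and below. -/
def H2 (W : M33 → ℝ) (p : ℝ) : Prop :=
  ∃ C > (0 : ℝ), ∀ ξ, C⁻¹ * (mnorm ξ) ^ p - C ≤ W ξ ∧ W ξ ≤ C * (mnorm ξ) ^ p + C

/-- Hypothesis (H3): non-degeneracy near the wells. -/
def H3 (W : M33 → ℝ) (A B : M33) (p : ℝ) : Prop :=
  ∃ ϱ > (0 : ℝ), ∃ C > (0 : ℝ), ∀ ξ, mdist A B ξ ≤ ϱ →
    C⁻¹ * (mdist A B ξ) ^ p ≤ W ξ ∧ W ξ ≤ C * (mdist A B ξ) ^ p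

/-- Hypothesis (H4): W(ξ₁, 0, ξ₃) ≤ W(ξ). -/
def H4 (W : M33 → ℝ) : Prop := ∀ ξ : M33, W ![ξ 0, 0, ξ 2] ≤ W ξ

/-- Normalization of the wells: A = −B, first column of A is a, second column is 0. -/
def Wells (A B : M33) (a : V3) : Prop := A = -B ∧ A 0 = a ∧ A 1 = 0

/-- ū₀(t) = |t| a. -/
def ub0 (a : V3) (t : ℝ) : V3 := |t| • a

/-- b̄₀(t) = A₃ for t ≥ 0, −A₃ (= B₃) for t < 0. -/
def bb0 (A3 : V3) (t : ℝ) : V3 := if 0 ≤ t then A3 else -A3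

/-- u₀(x) = ū₀(x₁). -/
def u0 (a : V3) (x : Pt) : V3 := ub0 a x.1

/-- b₀(x) = b̄₀(x₁). -/
def b0 (A3 : V3) (x : Pt) : V3 := bb0 A3 x.1

/-- The interval I = (−1/2, 1/2). -/
def II : Set ℝ := Set.Ioo (-(1 / 2 : ℝ)) (1 / 2)

/-- The unit cube Q = I × I × I. -/
def Q3 : Set Pt := II ×ˢ (II ×ˢ II)

/-- J_ρ = (ρ I) × J × I. -/
def Jrho (J : Set ℝ) (ρ : ℝ) : Set Pt := (Set.Ioo (-(ρ / 2)) (ρ / 2)) ×ˢ (J ×ˢ II)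

/-- The rescaled thin domain Ω = ω × I. -/
def Om (ω : Set (ℝ × ℝ)) : Set Pt := {x | (x.1, x.2.1) ∈ ω ∧ x.2.2 ∈ II}

/-- L¹ convergence on a set U. -/
def TendsL1 (U : Set Pt) (f : ℕ → Pt → V3) (g : Pt → V3) : Prop :=
  Tendsto (fun n => ∫⁻ x in U, ENNReal.ofReal (vnorm (f n x - g x))) atTop (nhds 0)

/-- L^q convergence on a set U. -/
def TendsLp (U : Set Pt) (q : ℝ) (f : ℕ → Pt → V3) (g : Pt → V3) : Prop :=
  Tendsto (fun n => ∫⁻ x in U, ENNReal.ofReal ((vnorm (f n x - g x)) ^ q)) atTop (nhds 0)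

/-- The localized asymptotic energy 𝓔_γ(J, ρ). -/
def Egam (W : M33 → ℝ) (a A3 : V3) (γ : ℝ) (J : Set ℝ) (ρ : ℝ) : ℝ≥0∞ :=
  sInf { L : ℝ≥0∞ | ∃ (h ε : ℕ → ℝ) (u : ℕ → Pt → V3),
    (∀ n, 0 < h n) ∧ (∀ n, 0 < ε n) ∧
    Tendsto h atTop (nhds 0) ∧ Tendsto ε atTop (nhds 0) ∧
    Tendsto (fun n => h n / ε n) atTop (nhds γ) ∧
    (∀ n, ContDiffOn ℝ 2 (u n) (Jrho J ρ)) ∧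
    TendsL1 (Jrho J ρ) u (u0 a) ∧
    TendsL1 (Jrho J ρ) (fun n x => (h n)⁻¹ • pd e3 (u n) x) (b0 A3) ∧
    L = Filter.liminf (fun n => F W (h n) (ε n) (u n) (Jrho J ρ)) atTop }

/-- K*_γ = 𝓔_γ(I, 1). -/
def Kstar (W : M33 → ℝ) (a A3 : V3) (γ : ℝ) : ℝ≥0∞ := Egam W a A3 γ II 1

/-- K*_∞ : the analogue of K*_γ for h/ε → ∞, on the unit cube Q. -/
def KstarInf (W : M33 → ℝ) (a A3 : V3) : ℝ≥0∞ :=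
  sInf { L : ℝ≥0∞ | ∃ (h ε : ℕ → ℝ) (u : ℕ → Pt → V3),
    (∀ n, 0 < h n) ∧ (∀ n, 0 < ε n) ∧
    Tendsto h atTop (nhds 0) ∧ Tendsto ε atTop (nhds 0) ∧
    Tendsto (fun n => h n / ε n) atTop atTop ∧
    (∀ n, ContDiffOn ℝ 2 (u n) Q3) ∧
    TendsL1 Q3 u (u0 a) ∧
    TendsL1 Q3 (fun n x => (h n)⁻¹ • pd e3 (u n) x) (b0 A3) ∧
    L = Filter.liminf (fun n => F W (h n) (ε n) (u n) Q3) atTop }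

open Classical in
/-- The phase matrix: B on E, A off E. -/
def Mfun (A B : M33) (E : Set (ℝ × ℝ)) (x' : ℝ × ℝ) : M33 := if x' ∈ E then B else A

/-! ### Two-dimensional objects -/

abbrev Pt2 := ℝ × ℝ

/-- Directional partial derivative of a map `v : ℝ² → ℝ³`. -/
def qd (e : Pt2) (v : Pt2 → V3) (y : Pt2) : V3 := fderiv ℝ v y e

def f1 : Pt2 := (1, 0)
def f2 : Pt2 := (0, 1)

/-- 𝒲(∇v) = W(∂₁v, 0, ∂₂v). -/
def W2 (W : M33 → ℝ) (v : Pt2 → V3) (y : Pt2) : ℝ := W ![qd f1 v y, 0, qd f2 v y]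

/-- Squared 2D Hessian |∇²v|². -/
def hess2d (v : Pt2 → V3) (y : Pt2) : ℝ :=
  (vnorm (qd f1 (qd f1 v) y)) ^ 2 + 2 * (vnorm (qd f2 (qd f1 v) y)) ^ 2
    + (vnorm (qd f2 (qd f2 v) y)) ^ 2

/-- The rectangle ℓI × γI. -/
def Rect (ℓ γ : ℝ) : Set Pt2 := Set.Ioo (-(ℓ / 2)) (ℓ / 2) ×ˢ Set.Ioo (-(γ / 2)) (γ / 2)

/-- The optimal-profile constant K_γ of the critical regime. -/
def Kgam (W : M33 → ℝ) (a A3 : V3) (γ : ℝ) : ℝ≥0∞ :=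
  sInf { L : ℝ≥0∞ | ∃ ℓ > (0 : ℝ), ∃ v : Pt2 → V3,
    ContDiffOn ℝ 2 v (Rect ℓ γ) ∧
    (∃ δ > (0 : ℝ), ∀ y ∈ Rect ℓ γ, ℓ / 2 - δ < y.1 → qd f1 v y = a ∧ qd f2 v y = A3) ∧
    (∃ δ > (0 : ℝ), ∀ y ∈ Rect ℓ γ, y.1 < -(ℓ / 2) + δ → qd f1 v y = -a ∧ qd f2 v y = -A3) ∧
    L = ENNReal.ofReal γ⁻¹ *
      ∫⁻ y in Rect ℓ γ, ENNReal.ofReal (W2 W v y + hess2d v y) }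

/-- The 2D subcritical functional F⁰_ε(u, b, D). -/
def F0 (W : M33 → ℝ) (ε : ℝ) (u b : Pt2 → V3) (D : Set Pt2) : ℝ≥0∞ :=
  ∫⁻ y in D, ENNReal.ofReal (ε⁻¹ * W ![qd f1 u y, qd f2 u y, b y]
    + ε * ((vnorm (qd f1 (qd f1 u) y)) ^ 2 + 2 * (vnorm (qd f2 (qd f1 u) y)) ^ 2
      + (vnorm (qd f2 (qd f2 u) y)) ^ 2
      + 2 * (vnorm (qd f1 b y)) ^ 2 + 2 * (vnorm (qd f2 b y)) ^ 2))

/-- K*₀: the subcritical cell constant. -/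
def Kstar0 (W : M33 → ℝ) (a A3 : V3) : ℝ≥0∞ :=
  sInf { L : ℝ≥0∞ | ∃ (ε : ℕ → ℝ) (u b : ℕ → Pt2 → V3),
    (∀ n, 0 < ε n) ∧ Tendsto ε atTop (nhds 0) ∧
    (∀ n, ContDiffOn ℝ 2 (u n) (II ×ˢ II)) ∧ (∀ n, ContDiffOn ℝ 1 (b n) (II ×ˢ II)) ∧
    Tendsto (fun n => ∫⁻ y in II ×ˢ II,
      ENNReal.ofReal (vnorm (u n y - ub0 a y.1) + vnorm (b n y - bb0 A3 y.1)))
      atTop (nhds 0) ∧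
    L = Filter.liminf (fun n => F0 W (ε n) (u n) (b n) (II ×ˢ II)) atTop }

/-- K₀: the subcritical optimal-profile constant. -/
def K0 (W : M33 → ℝ) (a A3 : V3) : ℝ≥0∞ :=
  sInf { L : ℝ≥0∞ | ∃ ℓ > (0 : ℝ), ∃ φ1 φ2 : ℝ → V3,
    ContDiffOn ℝ 1 φ1 (Set.Icc (-ℓ) ℓ) ∧ ContDiffOn ℝ 1 φ2 (Set.Icc (-ℓ) ℓ) ∧
    φ1 ℓ = a ∧ φ2 ℓ = A3 ∧ φ1 (-ℓ) = -a ∧ φ2 (-ℓ) = -A3 ∧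
    L = ∫⁻ t in Set.Ioo (-ℓ) ℓ, ENNReal.ofReal (W ![φ1 t, 0, φ2 t]
      + (vnorm (derivWithin φ1 (Set.Icc (-ℓ) ℓ) t)) ^ 2
      + 2 * (vnorm (derivWithin φ2 (Set.Icc (-ℓ) ℓ) t)) ^ 2) }

/-- K_∞ in the case λ = 0. -/
def KinfZero (W : M33 → ℝ) (a : V3) : ℝ≥0∞ :=
  sInf { L : ℝ≥0∞ | ∃ ℓ > (0 : ℝ), ∃ v : Pt2 → V3,
    ContDiff ℝ 2 v ∧ (∀ y : Pt2, v (y.1, y.2 + 1) = v y) ∧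
    (∃ δ > (0 : ℝ), ∀ y : Pt2, |y.1 - 1 / 2| < δ → qd f1 v y = a ∧ qd f2 v y = 0) ∧
    (∃ δ > (0 : ℝ), ∀ y : Pt2, |y.1 + 1 / 2| < δ → qd f1 v y = -a ∧ qd f2 v y = 0) ∧
    L = ∫⁻ y in II ×ˢ II, ENNReal.ofReal (ℓ * W2 W v y + ℓ⁻¹ * hess2d v y) }

/-- The unit normal ν_λ = (1+λ²)^{-1/2} (1, λ). -/
def nuv (lam : ℝ) : Pt2 := (1 / Real.sqrt (1 + lam ^ 2), lam / Real.sqrt (1 + lam ^ 2))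

/-- The orthogonal direction ν_λ^⊥ = (1+λ²)^{-1/2} (−λ, 1). -/
def nupv (lam : ℝ) : Pt2 := (-lam / Real.sqrt (1 + lam ^ 2), 1 / Real.sqrt (1 + lam ^ 2))

/-- Dot product on ℝ². -/
def dotp (w y : Pt2) : ℝ := w.1 * y.1 + w.2 * y.2

/-- The unit square Q'_λ centered at 0 with two sides orthogonal to ν_λ. -/
def Qlam (lam : ℝ) : Set Pt2 := {y | |dotp (nuv lam) y| < 1 / 2 ∧ |dotp (nupv lam) y| < 1 / 2}

/-- K_∞ for general λ. -/
def KinfL (W : M33 → ℝ) (a : V3) (lam : ℝ) : ℝ≥0∞ :=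
  ENNReal.ofReal (Real.sqrt (1 + lam ^ 2)) *
    sInf { L : ℝ≥0∞ | ∃ ℓ > (0 : ℝ), ∃ v : Pt2 → V3,
      ContDiff ℝ 2 v ∧ (∀ y : Pt2, v (y + nupv lam) = v y) ∧
      (∃ δ > (0 : ℝ), ∀ y : Pt2, |dotp (nuv lam) y - 1 / 2| < δ →
        qd f1 v y = a ∧ qd f2 v y = lam • a) ∧
      (∃ δ > (0 : ℝ), ∀ y : Pt2, |dotp (nuv lam) y + 1 / 2| < δ →
        qd f1 v y = -a ∧ qd f2 v y = -(lam • a)) ∧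
      L = ∫⁻ y in Qlam lam, ENNReal.ofReal (ℓ * W2 W v y + ℓ⁻¹ * hess2d v y) }

/-- Number of interfaces strictly below t. -/
def cnt (m : ℕ) (α : Fin m → ℝ) (t : ℝ) : ℕ := (Finset.univ.filter (fun i => α i < t)).card

end

/-- Fundamental theorem of calculus estimate on an open interval. -/
theorem enorm_sub_le_lintegral_Ioo {E : Type*} [NormedAddCommGroup E] [NormedSpace ℝ E]
    [CompleteSpace E] {f f' : ℝ → E} {α β : ℝ}
    (hf : ∀ t ∈ Ioo α β, HasDerivAt f (f' t) t) (hf' : ContinuousOn f' (Ioo α β))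
    {s t : ℝ} (hs : s ∈ Ioo α β) (ht : t ∈ Ioo α β) :
    ‖f t - f s‖ₑ ≤ ∫⁻ r in Ioo α β, ‖f' r‖ₑ := by
  wlog hst : s ≤ t generalizing s t
  · rw [← neg_sub, enorm_neg]
    exact this ht hs (le_of_not_ge hst)
  have hsub : Icc s t ⊆ Ioo α β := fun r hr => ⟨hs.1.trans_le hr.1, hr.2.trans_lt ht.2⟩
  have h := intervalIntegral.integral_eq_sub_of_hasDerivAt (a := s) (b := t) (f := f) (f' := f')
    (fun r hr => hf r (hsub (by rwa [uIcc_of_le hst] at hr)))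
    ((hf'.mono (by rw [uIcc_of_le hst]; exact hsub)).intervalIntegrable)
  rw [← h, intervalIntegral.integral_of_le hst]
  refine (enorm_integral_le_lintegral_enorm _).trans ?_
  exact lintegral_mono_set (Ioc_subset_Icc_self.trans hsub)

/-- A function takes a value not larger than its mean on an interval. -/
theorem exists_mul_le_setLIntegral_Ioo {f : ℝ → ℝ≥0∞} {α β : ℝ} (h : α < β)
    (hf : AEMeasurable f (volume.restrict (Ioo α β))) :
    ∃ s ∈ Ioo α β, ENNReal.ofReal (β - α) * f s ≤ ∫⁻ t in Ioo α β, f t := by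
  obtain ⟨s, hs, hle⟩ := exists_le_setLAverage (μ := volume) (s := Ioo α β) (f := f)
    (by simp [h]) (by simp) hf
  refine ⟨s, hs, ?_⟩
  rw [setLAverage_eq, Real.volume_Ioo] at hle
  have h0 : ENNReal.ofReal (β - α) ≠ 0 := by simp [h]
  rw [ENNReal.le_div_iff_mul_le (Or.inl h0) (Or.inl ofReal_ne_top)] at hle
  rwa [mul_comm]

/-- If a curve follows `y ↦ y • a` in the mean and its velocity is close to `{a, -a}`, then
its velocity is close to `a`. -/
theorem lintegral_velocity_sub_le {E : Type*} [NormedAddCommGroup E] [NormedSpace ℝ E]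
    [CompleteSpace E] {f f' : ℝ → E} {α r : ℝ} (hr : 0 < r) (a : E)
    (hf : ∀ t ∈ Ioo α (α + 4 * r), HasDerivAt f (f' t) t)
    (hf' : ContinuousOn f' (Ioo α (α + 4 * r))) :
    ENNReal.ofReal r * ∫⁻ t in Ioo (α + r) (α + 3 * r), ‖f' t - a‖ₑ ≤
      2 * ENNReal.ofReal r *
          (∫⁻ t in Ioo α (α + 4 * r), ENNReal.ofReal (min ‖f' t - a‖ ‖f' t + a‖)) +
        ∫⁻ t in Ioo α (α + 4 * r), ‖f t - t • a‖ₑ := by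
  have hcf : ContinuousOn f (Ioo α (α + 4 * r)) :=
    fun t ht => (hf t ht).continuousAt.continuousWithinAt
  have hcg : ContinuousOn (fun t => ‖f t - t • a‖ₑ) (Ioo α (α + 4 * r)) := by fun_prop
  have hsub1 : Ioo α (α + r) ⊆ Ioo α (α + 4 * r) := Ioo_subset_Ioo_right (by linarith)
  have hsub2 : Ioo (α + 3 * r) (α + 4 * r) ⊆ Ioo α (α + 4 * r) :=
    Ioo_subset_Ioo_left (by linarith)
  obtain ⟨s, hs, hs'⟩ := exists_mul_le_setLIntegral_Ioo (by linarith : α < α + r)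
    ((hcg.mono hsub1).aemeasurable measurableSet_Ioo)
  obtain ⟨t, ht, ht'⟩ := exists_mul_le_setLIntegral_Ioo
    (by linarith : α + 3 * r < α + 4 * r) ((hcg.mono hsub2).aemeasurable measurableSet_Ioo)
  rw [show α + r - α = r by ring] at hs'
  rw [show α + 4 * r - (α + 3 * r) = r by ring] at ht'
  have hst : s ≤ t := by linarith [hs.2, ht.1]
  have hsub : Icc s t ⊆ Ioo α (α + 4 * r) :=
    fun q hq => ⟨hs.1.trans_le hq.1, hq.2.trans_lt ht.2⟩
  obtain ⟨g, hg1, hga⟩ := exists_dual_vector'' ℝ a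
  have hgle : ∀ x, |g x| ≤ ‖x‖ := fun x => by
    have := g.le_opNorm x
    rw [Real.norm_eq_abs] at this
    nlinarith [norm_nonneg x]
  have key : ∀ x : E, ‖x - a‖ ≤ 2 * min ‖x - a‖ ‖x + a‖ - g (x - a) := by
    intro x
    rcases le_total ‖x - a‖ ‖x + a‖ with h | h
    · rw [min_eq_left h]
      linarith [(abs_le.1 (hgle (x - a))).2]
    · rw [min_eq_right h]
      have h1 := (abs_le.1 (hgle (x + a))).2
      have h2 : ‖x - a‖ ≤ ‖x + a‖ + 2 * ‖a‖ := by
        calc ‖x - a‖ = ‖(x + a) - (2 : ℝ) • a‖ := by rw [two_smul]; congr 1; abel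
          _ ≤ ‖x + a‖ + ‖(2 : ℝ) • a‖ := norm_sub_le _ _
          _ = _ := by rw [norm_smul]; simp
      simp only [map_add, map_sub, hga, RCLike.ofReal_real_eq_id, id] at h1 ⊢
      linarith
  have hcI : ContinuousOn f' (Icc s t) := hf'.mono hsub
  have hcd : ContinuousOn (fun q => min ‖f' q - a‖ ‖f' q + a‖) (Icc s t) := by fun_prop
  have hint1 : IntervalIntegrable (fun q => ‖f' q - a‖) volume s t := by
    apply ContinuousOn.intervalIntegrable; rw [uIcc_of_le hst]; fun_prop
  have hint2 : IntervalIntegrable (fun q => min ‖f' q - a‖ ‖f' q + a‖) volume s t := by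
    apply ContinuousOn.intervalIntegrable; rw [uIcc_of_le hst]; fun_prop
  have hint3 : IntervalIntegrable (fun q => g (f' q - a)) volume s t := by
    apply ContinuousOn.intervalIntegrable; rw [uIcc_of_le hst]; fun_prop
  have hftc : ∫ q in s..t, g (f' q - a) = g ((f t - t • a) - (f s - s • a)) := by
    have := intervalIntegral.integral_eq_sub_of_hasDerivAt (a := s) (b := t)
      (f := fun q => g (f q - q • a)) (f' := fun q => g (f' q - a)) (fun q hq => by
        rw [uIcc_of_le hst] at hq
        have h1 := (hf q (hsub hq)).sub ((hasDerivAt_id q).smul_const a)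
        simp only [one_smul] at h1
        exact g.hasFDerivAt.comp_hasDerivAt q h1) hint3
    rw [this, ← map_sub]
  have hreal : ∫ q in s..t, ‖f' q - a‖ ≤
      2 * (∫ q in s..t, min ‖f' q - a‖ ‖f' q + a‖) + ‖f s - s • a‖ + ‖f t - t • a‖ := by
    calc ∫ q in s..t, ‖f' q - a‖
        ≤ ∫ q in s..t, (2 * min ‖f' q - a‖ ‖f' q + a‖ - g (f' q - a)) :=
          intervalIntegral.integral_mono_on hst hint1 ((hint2.const_mul 2).sub hint3)
            fun q _ => key _
      _ = 2 * (∫ q in s..t, min ‖f' q - a‖ ‖f' q + a‖)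
            - g ((f t - t • a) - (f s - s • a)) := by
          rw [intervalIntegral.integral_sub (hint2.const_mul 2) hint3,
            intervalIntegral.integral_const_mul, hftc]
      _ ≤ _ := by
          have h1 := (abs_le.1 (hgle ((f t - t • a) - (f s - s • a)))).1
          have h2 := norm_sub_le (f t - t • a) (f s - s • a)
          linarith
  have hconv : ∀ G : ℝ → ℝ, (∀ q, 0 ≤ G q) → IntervalIntegrable G volume s t →
      ENNReal.ofReal (∫ q in s..t, G q) = ∫⁻ q in Ioc s t, ENNReal.ofReal (G q) := by
    intro G hG hi
    rw [intervalIntegral.integral_of_le hst]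
    exact ofReal_integral_eq_lintegral_ofReal
      ((intervalIntegrable_iff_integrableOn_Ioc_of_le hst).1 hi) (ae_of_all _ hG)
  have hle1 : ∫⁻ q in Ioo (α + r) (α + 3 * r), ‖f' q - a‖ₑ ≤
      2 * (∫⁻ q in Ioo α (α + 4 * r), ENNReal.ofReal (min ‖f' q - a‖ ‖f' q + a‖))
        + ‖f s - s • a‖ₑ + ‖f t - t • a‖ₑ := by
    calc ∫⁻ q in Ioo (α + r) (α + 3 * r), ‖f' q - a‖ₑ
        ≤ ∫⁻ q in Ioc s t, ‖f' q - a‖ₑ :=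
          lintegral_mono_set fun q hq => ⟨hs.2.trans hq.1, (hq.2.trans ht.1).le⟩
      _ = ENNReal.ofReal (∫ q in s..t, ‖f' q - a‖) := by
          rw [hconv _ (fun _ => norm_nonneg _) hint1]
          simp only [ofReal_norm]
      _ ≤ ENNReal.ofReal (2 * (∫ q in s..t, min ‖f' q - a‖ ‖f' q + a‖)
            + ‖f s - s • a‖ + ‖f t - t • a‖) := ENNReal.ofReal_le_ofReal hreal
      _ ≤ ENNReal.ofReal (2 * (∫ q in s..t, min ‖f' q - a‖ ‖f' q + a‖))
            + ENNReal.ofReal ‖f s - s • a‖ + ENNReal.ofReal ‖f t - t • a‖ :=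
          ofReal_add_le.trans (by gcongr; exact ofReal_add_le)
      _ ≤ _ := by
          rw [ENNReal.ofReal_mul zero_le_two, ENNReal.ofReal_ofNat,
            hconv _ (fun _ => le_min (norm_nonneg _) (norm_nonneg _)) hint2, ofReal_norm,
            ofReal_norm]
          gcongr
          exact Ioc_subset_Icc_self.trans hsub
  calc ENNReal.ofReal r * ∫⁻ q in Ioo (α + r) (α + 3 * r), ‖f' q - a‖ₑ
      ≤ ENNReal.ofReal r * (2 * (∫⁻ q in Ioo α (α + 4 * r),
          ENNReal.ofReal (min ‖f' q - a‖ ‖f' q + a‖))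
        + ‖f s - s • a‖ₑ + ‖f t - t • a‖ₑ) := by gcongr
    _ = 2 * ENNReal.ofReal r * (∫⁻ q in Ioo α (α + 4 * r),
          ENNReal.ofReal (min ‖f' q - a‖ ‖f' q + a‖))
        + (ENNReal.ofReal r * ‖f s - s • a‖ₑ + ENNReal.ofReal r * ‖f t - t • a‖ₑ) := by ring
    _ ≤ _ := by
      refine add_le_add le_rfl ((add_le_add hs' ht').trans ?_)
      rw [← lintegral_union measurableSet_Ioo]
      · exact lintegral_mono_set (union_subset hsub1 hsub2)
      · refine Set.disjoint_left.2 fun q hq hq' => ?_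
        linarith [hq.2, hq'.1]

theorem measurable_qd (e : Pt2) (v : Pt2 → V3) : Measurable (qd e v) :=
  measurable_fderiv_apply_const ℝ v e

theorem continuousOn_qd {U : Set Pt2} (hU : IsOpen U) {v : Pt2 → V3} (hv : ContDiffOn ℝ 1 v U)
    (e : Pt2) : ContinuousOn (qd e v) U :=
  (hv.continuousOn_fderiv_of_isOpen hU le_rfl).clm_apply continuousOn_const

theorem hasDerivAt_slice_fst {v : Pt2 → V3} {t z : ℝ} (h : DifferentiableAt ℝ v (t, z)) :
    HasDerivAt (fun s => v (s, z)) (qd f1 v (t, z)) t := by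
  have h1 : HasDerivAt (fun s : ℝ => ((s, z) : Pt2)) f1 t :=
    (hasDerivAt_id t).prodMk (hasDerivAt_const t z)
  exact h.hasFDerivAt.comp_hasDerivAt t h1

theorem hasDerivAt_slice_snd {v : Pt2 → V3} {t z : ℝ} (h : DifferentiableAt ℝ v (t, z)) :
    HasDerivAt (fun s => v (t, s)) (qd f2 v (t, z)) z := by
  have h1 : HasDerivAt (fun s : ℝ => ((t, s) : Pt2)) f2 z :=
    (hasDerivAt_const z t).prodMk (hasDerivAt_id z)
  exact h.hasFDerivAt.comp_hasDerivAt z h1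

/-- The sum of the power `p` and the identity on `[0,∞]`. -/
noncomputable def powAdd (p : ℝ) (x : ℝ≥0∞) : ℝ≥0∞ := x ^ p + x

theorem powAdd_mono {p : ℝ} (hp : 1 ≤ p) {x y : ℝ≥0∞} (h : x ≤ y) : powAdd p x ≤ powAdd p y :=
  add_le_add (ENNReal.rpow_le_rpow h (by linarith)) h

theorem measurable_powAdd (p : ℝ) : Measurable (powAdd p) := by
  unfold powAdd; fun_prop

theorem powAdd_add_le {p : ℝ} (hp : 1 < p) (x y : ℝ≥0∞) :
    powAdd p (x + y) ≤ 2 ^ (p - 1) * (powAdd p x + powAdd p y) := by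
  have h1 : (1 : ℝ≥0∞) ≤ 2 ^ (p - 1) :=
    ENNReal.one_le_rpow (by norm_num) (by linarith)
  calc powAdd p (x + y) ≤ 2 ^ (p - 1) * (x ^ p + y ^ p) + 1 * (x + y) := by
        rw [one_mul]
        exact add_le_add (ENNReal.rpow_add_le_mul_rpow_add_rpow x y hp.le) le_rfl
    _ ≤ 2 ^ (p - 1) * (x ^ p + y ^ p) + 2 ^ (p - 1) * (x + y) := by gcongr
    _ = _ := by unfold powAdd; ring

theorem rpow_lintegral_le {α : Type*} [MeasurableSpace α] {μ : Measure α} {p : ℝ} (hp : 1 < p)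
    {f : α → ℝ≥0∞} (hf : AEMeasurable f μ) :
    (∫⁻ x, f x ∂μ) ^ p ≤ μ univ ^ (p - 1) * ∫⁻ x, f x ^ p ∂μ := by
  have hpq := Real.HolderConjugate.conjExponent hp
  have h := ENNReal.lintegral_mul_le_Lp_mul_Lq μ hpq hf (aemeasurable_const (b := (1 : ℝ≥0∞)))
  simp only [Pi.mul_apply, mul_one, ENNReal.one_rpow, lintegral_const, one_mul] at h
  have hp0 : 0 < p := by linarith
  refine (ENNReal.rpow_le_rpow h hp0.le).trans_eq ?_
  rw [ENNReal.mul_rpow_of_nonneg _ _ hp0.le, ← ENNReal.rpow_mul, ← ENNReal.rpow_mul,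
    one_div_mul_cancel hp0.ne', ENNReal.rpow_one, mul_comm]
  congr 2
  have := hpq.sub_one_mul_conj
  have h2 := hpq.symm.pos
  field_simp
  linarith

theorem powAdd_lintegral_le {α : Type*} [MeasurableSpace α] {μ : Measure α} {p : ℝ} (hp : 1 < p)
    {f : α → ℝ≥0∞} (hf : AEMeasurable f μ) :
    powAdd p (∫⁻ x, f x ∂μ) ≤ (μ univ ^ (p - 1) + 1) * ∫⁻ x, powAdd p (f x) ∂μ := by
  have h : ∫⁻ x, powAdd p (f x) ∂μ = ∫⁻ x, f x ^ p ∂μ + ∫⁻ x, f x ∂μ :=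
    lintegral_add_right' _ hf
  rw [h]
  unfold powAdd
  calc _ ≤ μ univ ^ (p - 1) * (∫⁻ x, f x ^ p ∂μ) + 1 * ∫⁻ x, f x ∂μ := by
        rw [one_mul]; exact add_le_add (rpow_lintegral_le hp hf) le_rfl
    _ ≤ (μ univ ^ (p - 1) + 1) * (∫⁻ x, f x ^ p ∂μ)
        + (μ univ ^ (p - 1) + 1) * ∫⁻ x, f x ∂μ := by
        gcongr
        · exact le_self_add
        · exact le_add_self
    _ = _ := by ring

/-- The cell `(τ, τ + 1) × γI`. -/
def cell (γ τ : ℝ) : Set Pt2 := Ioo τ (τ + 1) ×ˢ Ioo (-(γ / 2)) (γ / 2)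

theorem isOpen_cell (γ τ : ℝ) : IsOpen (cell γ τ) := isOpen_Ioo.prod isOpen_Ioo

/-- A Poincaré inequality on the cell. -/
theorem exists_poincare_cell {p γ : ℝ} (hp : 1 < p) (hγ : 0 < γ) :
    ∃ C : ℝ≥0∞, C ≠ ∞ ∧ ∀ (τ : ℝ) (w : Pt2 → V3), ContDiffOn ℝ 1 w (cell γ τ) →
      ∃ c : V3, ∫⁻ y in cell γ τ, powAdd p ‖w y - c‖ₑ ≤
        C * ∫⁻ y in cell γ τ, (powAdd p ‖qd f1 w y‖ₑ + powAdd p ‖qd f2 w y‖ₑ) := by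
  set J : Set ℝ := Ioo (-(γ / 2)) (γ / 2) with hJ
  have hvJ : volume J = ENNReal.ofReal γ := by rw [hJ, Real.volume_Ioo]; congr 1; ring
  set m : ℝ≥0∞ := ENNReal.ofReal γ with hm
  set K : ℝ≥0∞ := m ^ (p - 1) + 1 with hK
  refine ⟨2 ^ (p - 1) * (2 + K * m), ?_, fun τ w hw => ?_⟩
  · have h1 : m ^ (p - 1) ≠ ∞ := ENNReal.rpow_ne_top_of_nonneg (by linarith) ofReal_ne_top
    have h2 : (2 : ℝ≥0∞) ^ (p - 1) ≠ ∞ := ENNReal.rpow_ne_top_of_nonneg (by linarith) (by simp)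
    finiteness
  set T : Set ℝ := Ioo τ (τ + 1) with hT
  have hvT : volume T = 1 := by rw [hT, Real.volume_Ioo]; simp
  have hopen : IsOpen (cell γ τ) := isOpen_cell γ τ
  have hcell : cell γ τ = T ×ˢ J := rfl
  have hdiff : ∀ t ∈ T, ∀ z ∈ J, DifferentiableAt ℝ w (t, z) := fun t ht z hz =>
    (hw.differentiableOn one_ne_zero).differentiableAt (hopen.mem_nhds ⟨ht, hz⟩)
  have hq1 := continuousOn_qd hopen hw f1
  have hq2 := continuousOn_qd hopen hw f2
  have hm1 : Measurable fun y => ‖qd f1 w y‖ₑ := (measurable_qd f1 w).enorm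
  have hm2 : Measurable fun y => ‖qd f2 w y‖ₑ := (measurable_qd f2 w).enorm
  have hp1 : Measurable fun y => powAdd p ‖qd f1 w y‖ₑ := (measurable_powAdd p).comp hm1
  have hp2 : Measurable fun y => powAdd p ‖qd f2 w y‖ₑ := (measurable_powAdd p).comp hm2
  obtain ⟨s, hs, hle⟩ := exists_mul_le_setLIntegral_Ioo (α := τ) (β := τ + 1) (by linarith)
    (f := fun t => ∫⁻ z in J, powAdd p ‖qd f2 w (t, z)‖ₑ)
    (hp2.lintegral_prod_right').aemeasurable
  simp only [add_sub_cancel_left, ENNReal.ofReal_one, one_mul] at hle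
  have h0 : (0 : ℝ) ∈ J := ⟨by linarith, by linarith⟩
  refine ⟨w (s, 0), ?_⟩
  set Y : ℝ≥0∞ := ∫⁻ z in J, ‖qd f2 w (s, z)‖ₑ with hY
  have hpt : ∀ y ∈ cell γ τ, powAdd p ‖w y - w (s, 0)‖ₑ ≤
      2 ^ (p - 1) * (2 * (∫⁻ t in T, powAdd p ‖qd f1 w (t, y.2)‖ₑ) +
        K * ∫⁻ z in J, powAdd p ‖qd f2 w (s, z)‖ₑ) := by
    rintro ⟨t, z⟩ ⟨ht, hz⟩
    simp only at ht hz ⊢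
    have e1 : ‖w (t, z) - w (s, z)‖ₑ ≤ ∫⁻ r in T, ‖qd f1 w (r, z)‖ₑ :=
      enorm_sub_le_lintegral_Ioo (f := fun r => w (r, z))
        (fun r hr => hasDerivAt_slice_fst (hdiff r hr z hz))
        (hq1.comp (by fun_prop) fun r hr => ⟨hr, hz⟩) hs ht
    have e2 : ‖w (s, z) - w (s, 0)‖ₑ ≤ Y :=
      enorm_sub_le_lintegral_Ioo (f := fun r => w (s, r))
        (fun r hr => hasDerivAt_slice_snd (hdiff s hs r hr))
        (hq2.comp (by fun_prop) fun r hr => ⟨hs, hr⟩) h0 hz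
    have e3 : ‖w (t, z) - w (s, 0)‖ₑ ≤ (∫⁻ r in T, ‖qd f1 w (r, z)‖ₑ) + Y := by
      rw [← sub_add_sub_cancel _ (w (s, z))]
      exact (enorm_add_le _ _).trans (add_le_add e1 e2)
    refine (powAdd_mono hp.le e3).trans ((powAdd_add_le hp _ _).trans ?_)
    gcongr
    · refine (powAdd_lintegral_le hp (hm1.comp measurable_prodMk_right).aemeasurable).trans_eq ?_
      rw [Measure.restrict_apply_univ, hvT, ENNReal.one_rpow, one_add_one_eq_two]
      rfl
    · refine (powAdd_lintegral_le hp (hm2.comp measurable_prodMk_left).aemeasurable).trans_eq ?_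
      rw [Measure.restrict_apply_univ, hvJ]
      rfl
  have hI1 : ∫⁻ y in cell γ τ, (∫⁻ t in T, powAdd p ‖qd f1 w (t, y.2)‖ₑ) =
      ∫⁻ y in cell γ τ, powAdd p ‖qd f1 w y‖ₑ := by
    have hmm : Measurable fun y : Pt2 => ∫⁻ t in T, powAdd p ‖qd f1 w (t, y.2)‖ₑ :=
      (hp1.lintegral_prod_left').comp measurable_snd
    rw [hcell, Measure.volume_eq_prod, setLIntegral_prod_symm _ hmm.aemeasurable,
      setLIntegral_prod_symm _ hp1.aemeasurable]
    simp [hvT]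
  have hI2 : ∫⁻ y in cell γ τ, powAdd p ‖qd f2 w y‖ₑ =
      ∫⁻ t in T, ∫⁻ z in J, powAdd p ‖qd f2 w (t, z)‖ₑ := by
    rw [hcell, Measure.volume_eq_prod, setLIntegral_prod _ hp2.aemeasurable]
  have hvc : volume (cell γ τ) = m := by
    rw [hcell, Measure.volume_eq_prod, Measure.prod_prod, hvT, hvJ, one_mul]
  have hmm : Measurable fun y : Pt2 => ∫⁻ t in T, powAdd p ‖qd f1 w (t, y.2)‖ₑ :=
      (hp1.lintegral_prod_left').comp measurable_snd
  calc ∫⁻ y in cell γ τ, powAdd p ‖w y - w (s, 0)‖ₑ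
      ≤ ∫⁻ y in cell γ τ, 2 ^ (p - 1) * (2 * (∫⁻ t in T, powAdd p ‖qd f1 w (t, y.2)‖ₑ) +
        K * ∫⁻ z in J, powAdd p ‖qd f2 w (s, z)‖ₑ) :=
        setLIntegral_mono' hopen.measurableSet hpt
    _ = 2 ^ (p - 1) * (2 * (∫⁻ y in cell γ τ, powAdd p ‖qd f1 w y‖ₑ) +
        K * (∫⁻ z in J, powAdd p ‖qd f2 w (s, z)‖ₑ) * m) := by
        rw [lintegral_const_mul _ (by fun_prop), lintegral_add_right _ measurable_const,
          lintegral_const_mul _ hmm, hI1, lintegral_const, Measure.restrict_apply_univ, hvc]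
    _ ≤ 2 ^ (p - 1) * (2 * (∫⁻ y in cell γ τ, powAdd p ‖qd f1 w y‖ₑ) +
        K * (∫⁻ y in cell γ τ, powAdd p ‖qd f2 w y‖ₑ) * m) := by
        rw [hI2]; gcongr
    _ = 2 ^ (p - 1) * (2 * (∫⁻ y in cell γ τ, powAdd p ‖qd f1 w y‖ₑ) +
        K * m * (∫⁻ y in cell γ τ, powAdd p ‖qd f2 w y‖ₑ)) := by ring
    _ ≤ 2 ^ (p - 1) * ((2 + K * m) * (∫⁻ y in cell γ τ, powAdd p ‖qd f1 w y‖ₑ) +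
        (2 + K * m) * (∫⁻ y in cell γ τ, powAdd p ‖qd f2 w y‖ₑ)) := by
        gcongr
        · exact le_self_add
        · exact le_add_self
    _ = _ := by rw [lintegral_add_left hp1]; ring

theorem norm_le_vnorm (v : V3) : ‖v‖ ≤ vnorm v := by
  refine (pi_norm_le_iff_of_nonneg (Real.sqrt_nonneg _)).2 fun i => ?_
  rw [Real.norm_eq_abs]
  exact Real.abs_le_sqrt (Finset.single_le_sum (f := fun i => v i ^ 2)
    (fun j _ => sq_nonneg (v j)) (Finset.mem_univ i))

theorem vnorm_sq_le (v : V3) : vnorm v ^ 2 ≤ 3 * ‖v‖ ^ 2 := by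
  rw [vnorm, Real.sq_sqrt (by positivity), Fin.sum_univ_three]
  have h : ∀ i, v i ^ 2 ≤ ‖v‖ ^ 2 := fun i => by
    rw [← sq_abs, ← Real.norm_eq_abs]
    exact pow_le_pow_left₀ (norm_nonneg _) (norm_le_pi_norm v i) 2
  linarith [h 0, h 1, h 2]

theorem continuous_vnorm : Continuous vnorm := by
  unfold vnorm; fun_prop

theorem norm_le_mnorm (ξ : M33) : ‖ξ‖ ≤ mnorm ξ := by
  refine (pi_norm_le_iff_of_nonneg (Real.sqrt_nonneg _)).2 fun j => ?_
  refine (norm_le_vnorm _).trans (Real.sqrt_le_sqrt ?_)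
  exact Finset.single_le_sum (f := fun j => ∑ i, ξ j i ^ 2)
    (fun j _ => Finset.sum_nonneg fun i _ => sq_nonneg _) (Finset.mem_univ j)

theorem mnorm_le (ξ : M33) : mnorm ξ ≤ 3 * ‖ξ‖ := by
  refine Real.sqrt_le_iff.2 ⟨by positivity, ?_⟩
  have h : ∀ j, ∑ i, ξ j i ^ 2 ≤ 3 * ‖ξ‖ ^ 2 := fun j => by
    have h1 := vnorm_sq_le (ξ j)
    rw [vnorm, Real.sq_sqrt (by positivity)] at h1
    have h2 := pow_le_pow_left₀ (norm_nonneg _) (norm_le_pi_norm ξ j) 2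
    linarith
  rw [Fin.sum_univ_three]
  nlinarith [h 0, h 1, h 2]

theorem norm_columns_sub_le (ξ η a b : V3) :
    ‖(![ξ, 0, η] : M33) - ![a, 0, b]‖ ≤ ‖ξ - a‖ + ‖η - b‖ := by
  refine (pi_norm_le_iff_of_nonneg (by positivity)).2 fun j => ?_
  fin_cases j
  · simp
  · simpa using by positivity
  · simp

theorem le_norm_columns_sub (ξ η a b : V3) :
    ‖ξ - a‖ + ‖η - b‖ ≤ 2 * ‖(![ξ, 0, η] : M33) - ![a, 0, b]‖ := by
  have h0 := norm_le_pi_norm ((![ξ, 0, η] : M33) - ![a, 0, b]) 0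
  have h2 := norm_le_pi_norm ((![ξ, 0, η] : M33) - ![a, 0, b]) 2
  simp only [Pi.sub_apply] at h0 h2
  have e0 : (![ξ, 0, η] : M33) 0 - (![a, 0, b] : M33) 0 = ξ - a := rfl
  have e2 : (![ξ, 0, η] : M33) 2 - (![a, 0, b] : M33) 2 = η - b := rfl
  rw [e0] at h0
  rw [e2] at h2
  linarith

/-- Quantitative behaviour of the reduced potential `(ξ, η) ↦ W (ξ, 0, η)` around the well
`(a, b)`. -/
structure WellBounds (W : M33 → ℝ) (p : ℝ) (a b : V3) : Prop where
  nonneg : ∀ ξ, 0 ≤ W ξ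
  zero : W ![a, 0, b] = 0
  upper : ∃ C > (0 : ℝ), ∀ ξ η, W ![ξ, 0, η] ≤ C * (‖ξ - a‖ + ‖η - b‖) ^ p
  lower : ∃ C > (0 : ℝ), ∀ ξ η,
    (‖ξ - a‖ + ‖η - b‖) ^ p ≤ C * (W ![ξ, 0, η] + (‖ξ - a‖ + ‖η - b‖))
  coarse : ∀ κ > (0 : ℝ), ∃ C > (0 : ℝ), ∀ ξ η,
    min ‖ξ - a‖ ‖ξ + a‖ ≤ κ + C * W ![ξ, 0, η]

theorem wellBounds_of_hypotheses {W : M33 → ℝ} {p : ℝ} (hp : 2 ≤ p) (hWc : Continuous W)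
    (h0 : ∀ ξ, 0 ≤ W ξ) {a b : V3}
    (hz : ∀ ξ, W ξ = 0 ↔ ξ = ![a, 0, b] ∨ ξ = ![-a, 0, -b])
    (h2 : H2 W p) (h3 : H3 W ![a, 0, b] ![-a, 0, -b] p) : WellBounds W p a b := by
  obtain ⟨C, hC, hW2⟩ := h2
  obtain ⟨r, hr, D, hD, hW3⟩ := h3
  have hp0 : 0 ≤ p := by linarith
  set A : M33 := ![a, 0, b] with hA
  have growth : ∃ K > (0 : ℝ), ∀ ξ η : V3,
      (‖ξ - a‖ + ‖η - b‖) ^ p ≤ K * (W ![ξ, 0, η] + 1) := by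
    refine ⟨4 ^ p * (C + C * C + ‖A‖ ^ p), by positivity, fun ξ η => ?_⟩
    set X : M33 := ![ξ, 0, η]
    have hm : 0 ≤ mnorm X := Real.sqrt_nonneg _
    have hmx : 0 ≤ max (mnorm X) ‖A‖ := le_max_of_le_left hm
    have h1 : ‖ξ - a‖ + ‖η - b‖ ≤ 4 * max (mnorm X) ‖A‖ := by
      have := le_norm_columns_sub ξ η a b
      have := norm_sub_le X A
      have := norm_le_mnorm X
      have := le_max_left (mnorm X) ‖A‖
      have := le_max_right (mnorm X) ‖A‖
      linarith
    have h2 : max (mnorm X) ‖A‖ ^ p ≤ mnorm X ^ p + ‖A‖ ^ p := by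
      have e1 : 0 ≤ mnorm X ^ p := Real.rpow_nonneg hm p
      have e2 : 0 ≤ ‖A‖ ^ p := Real.rpow_nonneg (norm_nonneg _) p
      rcases max_choice (mnorm X) ‖A‖ with h | h <;> rw [h] <;> linarith
    have h3 : mnorm X ^ p ≤ C * (W X + C) := by
      have := (hW2 X).1
      rw [sub_le_iff_le_add, inv_mul_le_iff₀ hC] at this
      exact this
    have hWX := h0 X
    calc (‖ξ - a‖ + ‖η - b‖) ^ p ≤ (4 * max (mnorm X) ‖A‖) ^ p :=
          Real.rpow_le_rpow (by positivity) h1 hp0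
      _ = 4 ^ p * max (mnorm X) ‖A‖ ^ p := Real.mul_rpow (by norm_num) hmx
      _ ≤ 4 ^ p * (C * (W X + C) + ‖A‖ ^ p) := by gcongr; linarith
      _ ≤ 4 ^ p * ((C + C * C + ‖A‖ ^ p) * (W X + 1)) := by
          gcongr
          have : 0 ≤ ‖A‖ ^ p := by positivity
          nlinarith [mul_nonneg this hWX, mul_nonneg (mul_nonneg hC.le hC.le) hWX]
      _ = _ := by ring
  refine ⟨h0, (hz _).2 (Or.inl rfl), ?_, ?_, ?_⟩
  · refine ⟨D * 3 ^ p + (C * (3 * (3 * ‖A‖ / r + 1)) ^ p + C * (3 / r) ^ p), by positivity,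
      fun ξ η => ?_⟩
    set X : M33 := ![ξ, 0, η]
    set N := ‖ξ - a‖ + ‖η - b‖ with hN
    have hN0 : 0 ≤ N := by positivity
    have hXA : ‖X - A‖ ≤ N := norm_columns_sub_le ξ η a b
    have hd : mnorm (X - A) ≤ 3 * N := (mnorm_le _).trans (by linarith)
    have hdd : mdist A ![-a, 0, -b] X ≤ mnorm (X - A) := min_le_left _ _
    have hd0 : 0 ≤ mdist A ![-a, 0, -b] X :=
      le_min (Real.sqrt_nonneg _) (Real.sqrt_nonneg _)
    have hn1 : 0 ≤ D * 3 ^ p := by positivity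
    have hn2 : 0 ≤ C * (3 * (3 * ‖A‖ / r + 1)) ^ p + C * (3 / r) ^ p := by positivity
    have hNp : 0 ≤ N ^ p := by positivity
    rw [add_mul]
    by_cases h : mdist A ![-a, 0, -b] X ≤ r
    · have h4 : mdist A ![-a, 0, -b] X ^ p ≤ 3 ^ p * N ^ p := by
        rw [← Real.mul_rpow (by norm_num) hN0]
        exact Real.rpow_le_rpow hd0 (hdd.trans hd) hp0
      have h5 := (hW3 X h).2
      have h6 := mul_le_mul_of_nonneg_left h4 hD.le
      nlinarith [mul_nonneg hn2 hNp]
    · push Not at h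
      have hrN : r ≤ 3 * N := by linarith
      have h4 : 1 ≤ 3 / r * N := by rw [div_mul_eq_mul_div, le_div_iff₀ hr]; linarith
      have h5 : mnorm X ≤ 3 * (3 * ‖A‖ / r + 1) * N := by
        have e1 := mnorm_le X
        have e2 : ‖X‖ ≤ ‖X - A‖ + ‖A‖ := by
          simpa using norm_add_le (X - A) A
        have e3 : ‖A‖ ≤ ‖A‖ * (3 / r * N) := le_mul_of_one_le_right (norm_nonneg _) h4
        have e4 : 3 * (3 * ‖A‖ / r + 1) * N = 3 * (‖A‖ * (3 / r * N) + N) := by ring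
        rw [e4]; linarith
      have h6 : mnorm X ^ p ≤ (3 * (3 * ‖A‖ / r + 1)) ^ p * N ^ p := by
        rw [← Real.mul_rpow (by positivity) hN0]
        exact Real.rpow_le_rpow (Real.sqrt_nonneg _) h5 hp0
      have h7 : 1 ≤ (3 / r) ^ p * N ^ p := by
        rw [← Real.mul_rpow (by positivity) hN0]
        exact Real.one_le_rpow h4 hp0
      have h8 := (hW2 X).2
      have h9 := mul_le_mul_of_nonneg_left h6 hC.le
      have h10 := mul_le_mul_of_nonneg_left h7 hC.le
      nlinarith [mul_nonneg hn1 hNp]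
  · obtain ⟨K, hK, hgr⟩ := growth
    refine ⟨K + 1, by positivity, fun ξ η => ?_⟩
    have hg := hgr ξ η
    set X : M33 := ![ξ, 0, η]
    set N := ‖ξ - a‖ + ‖η - b‖ with hN
    have hN0 : 0 ≤ N := by positivity
    have hWX := h0 X
    rcases le_total 1 N with h | h
    · nlinarith
    · have : N ^ p ≤ N ^ (1 : ℝ) :=
        Real.rpow_le_rpow_of_exponent_ge' hN0 h zero_le_one (by linarith)
      rw [Real.rpow_one] at this
      nlinarith [mul_nonneg hK.le hWX, mul_nonneg hK.le hN0]
  · intro κ hκ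
    obtain ⟨K, hK, hgr⟩ := growth
    set N0 := max 1 (2 * K) with hN0
    set S : Set (V3 × V3) :=
      {x | ‖x.1 - a‖ + ‖x.2 - b‖ ≤ N0 ∧ κ ≤ min ‖x.1 - a‖ ‖x.1 + a‖} with hS
    have hScl : IsClosed S := by
      have hc1 : Continuous fun x : V3 × V3 => ‖x.1 - a‖ + ‖x.2 - b‖ := by fun_prop
      have hc2 : Continuous fun x : V3 × V3 => min ‖x.1 - a‖ ‖x.1 + a‖ := by fun_prop
      exact (isClosed_le hc1 continuous_const).inter (isClosed_le continuous_const hc2)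
    have hSc : IsCompact S := by
      refine (isCompact_closedBall ((a, b) : V3 × V3) N0).of_isClosed_subset hScl ?_
      rintro ⟨x, y⟩ ⟨hx, -⟩
      rw [mem_closedBall_iff_norm, Prod.norm_def]
      simp only [Prod.mk_sub_mk] at hx ⊢
      exact max_le (by linarith [norm_nonneg (y - b)]) (by linarith [norm_nonneg (x - a)])
    obtain ⟨c, hc, hcS⟩ : ∃ c > (0 : ℝ), ∀ x ∈ S, c ≤ W ![x.1, 0, x.2] := by
      rcases S.eq_empty_or_nonempty with he | hne
      · exact ⟨1, one_pos, fun x hx => by simp [he] at hx⟩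
      have hcont : Continuous fun x : V3 × V3 => W ![x.1, 0, x.2] := by
        refine hWc.comp (continuous_pi fun j => ?_)
        fin_cases j
        · exact continuous_fst
        · exact continuous_const
        · exact continuous_snd
      obtain ⟨x, hx, hmin⟩ := hSc.exists_isMinOn hne hcont.continuousOn
      refine ⟨_, lt_of_le_of_ne (h0 _) (Ne.symm fun h => ?_), hmin⟩
      have hx2 := hx.2
      rcases (hz _).1 h with h | h
      · have : x.1 = a := congrFun h 0
        rw [this] at hx2
        have := min_le_left ‖a - a‖ ‖a + a‖
        simp only [sub_self, norm_zero] at this hx2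
        linarith
      · have : x.1 = -a := congrFun h 0
        rw [this] at hx2
        have := min_le_right ‖-a - a‖ ‖-a + a‖
        simp only [neg_add_cancel, norm_zero] at this hx2
        linarith
    refine ⟨2 * K + N0 / c, by positivity, fun ξ η => ?_⟩
    have hg := hgr ξ η
    have hWX := h0 ![ξ, 0, η]
    have hcS' := hcS (ξ, η)
    simp only at hcS'
    set X : M33 := ![ξ, 0, η]
    set N := ‖ξ - a‖ + ‖η - b‖ with hN
    have hmN : min ‖ξ - a‖ ‖ξ + a‖ ≤ N :=
      (min_le_left _ _).trans (by linarith [norm_nonneg (η - b)])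
    have hpos : 0 ≤ N0 / c * W X := by positivity
    rcases le_total N N0 with h | h
    · by_cases hk : κ ≤ min ‖ξ - a‖ ‖ξ + a‖
      · have h1 : c ≤ W X := hcS' ⟨h, hk⟩
        have h2 : N0 ≤ N0 / c * W X := by
          rw [div_mul_eq_mul_div, le_div_iff₀ hc]
          gcongr
        nlinarith
      · push Not at hk
        nlinarith
    · have h1 : 1 ≤ N := (le_max_left _ _).trans h
      have h2 : 2 * K ≤ N := (le_max_right _ _).trans h
      have h3 : N ^ (2 : ℝ) ≤ N ^ p := Real.rpow_le_rpow_of_exponent_le h1 hp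
      rw [Real.rpow_two] at h3
      nlinarith

theorem qd_smul_fst (e : Pt2) {φ : ℝ → ℝ} {G : Pt2 → V3} {y : Pt2}
    (hφ : DifferentiableAt ℝ φ y.1) (hG : DifferentiableAt ℝ G y) :
    qd e (fun z => φ z.1 • G z) y = φ y.1 • qd e G y + (e.1 * deriv φ y.1) • G y := by
  have h1 : HasFDerivAt (fun z : Pt2 => φ z.1)
      ((ContinuousLinearMap.toSpanSingleton ℝ (deriv φ y.1)).comp
        (ContinuousLinearMap.fst ℝ ℝ ℝ)) y :=
    (hφ.hasDerivAt.hasFDerivAt).comp y hasFDerivAt_fst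
  have h := (h1.smul hG.hasFDerivAt).fderiv
  have h' : fderiv ℝ (fun z => φ z.1 • G z) y = _ := h
  simp [qd, h']

theorem qd_congr {e : Pt2} {u v : Pt2 → V3} {y : Pt2} (h : u =ᶠ[𝓝 y] v) :
    qd e u y = qd e v y := by
  rw [qd, qd, h.fderiv_eq]

theorem qd_eventuallyEq {e : Pt2} {u v : Pt2 → V3} {y : Pt2} (h : u =ᶠ[𝓝 y] v) :
    qd e u =ᶠ[𝓝 y] qd e v := by
  filter_upwards [eventually_eventually_nhds.2 h] with z hz using qd_congr hz

theorem differentiableAt_qd {U : Set Pt2} (hU : IsOpen U) {v : Pt2 → V3}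
    (hv : ContDiffOn ℝ 2 v U) (e : Pt2) {y : Pt2} (hy : y ∈ U) :
    DifferentiableAt ℝ (qd e v) y := by
  have h : ContDiffOn ℝ 1 (fderiv ℝ v) U := hv.fderiv_of_isOpen hU (by norm_num [one_add_one_eq_two])
  exact ((h.differentiableOn one_ne_zero).differentiableAt (hU.mem_nhds hy)).clm_apply
    (differentiableAt_const e)

/-- The affine map with gradient `(a, b)` and value `c` at the origin. -/
def affineMap2 (a b c : V3) (y : Pt2) : V3 := y.1 • a + y.2 • b + c

theorem hasFDerivAt_affineMap2 (a b c : V3) (y : Pt2) :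
    HasFDerivAt (affineMap2 a b c)
      ((ContinuousLinearMap.fst ℝ ℝ ℝ).smulRight a + (ContinuousLinearMap.snd ℝ ℝ ℝ).smulRight b)
      y :=
  ((hasFDerivAt_fst.smul_const a).add (hasFDerivAt_snd.smul_const b)).add_const c

theorem qd_affineMap2 (e : Pt2) (a b c : V3) (y : Pt2) :
    qd e (affineMap2 a b c) y = e.1 • a + e.2 • b := by
  rw [qd, (hasFDerivAt_affineMap2 a b c y).fderiv]
  rfl

theorem contDiff_affineMap2 (a b c : V3) : ContDiff ℝ 2 (affineMap2 a b c) := by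
  unfold affineMap2; fun_prop

/-- Interpolation between `v` (where `φ = 1`) and an affine map (where `φ = 0`). -/
def blend (φ : ℝ → ℝ) (a b c : V3) (v : Pt2 → V3) (y : Pt2) : V3 :=
  affineMap2 a b c y + φ y.1 • (v y - affineMap2 a b c y)

section Blend

variable {φ : ℝ → ℝ} (hφ : ContDiff ℝ 2 φ) {U : Set Pt2} (hU : IsOpen U) {v : Pt2 → V3}
  (hv : ContDiffOn ℝ 2 v U) (a b c : V3) {y : Pt2} (hy : y ∈ U) (e e' : Pt2)

include hφ hv in
theorem contDiffOn_blend : ContDiffOn ℝ 2 (blend φ a b c v) U := by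
  have h := contDiff_affineMap2 a b c
  have h1 : ContDiff ℝ 2 fun y : Pt2 => φ y.1 := hφ.comp contDiff_fst
  exact h.contDiffOn.add (h1.contDiffOn.smul (hv.sub h.contDiffOn))

include hφ hU hv hy

theorem qd_blend : qd e (blend φ a b c v) y =
    (e.1 • a + e.2 • b) + (φ y.1 • (qd e v y - (e.1 • a + e.2 • b)) +
      (e.1 * deriv φ y.1) • (v y - affineMap2 a b c y)) := by
  have hφd : DifferentiableAt ℝ φ y.1 := hφ.differentiable two_ne_zero _
  have hvd : DifferentiableAt ℝ v y :=
    (hv.differentiableOn two_ne_zero).differentiableAt (hU.mem_nhds hy)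
  have hA := (hasFDerivAt_affineMap2 a b c y).differentiableAt
  have hs : qd e (fun z => v z - affineMap2 a b c z) y = qd e v y - (e.1 • a + e.2 • b) := by
    rw [← qd_affineMap2 e a b c y, qd, fderiv_fun_sub hvd hA]; rfl
  have hφ' : DifferentiableAt ℝ (fun z : Pt2 => φ z.1) y := hφd.comp y differentiableAt_fst
  have := fderiv_fun_add hA (hφ'.fun_smul (hvd.fun_sub hA))
  have h2 := qd_smul_fst e hφd (hvd.fun_sub hA)
  rw [hs] at h2
  rw [← h2, ← qd_affineMap2 e a b c y]
  exact congrArg (fun L => L e) this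

theorem qd_qd_blend : qd e' (qd e (blend φ a b c v)) y =
    φ y.1 • qd e' (qd e v) y + (e'.1 * deriv φ y.1) • (qd e v y - (e.1 • a + e.2 • b)) +
      ((e.1 * deriv φ y.1) • (qd e' v y - (e'.1 • a + e'.2 • b)) +
        (e'.1 * (e.1 * deriv (deriv φ) y.1)) • (v y - affineMap2 a b c y)) := by
  have hev : qd e (blend φ a b c v) =ᶠ[𝓝 y] fun z =>
      (e.1 • a + e.2 • b) + (φ z.1 • (qd e v z - (e.1 • a + e.2 • b)) +
      (e.1 * deriv φ z.1) • (v z - affineMap2 a b c z)) := by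
    filter_upwards [hU.mem_nhds hy] with z hz using qd_blend hφ hU hv a b c hz e
  rw [qd_congr hev]
  have hφd : DifferentiableAt ℝ φ y.1 := hφ.differentiable two_ne_zero _
  have hφ1 : DifferentiableAt ℝ (deriv φ) y.1 :=
    ((contDiff_succ_iff_deriv (n := 1)).1 hφ).2.2.differentiable one_ne_zero _
  have hvd : DifferentiableAt ℝ v y :=
    (hv.differentiableOn two_ne_zero).differentiableAt (hU.mem_nhds hy)
  have hA := (hasFDerivAt_affineMap2 a b c y).differentiableAt
  have hq := differentiableAt_qd hU hv e hy
  have hs : qd e' (fun z => v z - affineMap2 a b c z) y = qd e' v y - (e'.1 • a + e'.2 • b) := by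
    rw [← qd_affineMap2 e' a b c y, qd, fderiv_fun_sub hvd hA]; rfl
  have hs2 : qd e' (fun z => qd e v z - (e.1 • a + e.2 • b)) y = qd e' (qd e v) y := by
    rw [qd, fderiv_sub_const]; rfl
  have hG1 : DifferentiableAt ℝ (fun z => qd e v z - (e.1 • a + e.2 • b)) y := hq.sub_const _
  have hG2 : DifferentiableAt ℝ (fun z => v z - affineMap2 a b c z) y := hvd.fun_sub hA
  have hφ1' : DifferentiableAt ℝ (fun t => e.1 * deriv φ t) y.1 := hφ1.const_mul _
  have h1 := qd_smul_fst e' hφd hG1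
  have h2 := qd_smul_fst e' hφ1' hG2
  rw [hs2] at h1
  rw [hs, deriv_const_mul _ hφ1] at h2
  rw [← h1, ← h2]
  have d1 : DifferentiableAt ℝ (fun z : Pt2 => φ z.1 • (qd e v z - (e.1 • a + e.2 • b))) y :=
    (hφd.comp y differentiableAt_fst : DifferentiableAt ℝ (fun z : Pt2 => φ z.1) y).fun_smul hG1
  have d2 : DifferentiableAt ℝ
      (fun z : Pt2 => (e.1 * deriv φ z.1) • (v z - affineMap2 a b c z)) y :=
    (hφ1'.comp y differentiableAt_fst :
      DifferentiableAt ℝ (fun z : Pt2 => e.1 * deriv φ z.1) y).fun_smul hG2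
  rw [qd, fderiv_const_add, fderiv_fun_add d1 d2]
  rfl

end Blend

/-- The energy density of the two-dimensional functional. -/
noncomputable def energyDensity (W : M33 → ℝ) (v : Pt2 → V3) (y : Pt2) : ℝ≥0∞ :=
  ENNReal.ofReal (W2 W v y + hess2d v y)

theorem hess2d_nonneg (v : Pt2 → V3) (y : Pt2) : 0 ≤ hess2d v y := by
  unfold hess2d; positivity

theorem measurable_energyDensity {W : M33 → ℝ} (hW : Continuous W) (v : Pt2 → V3) :
    Measurable (energyDensity W v) := by
  have h1 : Measurable fun y => (![qd f1 v y, 0, qd f2 v y] : M33) := by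
    refine measurable_pi_lambda _ fun j => ?_
    fin_cases j
    · exact measurable_qd f1 v
    · exact measurable_const
    · exact measurable_qd f2 v
  have h2 : ∀ e e' : Pt2, Measurable fun y => vnorm (qd e (qd e' v) y) := fun e e' =>
    continuous_vnorm.measurable.comp (measurable_qd _ _)
  refine ENNReal.measurable_ofReal.comp ((hW.measurable.comp h1).add ?_)
  exact (((h2 _ _).pow_const 2).add (((h2 _ _).pow_const 2).const_mul 2)).add
    ((h2 _ _).pow_const 2)

theorem energyDensity_congr {W : M33 → ℝ} {u v : Pt2 → V3} {y : Pt2} (h : u =ᶠ[𝓝 y] v) :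
    energyDensity W u y = energyDensity W v y := by
  have h1 := fun e => qd_congr (e := e) h
  have h2 := fun e e' => qd_congr (e := e') (qd_eventuallyEq (e := e) h)
  simp only [energyDensity, W2, hess2d, h1, h2]

theorem energyDensity_affineMap2 {W : M33 → ℝ} {a b : V3} (h : W ![a, 0, b] = 0) (c : V3)
    (y : Pt2) : energyDensity W (affineMap2 a b c) y = 0 := by
  have h1 : ∀ e, qd e (affineMap2 a b c) = fun _ => e.1 • a + e.2 • b :=
    fun e => funext fun y => qd_affineMap2 e a b c y
  have h2 : ∀ e (x : V3), qd e (fun _ => x) y = 0 := fun e x => by simp [qd]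
  have h3 : vnorm (0 : V3) = 0 := by simp [vnorm]
  simp only [energyDensity, W2, hess2d, h1, h2, h3]
  simp [f1, f2, h]

theorem sq_le_rpow_add {p : ℝ} (hp : 2 ≤ p) {x : ℝ} (hx : 0 ≤ x) : x ^ 2 ≤ x ^ p + x := by
  rcases le_total 1 x with h | h
  · have := Real.rpow_le_rpow_of_exponent_le h hp
    rw [Real.rpow_two] at this
    linarith
  · have : 0 ≤ x ^ p := Real.rpow_nonneg hx p
    nlinarith

theorem add_rpow_le_two {p : ℝ} (hp : 0 ≤ p) {x y : ℝ} (hx : 0 ≤ x) (hy : 0 ≤ y) :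
    (x + y) ^ p ≤ 2 ^ p * (x ^ p + y ^ p) := by
  have e1 : 0 ≤ x ^ p := Real.rpow_nonneg hx p
  have e2 : 0 ≤ y ^ p := Real.rpow_nonneg hy p
  have hm : 0 ≤ max x y := le_max_of_le_left hx
  calc (x + y) ^ p ≤ (2 * max x y) ^ p :=
        Real.rpow_le_rpow (by positivity) (by linarith [le_max_left x y, le_max_right x y]) hp
    _ = 2 ^ p * max x y ^ p := Real.mul_rpow (by norm_num) hm
    _ ≤ 2 ^ p * (x ^ p + y ^ p) := by
        gcongr
        rcases max_choice x y with h | h <;> rw [h] <;> linarith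

theorem vnorm_sq_add_le (x y : V3) : vnorm (x + y) ^ 2 ≤ 2 * vnorm x ^ 2 + 2 * vnorm y ^ 2 := by
  have h : ∀ v : V3, vnorm v ^ 2 = v 0 ^ 2 + v 1 ^ 2 + v 2 ^ 2 := fun v => by
    rw [vnorm, Real.sq_sqrt (by positivity), Fin.sum_univ_three]
  rw [h, h, h]
  simp only [Pi.add_apply]
  nlinarith [sq_nonneg (x 0 - y 0), sq_nonneg (x 1 - y 1), sq_nonneg (x 2 - y 2)]

theorem vnorm_sq_smul (r : ℝ) (x : V3) : vnorm (r • x) ^ 2 = r ^ 2 * vnorm x ^ 2 := by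
  have h : ∀ v : V3, vnorm v ^ 2 = v 0 ^ 2 + v 1 ^ 2 + v 2 ^ 2 := fun v => by
    rw [vnorm, Real.sq_sqrt (by positivity), Fin.sum_univ_three]
  rw [h, h]
  simp only [Pi.smul_apply, smul_eq_mul]
  ring

theorem vnorm_sq_smul_le {r K : ℝ} (h : |r| ≤ K) (x : V3) :
    vnorm (r • x) ^ 2 ≤ 3 * K ^ 2 * ‖x‖ ^ 2 := by
  rw [vnorm_sq_smul]
  have h1 : r ^ 2 ≤ K ^ 2 := sq_le_sq' (abs_le.1 h).1 (abs_le.1 h).2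
  calc r ^ 2 * vnorm x ^ 2 ≤ K ^ 2 * (3 * ‖x‖ ^ 2) :=
        mul_le_mul h1 (vnorm_sq_le x) (sq_nonneg _) (sq_nonneg _)
    _ = _ := by ring

theorem vnorm_sq_smul_le_self {r : ℝ} (h : |r| ≤ 1) (x : V3) :
    vnorm (r • x) ^ 2 ≤ vnorm x ^ 2 := by
  rw [vnorm_sq_smul]
  exact mul_le_of_le_one_left (sq_nonneg _) ((sq_le_one_iff_abs_le_one r).2 h)

/-- Pointwise bound for the Hessian of the interpolation. -/
theorem hess2d_blend_le {φ : ℝ → ℝ} (hφ : ContDiff ℝ 2 φ) {U : Set Pt2} (hU : IsOpen U)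
    {v : Pt2 → V3} (hv : ContDiffOn ℝ 2 v U) (a b c : V3) {y : Pt2} (hy : y ∈ U) {K : ℝ}
    (h0 : |φ y.1| ≤ 1) (h1 : |deriv φ y.1| ≤ K) (h2 : |deriv (deriv φ) y.1| ≤ K) :
    hess2d (blend φ a b c v) y ≤ 2 * hess2d v y + 36 * K ^ 2 * ((‖qd f1 v y - a‖
      + ‖qd f2 v y - b‖) ^ 2 + ‖v y - affineMap2 a b c y‖ ^ 2) := by
  have e11 := qd_qd_blend hφ hU hv a b c hy f1 f1
  have e21 := qd_qd_blend hφ hU hv a b c hy f1 f2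
  have e22 := qd_qd_blend hφ hU hv a b c hy f2 f2
  simp only [f1, f2, one_mul, zero_mul, zero_smul, one_smul, add_zero, zero_add] at e11 e21 e22
  set P := qd (1, 0) v y - a
  set R := qd (0, 1) v y - b
  set w := v y - affineMap2 a b c y
  simp only [hess2d, f1, f2]
  rw [add_assoc] at e11
  rw [e11, e21, e22, show qd (1, 0) v y - a = P from rfl, show qd (0, 1) v y - b = R from rfl]
  have b1 := vnorm_sq_smul_le_self h0 (qd (1, 0) (qd (1, 0) v) y)
  have b2 := vnorm_sq_smul_le_self h0 (qd (0, 1) (qd (1, 0) v) y)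
  have b3 := vnorm_sq_smul_le_self h0 (qd (0, 1) (qd (0, 1) v) y)
  have c1 := vnorm_sq_smul_le h1 P
  have c2 := vnorm_sq_smul_le h1 R
  have c3 := vnorm_sq_smul_le h2 w
  have d1 := vnorm_sq_add_le (φ y.1 • qd (1, 0) (qd (1, 0) v) y)
    (deriv φ y.1 • P + (deriv φ y.1 • P + deriv (deriv φ) y.1 • w))
  have d2 := vnorm_sq_add_le (deriv φ y.1 • P) (deriv φ y.1 • P + deriv (deriv φ) y.1 • w)
  have d3 := vnorm_sq_add_le (deriv φ y.1 • P) (deriv (deriv φ) y.1 • w)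
  have d4 := vnorm_sq_add_le (φ y.1 • qd (0, 1) (qd (1, 0) v) y) (deriv φ y.1 • R)
  have hPR : ‖P‖ ^ 2 + ‖R‖ ^ 2 ≤ (‖P‖ + ‖R‖) ^ 2 := by
    nlinarith [norm_nonneg P, norm_nonneg R, mul_nonneg (norm_nonneg P) (norm_nonneg R)]
  have hK : K ^ 2 * (‖P‖ ^ 2 + ‖R‖ ^ 2) ≤ K ^ 2 * (‖P‖ + ‖R‖) ^ 2 := by gcongr
  have := mul_nonneg (sq_nonneg K) (sq_nonneg ‖P‖)
  have := mul_nonneg (sq_nonneg K) (sq_nonneg ‖R‖)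
  have := mul_nonneg (sq_nonneg K) (sq_nonneg ‖w‖)
  have := sq_nonneg (vnorm (qd (0, 1) (qd (0, 1) v) y))
  linarith

/-- Pointwise bound for the energy of the interpolation. -/
theorem exists_density_blend_le {W : M33 → ℝ} {p : ℝ} (hp : 2 ≤ p) {a b : V3}
    (hW : WellBounds W p a b) {K : ℝ} (hK : 1 ≤ K) :
    ∃ C > (0 : ℝ), ∀ {φ : ℝ → ℝ} (_ : ContDiff ℝ 2 φ) {U : Set Pt2} (_ : IsOpen U)
      {v : Pt2 → V3} (_ : ContDiffOn ℝ 2 v U) (c : V3) {y : Pt2} (_ : y ∈ U),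
      |φ y.1| ≤ 1 → |deriv φ y.1| ≤ K → |deriv (deriv φ) y.1| ≤ K →
      W2 W (blend φ a b c v) y + hess2d (blend φ a b c v) y ≤
        C * (W2 W v y + hess2d v y + ‖qd f1 v y - a‖ + ‖qd f2 v y - b‖ +
          (‖v y - affineMap2 a b c y‖ ^ p + ‖v y - affineMap2 a b c y‖)) := by
  obtain ⟨Cu, hCu, hu⟩ := hW.upper
  obtain ⟨Cl, hCl, hl⟩ := hW.lower
  have hp0 : 0 ≤ p := by linarith
  refine ⟨Cu * 2 ^ p * (Cl + K ^ p) + 36 * K ^ 2 * (Cl + 2), by positivity, ?_⟩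
  intro φ hφ U hU v hv c y hy h0 h1 h2
  have hh := hess2d_blend_le hφ hU hv a b c hy h0 h1 h2
  have q1 := qd_blend hφ hU hv a b c hy f1
  have q2 := qd_blend hφ hU hv a b c hy f2
  simp only [f1, f2, one_mul, zero_mul, zero_smul, one_smul, add_zero, zero_add] at q1 q2
  have hup := hu (qd f1 (blend φ a b c v) y) (qd f2 (blend φ a b c v) y)
  have hlo := hl (qd f1 v y) (qd f2 v y)
  simp only [W2]
  have hWn := hW.nonneg ![qd f1 v y, 0, qd f2 v y]
  have hHn := hess2d_nonneg v y
  simp only [f1, f2] at *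
  set ω := ‖v y - affineMap2 a b c y‖ with hω
  have hω0 : 0 ≤ ω := norm_nonneg _
  set N := ‖qd (1, 0) v y - a‖ + ‖qd (0, 1) v y - b‖ with hN
  have hN0 : 0 ≤ N := by positivity
  set w := W ![qd (1, 0) v y, 0, qd (0, 1) v y]
  set w' := W ![qd (1, 0) (blend φ a b c v) y, 0, qd (0, 1) (blend φ a b c v) y]
  have n1 : ‖qd (1, 0) (blend φ a b c v) y - a‖ + ‖qd (0, 1) (blend φ a b c v) y - b‖
      ≤ N + K * ω := by
    rw [q1, q2, add_sub_cancel_left, add_sub_cancel_left]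
    have m1 : ‖φ y.1 • (qd (1, 0) v y - a)‖ ≤ ‖qd (1, 0) v y - a‖ := by
      rw [norm_smul]; exact mul_le_of_le_one_left (norm_nonneg _) h0
    have m2 : ‖φ y.1 • (qd (0, 1) v y - b)‖ ≤ ‖qd (0, 1) v y - b‖ := by
      rw [norm_smul]; exact mul_le_of_le_one_left (norm_nonneg _) h0
    have m3 : ‖deriv φ y.1 • (v y - affineMap2 a b c y)‖ ≤ K * ω := by
      rw [norm_smul]; exact mul_le_mul_of_nonneg_right h1 (norm_nonneg _)
    have := norm_add_le (φ y.1 • (qd (1, 0) v y - a))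
      (deriv φ y.1 • (v y - affineMap2 a b c y))
    linarith
  have hNp := Real.rpow_nonneg hN0 p
  have hωp := Real.rpow_nonneg hω0 p
  have n2 : w' ≤ Cu * (2 ^ p * (Cl * (w + N) + K ^ p * ω ^ p)) := by
    refine hup.trans ?_
    gcongr
    refine (Real.rpow_le_rpow (by positivity) n1 hp0).trans ?_
    refine (add_rpow_le_two hp0 hN0 (by positivity)).trans ?_
    rw [Real.mul_rpow (by positivity) hω0]
    gcongr
  have n3 := sq_le_rpow_add hp hN0
  have n4 := sq_le_rpow_add hp hω0
  have n5 : 36 * K ^ 2 * (N ^ 2 + ω ^ 2) ≤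
      36 * K ^ 2 * (Cl * (w + N) + N + (ω ^ p + ω)) := by
    gcongr; linarith
  set H := hess2d v y
  have hA : 0 ≤ Cu * 2 ^ p := by positivity
  have hKp : 0 ≤ K ^ p := by positivity
  have hK2 : 1 ≤ K ^ 2 := one_le_pow₀ hK
  set A := Cu * 2 ^ p
  set B := K ^ p
  have n6 : w' ≤ A * (Cl + B) * (w + H + N + (ω ^ p + ω)) := by
    have : Cl * (w + N) + B * ω ^ p ≤ (Cl + B) * (w + H + N + (ω ^ p + ω)) := by
      have t1 : Cl * (w + N) ≤ Cl * (w + H + N + (ω ^ p + ω)) :=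
        mul_le_mul_of_nonneg_left (by linarith) hCl.le
      have t2 : B * ω ^ p ≤ B * (w + H + N + (ω ^ p + ω)) :=
        mul_le_mul_of_nonneg_left (by linarith) hKp
      rw [add_mul]; linarith
    calc w' ≤ Cu * (2 ^ p * (Cl * (w + N) + B * ω ^ p)) := n2
      _ = A * (Cl * (w + N) + B * ω ^ p) := by simp only [A]; ring
      _ ≤ A * ((Cl + B) * (w + H + N + (ω ^ p + ω))) := by gcongr
      _ = _ := by ring
  have n7 : 2 * H + 36 * K ^ 2 * (Cl * (w + N) + N + (ω ^ p + ω)) ≤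
      36 * K ^ 2 * (Cl + 2) * (w + H + N + (ω ^ p + ω)) := by
    have t1 : Cl * (w + N) ≤ Cl * (w + H + N + (ω ^ p + ω)) :=
        mul_le_mul_of_nonneg_left (by linarith) hCl.le
    have t2 : H ≤ K ^ 2 * H := le_mul_of_one_le_left hHn hK2
    have t3 : 36 * K ^ 2 * (H + Cl * (w + N) + N + (ω ^ p + ω)) ≤
      36 * K ^ 2 * ((Cl + 2) * (w + H + N + (ω ^ p + ω))) := by
      gcongr
      rw [add_mul]; linarith
    have t4 : 0 ≤ K ^ 2 * H := by positivity
    calc _ ≤ 36 * K ^ 2 * (H + Cl * (w + N) + N + (ω ^ p + ω)) := by linarith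
      _ ≤ _ := t3
      _ = _ := by ring
  rw [add_mul]
  simp only [add_assoc] at *
  linarith

/-- The energy density together with the distance of the gradient to the well `(a, b)`. -/
noncomputable def wellDensity (W : M33 → ℝ) (a b : V3) (v : Pt2 → V3) (y : Pt2) : ℝ≥0∞ :=
  energyDensity W v y + (‖qd f1 v y - a‖ₑ + ‖qd f2 v y - b‖ₑ)

theorem measurable_wellDensity {W : M33 → ℝ} (hW : Continuous W) (a b : V3) (v : Pt2 → V3) :
    Measurable (wellDensity W a b v) :=
  (measurable_energyDensity hW v).add
    (((measurable_qd f1 v).sub_const a).enorm.add ((measurable_qd f2 v).sub_const b).enorm)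

/-- Energy of the interpolation on a cell. -/
theorem exists_lintegral_blend_le {W : M33 → ℝ} (hWc : Continuous W) {p : ℝ} (hp : 2 ≤ p)
    {a b : V3} (hW : WellBounds W p a b) {K γ : ℝ} (hK : 1 ≤ K) (hγ : 0 < γ) :
    ∃ C : ℝ≥0∞, C ≠ ∞ ∧ ∀ (τ : ℝ) (v : Pt2 → V3), ContDiffOn ℝ 2 v (cell γ τ) →
      ∃ c : V3, ∀ φ : ℝ → ℝ, ContDiff ℝ 2 φ → (∀ t ∈ Ioo τ (τ + 1),
        |φ t| ≤ 1 ∧ |deriv φ t| ≤ K ∧ |deriv (deriv φ) t| ≤ K) →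
        ∫⁻ y in cell γ τ, energyDensity W (blend φ a b c v) y ≤
          C * ∫⁻ y in cell γ τ, wellDensity W a b v y := by
  obtain ⟨C, hC, hpt⟩ := exists_density_blend_le hp hW hK
  obtain ⟨D, hD, hpo⟩ := exists_poincare_cell (p := p) (by linarith) hγ
  obtain ⟨Cl, hCl, hl⟩ := hW.lower
  refine ⟨ENNReal.ofReal C * (1 + D * (2 * ENNReal.ofReal Cl + 1)), by finiteness, ?_⟩
  intro τ v hv
  have hop := isOpen_cell γ τ
  obtain ⟨c, hc⟩ := hpo τ (fun y => v y - affineMap2 a b 0 y)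
    ((hv.sub (contDiff_affineMap2 a b 0).contDiffOn).of_le one_le_two)
  have hqd : ∀ e, ∀ y ∈ cell γ τ, qd e (fun y => v y - affineMap2 a b 0 y) y =
      qd e v y - (e.1 • a + e.2 • b) := fun e y hy => by
    have hvd : DifferentiableAt ℝ v y :=
      (hv.differentiableOn two_ne_zero).differentiableAt (hop.mem_nhds hy)
    rw [← qd_affineMap2 e a b 0 y, qd,
      fderiv_fun_sub hvd (hasFDerivAt_affineMap2 a b 0 y).differentiableAt]
    rfl
  have hsub : ∀ y, v y - affineMap2 a b 0 y - c = v y - affineMap2 a b c y := fun y => by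
    simp only [affineMap2]; abel
  simp only [hsub] at hc
  refine ⟨c, fun φ hφ hb => ?_⟩
  have hpw : ∀ y ∈ cell γ τ, energyDensity W (blend φ a b c v) y ≤
      ENNReal.ofReal C * (wellDensity W a b v y + powAdd p ‖v y - affineMap2 a b c y‖ₑ) := by
    intro y hy
    obtain ⟨h0, h1, h2⟩ := hb y.1 hy.1
    have h := hpt hφ hop hv c hy h0 h1 h2
    have hWn : 0 ≤ W2 W v y := hW.nonneg _
    have hHn := hess2d_nonneg v y
    refine (ENNReal.ofReal_le_ofReal h).trans_eq ?_
    rw [ENNReal.ofReal_mul hC.le, ENNReal.ofReal_add (by positivity) (by positivity),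
      ENNReal.ofReal_add (by positivity) (by positivity),
      ENNReal.ofReal_add (by positivity) (by positivity),
      ENNReal.ofReal_add (by positivity) (by positivity),
      ENNReal.ofReal_add (Real.rpow_nonneg (norm_nonneg _) _) (norm_nonneg _),
      ← ENNReal.ofReal_rpow_of_nonneg (norm_nonneg _) (by linarith)]
    simp only [ofReal_norm, wellDensity, powAdd, energyDensity, ENNReal.ofReal_add hWn hHn,
      add_assoc]
  have hpw2 : ∀ y ∈ cell γ τ, powAdd p ‖qd f1 (fun y => v y - affineMap2 a b 0 y) y‖ₑ +
      powAdd p ‖qd f2 (fun y => v y - affineMap2 a b 0 y) y‖ₑ ≤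
      (2 * ENNReal.ofReal Cl + 1) * wellDensity W a b v y := by
    intro y hy
    rw [hqd f1 y hy, hqd f2 y hy]
    simp only [f1, f2, zero_smul, one_smul, add_zero, zero_add]
    have h := hl (qd f1 v y) (qd f2 v y)
    have hWn : 0 ≤ W ![qd f1 v y, 0, qd f2 v y] := hW.nonneg _
    have hHn := hess2d_nonneg v y
    have hs : (‖qd f1 v y - a‖ₑ + ‖qd f2 v y - b‖ₑ) ^ p ≤
        ENNReal.ofReal Cl * wellDensity W a b v y := by
      have h' := ENNReal.ofReal_le_ofReal h
      rw [← ENNReal.ofReal_rpow_of_nonneg (by positivity) (by linarith),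
        ENNReal.ofReal_add (norm_nonneg _) (norm_nonneg _), ENNReal.ofReal_mul hCl.le,
        ENNReal.ofReal_add hWn (by positivity),
        ENNReal.ofReal_add (norm_nonneg _) (norm_nonneg _)] at h'
      simp only [ofReal_norm] at h'
      refine h'.trans ?_
      unfold wellDensity energyDensity W2
      gcongr
      exact le_add_of_nonneg_right hHn
    have hs1 := (ENNReal.rpow_le_rpow (le_self_add : ‖qd f1 v y - a‖ₑ ≤ _ + ‖qd f2 v y - b‖ₑ)
      (by linarith : 0 ≤ p)).trans hs
    have hs2 := (ENNReal.rpow_le_rpow (le_add_self : ‖qd f2 v y - b‖ₑ ≤ ‖qd f1 v y - a‖ₑ + _)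
      (by linarith : 0 ≤ p)).trans hs
    have hs3 : ‖qd f1 v y - a‖ₑ + ‖qd f2 v y - b‖ₑ ≤ wellDensity W a b v y := le_add_self
    unfold powAdd
    simp only [f1, f2] at *
    calc _ = ‖qd (1, 0) v y - a‖ₑ ^ p + ‖qd (0, 1) v y - b‖ₑ ^ p
          + (‖qd (1, 0) v y - a‖ₑ + ‖qd (0, 1) v y - b‖ₑ) := by ring
      _ ≤ ENNReal.ofReal Cl * wellDensity W a b v y + ENNReal.ofReal Cl * wellDensity W a b v y
          + wellDensity W a b v y := by gcongr
      _ = _ := by ring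
  have hmw := measurable_wellDensity hWc a b v
  calc ∫⁻ y in cell γ τ, energyDensity W (blend φ a b c v) y
      ≤ ∫⁻ y in cell γ τ, ENNReal.ofReal C *
          (wellDensity W a b v y + powAdd p ‖v y - affineMap2 a b c y‖ₑ) :=
        setLIntegral_mono' hop.measurableSet hpw
    _ = ENNReal.ofReal C * ((∫⁻ y in cell γ τ, wellDensity W a b v y) +
          ∫⁻ y in cell γ τ, powAdd p ‖v y - affineMap2 a b c y‖ₑ) := by
        rw [lintegral_const_mul' _ _ ofReal_ne_top, lintegral_add_left hmw]
    _ ≤ ENNReal.ofReal C * ((∫⁻ y in cell γ τ, wellDensity W a b v y) +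
          D * ∫⁻ y in cell γ τ, (2 * ENNReal.ofReal Cl + 1) * wellDensity W a b v y) := by
        gcongr
        refine hc.trans ?_
        exact mul_le_mul' le_rfl (setLIntegral_mono' hop.measurableSet hpw2)
    _ = _ := by
        rw [lintegral_const_mul _ hmw]
        ring

theorem setLIntegral_prod_swap {f : ℝ × ℝ → ℝ≥0∞} {s t : Set ℝ}
    (hf : AEMeasurable f (volume.restrict (s ×ˢ t))) :
    ∫⁻ y in s ×ˢ t, f y = ∫⁻ z in t, ∫⁻ x in s, f (x, z) := by
  rw [Measure.volume_eq_prod, ← Measure.prod_restrict] at hf ⊢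
  exact lintegral_prod_symm f hf

/-- In a strip, the velocity is close to `a` in the middle half as soon as the map is close to
`t ↦ t • a` and its velocity is close to `{a, -a}`. -/
theorem lintegral_strip_velocity_le {W : M33 → ℝ} (hWc : Continuous W) {p : ℝ} {a b : V3}
    (hW : WellBounds W p a b) {γ κ C : ℝ} (hκ : 0 < κ) (hC : 0 < C)
    (hco : ∀ ξ η, min ‖ξ - a‖ ‖ξ + a‖ ≤ κ + C * W ![ξ, 0, η]) {α r : ℝ} (hr : 0 < r)
    {v : Pt2 → V3}
    (hv : ContDiffOn ℝ 2 v (Ioo α (α + 4 * r) ×ˢ Ioo (-(γ / 2)) (γ / 2))) :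
    ENNReal.ofReal r *
        ∫⁻ y in Ioo (α + r) (α + 3 * r) ×ˢ Ioo (-(γ / 2)) (γ / 2), ‖qd f1 v y - a‖ₑ ≤
      2 * ENNReal.ofReal r * (ENNReal.ofReal (κ * (4 * r * γ)) + ENNReal.ofReal C *
          ∫⁻ y in Ioo α (α + 4 * r) ×ˢ Ioo (-(γ / 2)) (γ / 2), energyDensity W v y) +
        ∫⁻ y in Ioo α (α + 4 * r) ×ˢ Ioo (-(γ / 2)) (γ / 2), ‖v y - y.1 • a‖ₑ := by
  set J := Ioo (-(γ / 2)) (γ / 2)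
  set S := Ioo α (α + 4 * r) ×ˢ J
  have hS : IsOpen S := isOpen_Ioo.prod isOpen_Ioo
  have hm1 : Measurable fun y => ‖qd f1 v y - a‖ₑ := ((measurable_qd f1 v).sub_const a).enorm
  have hm2 : Measurable fun y => ENNReal.ofReal (min ‖qd f1 v y - a‖ ‖qd f1 v y + a‖) :=
    (((measurable_qd f1 v).sub_const a).norm.min
      ((measurable_qd f1 v).add_const a).norm).ennreal_ofReal
  have hm3 : AEMeasurable (fun y : Pt2 => ‖v y - y.1 • a‖ₑ) (volume.restrict S) := by
    have : ContinuousOn (fun y : Pt2 => v y - y.1 • a) S :=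
      hv.continuousOn.sub (by fun_prop)
    exact (this.aemeasurable hS.measurableSet).enorm
  have hmin : ∫⁻ y in S, ENNReal.ofReal (min ‖qd f1 v y - a‖ ‖qd f1 v y + a‖) ≤
      ENNReal.ofReal (κ * (4 * r * γ)) + ENNReal.ofReal C * ∫⁻ y in S, energyDensity W v y := by
    have hvol : volume S = ENNReal.ofReal (4 * r * γ) := by
      rw [Measure.volume_eq_prod, Measure.prod_prod, Real.volume_Ioo, Real.volume_Ioo,
        ← ENNReal.ofReal_mul (by linarith)]
      congr 1; ring
    calc ∫⁻ y in S, ENNReal.ofReal (min ‖qd f1 v y - a‖ ‖qd f1 v y + a‖)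
        ≤ ∫⁻ y in S, (ENNReal.ofReal κ + ENNReal.ofReal C * energyDensity W v y) := by
          refine lintegral_mono fun y => ?_
          refine (ENNReal.ofReal_le_ofReal (hco (qd f1 v y) (qd f2 v y))).trans ?_
          rw [ENNReal.ofReal_add hκ.le (mul_nonneg hC.le (hW.nonneg _)),
            ENNReal.ofReal_mul hC.le]
          gcongr
          exact ENNReal.ofReal_le_ofReal (le_add_of_nonneg_right (hess2d_nonneg v y))
      _ = _ := by
          rw [lintegral_add_left measurable_const,
            lintegral_const_mul _ (measurable_energyDensity hWc v), setLIntegral_const, hvol,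
            ENNReal.ofReal_mul hκ.le]
  refine le_trans ?_ (add_le_add (mul_le_mul' (le_refl (2 * ENNReal.ofReal r)) hmin) le_rfl)
  rw [setLIntegral_prod_swap hm1.aemeasurable, setLIntegral_prod_swap hm2.aemeasurable,
    setLIntegral_prod_swap hm3]
  have hi1 : Measurable fun z => ∫⁻ x in Ioo (α + r) (α + 3 * r), ‖qd f1 v (x, z) - a‖ₑ :=
    hm1.lintegral_prod_left'
  have hi2 : Measurable fun z => ∫⁻ x in Ioo α (α + 4 * r),
      ENNReal.ofReal (min ‖qd f1 v (x, z) - a‖ ‖qd f1 v (x, z) + a‖) :=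
    hm2.lintegral_prod_left'
  rw [← lintegral_const_mul _ hi1, ← lintegral_const_mul _ hi2,
    ← lintegral_add_left (hi2.const_mul _)]
  refine setLIntegral_mono' measurableSet_Ioo fun z hz => ?_
  have hsl : ∀ t ∈ Ioo α (α + 4 * r), (t, z) ∈ S := fun t ht => ⟨ht, hz⟩
  refine lintegral_velocity_sub_le hr a (f := fun t => v (t, z)) (f' := fun t => qd f1 v (t, z))
    (fun t ht => hasDerivAt_slice_fst
      ((hv.differentiableOn two_ne_zero).differentiableAt (hS.mem_nhds (hsl t ht)))) ?_
  exact (continuousOn_qd hS (hv.of_le one_le_two) f1).comp (by fun_prop) hsl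

theorem exists_cell_mul_lintegral_le {γ α r : ℝ} (hr : 1 ≤ r) (f : Pt2 → ℝ≥0∞) :
    ∃ τ, α + r ≤ τ ∧ τ + 1 ≤ α + 3 * r ∧ ENNReal.ofReal r * ∫⁻ y in cell γ τ, f y ≤
      ∫⁻ y in Ioo (α + r) (α + 3 * r) ×ˢ Ioo (-(γ / 2)) (γ / 2), f y := by
  set n := ⌊2 * r⌋₊
  have hn1 : (n : ℝ) ≤ 2 * r := Nat.floor_le (by linarith)
  have hn2 : r ≤ n := by have := Nat.lt_floor_add_one (2 * r); linarith
  set τ : ℕ → ℝ := fun k => α + r + k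
  have hsub : ∀ k < n, τ k + 1 ≤ α + 3 * r := fun k hk => by
    have : (k : ℝ) + 1 ≤ n := by exact_mod_cast hk
    simp only [τ]; linarith
  have hdis : Pairwise (Function.onFun Disjoint fun k => cell γ (τ k)) := by
    intro i j hij
    refine Set.disjoint_left.2 fun y hi hj => hij ?_
    have h1 := hi.1
    have h2 := hj.1
    simp only [τ, mem_Ioo] at h1 h2
    have a1 : (i : ℝ) < j + 1 := by linarith
    have a2 : (j : ℝ) < i + 1 := by linarith
    have b1 : i < j + 1 := by exact_mod_cast a1
    have b2 : j < i + 1 := by exact_mod_cast a2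
    omega
  have hsum : ∑ k ∈ Finset.range n, ∫⁻ y in cell γ (τ k), f y ≤
      ∫⁻ y in Ioo (α + r) (α + 3 * r) ×ˢ Ioo (-(γ / 2)) (γ / 2), f y := by
    rw [← lintegral_biUnion_finset (hdis.set_pairwise _)
      (fun k _ => (isOpen_cell γ (τ k)).measurableSet)]
    refine lintegral_mono_set (Set.iUnion₂_subset fun k hk y hy => ⟨⟨?_, ?_⟩, hy.2⟩)
    · have := hy.1.1
      have hk0 : (0 : ℝ) ≤ k := k.cast_nonneg
      simp only [τ] at this; linarith
    · exact hy.1.2.trans_le (hsub k (Finset.mem_range.1 hk))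
  have hne : (Finset.range n).Nonempty := by
    rw [Finset.nonempty_range_iff]
    intro h
    rw [h] at hn2
    norm_num at hn2
    linarith
  obtain ⟨k, hk, hmin⟩ := Finset.exists_min_image (Finset.range n)
    (fun k => ∫⁻ y in cell γ (τ k), f y) hne
  refine ⟨τ k, by simp only [τ]; linarith [(k.cast_nonneg : (0 : ℝ) ≤ k)],
    hsub k (Finset.mem_range.1 hk), le_trans ?_ hsum⟩
  calc ENNReal.ofReal r * ∫⁻ y in cell γ (τ k), f y
      ≤ (n : ℝ≥0∞) * ∫⁻ y in cell γ (τ k), f y := by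
        gcongr
        rw [← ENNReal.ofReal_natCast]
        exact ENNReal.ofReal_le_ofReal hn2
    _ ≤ _ := by
        have := Finset.card_nsmul_le_sum (Finset.range n) _ _ hmin
        simpa using this

/-- A strip contains a cell on which the map has little energy and gradient close to the well. -/
theorem exists_cell_lintegral_wellDensity_le {W : M33 → ℝ} (hWc : Continuous W) {p : ℝ}
    {a b : V3} (hW : WellBounds W p a b) {γ : ℝ} (hγ : 0 < γ) {M σ : ℝ} (hM : 0 ≤ M)
    (hσ : 0 < σ) :
    ∃ κ > (0 : ℝ), κ ≤ 1 ∧ ∀ (α r : ℝ) (v : Pt2 → V3), 1 ≤ κ * r →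
      ContDiffOn ℝ 2 v (Ioo α (α + 4 * r) ×ˢ Ioo (-(γ / 2)) (γ / 2)) →
      ∫⁻ y in Ioo α (α + 4 * r) ×ˢ Ioo (-(γ / 2)) (γ / 2), energyDensity W v y
        ≤ ENNReal.ofReal M →
      ∫⁻ y in Ioo α (α + 4 * r) ×ˢ Ioo (-(γ / 2)) (γ / 2), ‖qd f2 v y - b‖ₑ
        ≤ ENNReal.ofReal (κ * r) →
      ∫⁻ y in Ioo α (α + 4 * r) ×ˢ Ioo (-(γ / 2)) (γ / 2), ‖v y - y.1 • a‖ₑ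
        ≤ ENNReal.ofReal (κ * r ^ 2) →
      ∃ τ, α + r ≤ τ ∧ τ + 1 ≤ α + 3 * r ∧
        ∫⁻ y in cell γ τ, wellDensity W a b v y ≤ ENNReal.ofReal σ := by
  obtain ⟨C, hC, hco⟩ := hW.coarse (σ / (32 * γ)) (by positivity)
  have hden : 0 < 2 * (1 + 2 * C) * M + 1 := by positivity
  refine ⟨min 1 (min (σ / 8) (σ / (2 * (1 + 2 * C) * M + 1))), by positivity, min_le_left _ _, ?_⟩
  intro α r v hr hv hE h2 h0
  set κ := min 1 (min (σ / 8) (σ / (2 * (1 + 2 * C) * M + 1)))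
  have hκ : 0 < κ := by positivity
  have k1 : κ ≤ 1 := min_le_left _ _
  have k2 : κ ≤ σ / 8 := (min_le_right _ _).trans (min_le_left _ _)
  have k3 : κ * (2 * (1 + 2 * C) * M + 1) ≤ σ :=
    (le_div_iff₀ hden).1 ((min_le_right _ _).trans (min_le_right _ _))
  have hr0 : 0 < r := by
    by_contra h
    nlinarith
  have hr1 : 1 ≤ r := hr.trans (by nlinarith)
  obtain ⟨τ, t1, t2, hτ⟩ := exists_cell_mul_lintegral_le (γ := γ) (α := α) hr1 (wellDensity W a b v)
  refine ⟨τ, t1, t2, ?_⟩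
  have hvel := lintegral_strip_velocity_le hWc hW (by positivity) hC hco hr0 hv
  set S := Ioo α (α + 4 * r) ×ˢ Ioo (-(γ / 2)) (γ / 2)
  set S' := Ioo (α + r) (α + 3 * r) ×ˢ Ioo (-(γ / 2)) (γ / 2)
  have hSS : S' ⊆ S := prod_mono (Ioo_subset_Ioo (by linarith) (by linarith)) le_rfl
  have hspl : ∫⁻ y in S', wellDensity W a b v y = (∫⁻ y in S', energyDensity W v y) +
      ((∫⁻ y in S', ‖qd f1 v y - a‖ₑ) + ∫⁻ y in S', ‖qd f2 v y - b‖ₑ) := by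
    unfold wellDensity
    rw [lintegral_add_left (measurable_energyDensity hWc v),
      lintegral_add_left (((measurable_qd f1 v).sub_const a).enorm)]
  have hE' := (lintegral_mono_set hSS).trans hE
  have h2' := (lintegral_mono_set hSS).trans h2
  have hfin : ENNReal.ofReal r * (ENNReal.ofReal r * ∫⁻ y in cell γ τ, wellDensity W a b v y) ≤
      ENNReal.ofReal r * (ENNReal.ofReal r * ENNReal.ofReal σ) := by
    calc _ ≤ ENNReal.ofReal r * ∫⁻ y in S', wellDensity W a b v y := by gcongr
      _ ≤ ENNReal.ofReal r * ENNReal.ofReal M + ((2 * ENNReal.ofReal r *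
            (ENNReal.ofReal (σ / (32 * γ) * (4 * r * γ)) + ENNReal.ofReal C * ENNReal.ofReal M) +
            ENNReal.ofReal (κ * r ^ 2)) + ENNReal.ofReal r * ENNReal.ofReal (κ * r)) := by
          rw [hspl, mul_add, mul_add]
          gcongr
          refine hvel.trans ?_
          gcongr
      _ = ENNReal.ofReal (r * M + ((2 * r * (σ / (32 * γ) * (4 * r * γ) + C * M) +
            κ * r ^ 2) + r * (κ * r))) := by
          rw [show (2 : ℝ≥0∞) = ENNReal.ofReal 2 by simp]
          rw [ENNReal.ofReal_add (by positivity) (by positivity),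
            ENNReal.ofReal_add (by positivity) (by positivity),
            ENNReal.ofReal_add (by positivity) (by positivity),
            ENNReal.ofReal_mul (p := 2 * r) (by positivity),
            ENNReal.ofReal_mul (p := 2) (by positivity),
            ENNReal.ofReal_add (by positivity) (by positivity),
            ENNReal.ofReal_mul (p := C) (by positivity),
            ENNReal.ofReal_mul (p := r) (q := M) (by positivity),
            ENNReal.ofReal_mul (p := r) (q := κ * r) (by positivity)]
      _ ≤ ENNReal.ofReal (r * (r * σ)) := by
          refine ENNReal.ofReal_le_ofReal ?_
          have i1 : σ / (32 * γ) * (4 * r * γ) = σ * r / 8 := by field_simp; norm_num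
          rw [i1]
          have i2 : κ * r ^ 2 ≤ σ / 8 * r ^ 2 := by gcongr
          have i3 : (2 * (1 + 2 * C) * M + 1) ≤ σ * r := by
            calc _ ≤ (κ * r) * (2 * (1 + 2 * C) * M + 1) := le_mul_of_one_le_left hden.le hr
              _ = r * (κ * (2 * (1 + 2 * C) * M + 1)) := by ring
              _ ≤ r * σ := by gcongr
              _ = _ := mul_comm _ _
          have i4 : r * (2 * (1 + 2 * C) * M + 1) ≤ r * (σ * r) := by gcongr
          nlinarith
      _ = _ := by
          rw [ENNReal.ofReal_mul hr0.le, ENNReal.ofReal_mul hr0.le]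
  have hne : ENNReal.ofReal r ≠ 0 := by simp [hr0]
  rwa [ENNReal.mul_le_mul_iff_right hne ofReal_ne_top,
    ENNReal.mul_le_mul_iff_right hne ofReal_ne_top] at hfin

theorem exists_cutoff : ∃ K : ℝ, 1 ≤ K ∧ ∀ τ : ℝ, ∃ φ : ℝ → ℝ, ContDiff ℝ 2 φ ∧
    (∀ t ≤ τ, φ =ᶠ[𝓝 t] fun _ => 0) ∧ (∀ t, τ + 1 ≤ t → φ =ᶠ[𝓝 t] fun _ => 1) ∧
    ∀ t ∈ Ioo τ (τ + 1), (0 ≤ φ t ∧ φ t ≤ 1) ∧ |deriv φ t| ≤ K ∧ |deriv (deriv φ) t| ≤ K := by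
  set ψ : ℝ → ℝ := fun t => Real.smoothTransition (2 * t - 1 / 2)
  have hψ : ContDiff ℝ 2 ψ := Real.smoothTransition.contDiff.comp (by fun_prop)
  have hψ1 : ContDiff ℝ 1 (deriv ψ) := ((contDiff_succ_iff_deriv (n := 1)).1 hψ).2.2
  have hψ2 : Continuous (deriv (deriv ψ)) :=
    (((contDiff_succ_iff_deriv (n := 0)).1 hψ1).2.2).continuous
  obtain ⟨K1, hK1⟩ := isCompact_Icc.exists_bound_of_continuousOn
    (hψ1.continuous.continuousOn (s := Icc (0 : ℝ) 1))
  obtain ⟨K2, hK2⟩ := isCompact_Icc.exists_bound_of_continuousOn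
    (hψ2.continuousOn (s := Icc (0 : ℝ) 1))
  refine ⟨max 1 (max K1 K2), le_max_left _ _, fun τ => ⟨fun t => ψ (t - τ), ?_, ?_, ?_, ?_⟩⟩
  · exact hψ.comp (by fun_prop)
  · intro t ht
    filter_upwards [Iio_mem_nhds (show t < τ + 1 / 4 by linarith)] with s hs
    exact Real.smoothTransition.zero_of_nonpos (by linarith [mem_Iio.1 hs])
  · intro t ht
    filter_upwards [Ioi_mem_nhds (show τ + 3 / 4 < t by linarith)] with s hs
    exact Real.smoothTransition.one_of_one_le (by linarith [mem_Ioi.1 hs])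
  · intro t ht
    have d1 : deriv (fun t => ψ (t - τ)) = fun t => deriv ψ (t - τ) :=
      funext fun s => deriv_comp_sub_const ..
    have d2 : deriv (fun t => deriv ψ (t - τ)) t = deriv (deriv ψ) (t - τ) :=
      deriv_comp_sub_const ..
    have hm : t - τ ∈ Icc (0 : ℝ) 1 := ⟨by linarith [ht.1], by linarith [ht.2]⟩
    refine ⟨⟨Real.smoothTransition.nonneg _, Real.smoothTransition.le_one _⟩, ?_, ?_⟩
    · rw [d1]
      exact (hK1 _ hm).trans ((le_max_left _ _).trans (le_max_right _ _))
    · rw [d1, d2]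
      exact (hK2 _ hm).trans ((le_max_right _ _).trans (le_max_right _ _))

theorem blend_eventuallyEq_of_one {φ : ℝ → ℝ} {y : Pt2} (h : φ =ᶠ[𝓝 y.1] fun _ => 1)
    (a b c : V3) (v : Pt2 → V3) : blend φ a b c v =ᶠ[𝓝 y] v := by
  filter_upwards [continuous_fst.continuousAt.eventually h] with z hz
  simp [blend, hz]

theorem blend_eventuallyEq_of_zero {φ : ℝ → ℝ} {y : Pt2} (h : φ =ᶠ[𝓝 y.1] fun _ => 0)
    (a b c : V3) (v : Pt2 → V3) : blend φ a b c v =ᶠ[𝓝 y] affineMap2 a b c := by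
  filter_upwards [continuous_fst.continuousAt.eventually h] with z hz
  simp [blend, hz]

/-- Interpolating to an affine map across a cell costs at most the well density on the cell. -/
theorem exists_lintegral_cut_le {W : M33 → ℝ} (hWc : Continuous W) {p : ℝ} (hp : 2 ≤ p)
    {a b : V3} (hW : WellBounds W p a b) {K γ : ℝ} (hK : 1 ≤ K) (hγ : 0 < γ) :
    ∃ C : ℝ≥0∞, C ≠ ∞ ∧ ∀ (τ : ℝ) (U : Set Pt2) (v : Pt2 → V3), MeasurableSet U →
      ContDiffOn ℝ 2 v (cell γ τ) → (∀ y ∈ U, y.1 ∈ Ioo τ (τ + 1) → y ∈ cell γ τ) →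
      ∃ c : V3, ∀ φ : ℝ → ℝ, ContDiff ℝ 2 φ → (∀ t ∈ Ioo τ (τ + 1),
        |φ t| ≤ 1 ∧ |deriv φ t| ≤ K ∧ |deriv (deriv φ) t| ≤ K) →
        (∀ t ∉ Ioo τ (τ + 1), (φ =ᶠ[𝓝 t] fun _ => 0) ∨ φ =ᶠ[𝓝 t] fun _ => 1) →
        ∫⁻ y in U, energyDensity W (blend φ a b c v) y ≤
          (∫⁻ y in U, energyDensity W v y) + C * ∫⁻ y in cell γ τ, wellDensity W a b v y := by
  obtain ⟨C, hC, h⟩ := exists_lintegral_blend_le hWc hp hW hK hγ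
  refine ⟨C, hC, fun τ U v hU hv hUc => ?_⟩
  obtain ⟨c, hc⟩ := h τ v hv
  refine ⟨c, fun φ hφ hb hloc => ?_⟩
  have hms := (isOpen_cell γ τ).measurableSet
  calc ∫⁻ y in U, energyDensity W (blend φ a b c v) y
      ≤ ∫⁻ y in U, (energyDensity W v y +
          (cell γ τ).indicator (energyDensity W (blend φ a b c v)) y) := by
        refine setLIntegral_mono' hU fun y hy => ?_
        by_cases hyt : y.1 ∈ Ioo τ (τ + 1)
        · rw [indicator_of_mem (hUc y hy hyt)]
          exact le_add_self
        · refine le_add_right ?_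
          rcases hloc _ hyt with h0 | h1
          · rw [energyDensity_congr (blend_eventuallyEq_of_zero h0 a b c v),
              energyDensity_affineMap2 hW.zero]
            exact zero_le
          · rw [energyDensity_congr (blend_eventuallyEq_of_one h1 a b c v)]
    _ = (∫⁻ y in U, energyDensity W v y) +
          ∫⁻ y in U, (cell γ τ).indicator (energyDensity W (blend φ a b c v)) y :=
        lintegral_add_left (measurable_energyDensity hWc v) _
    _ ≤ (∫⁻ y in U, energyDensity W v y) +
          ∫⁻ y in cell γ τ, energyDensity W (blend φ a b c v) y := by
        refine add_le_add le_rfl ((setLIntegral_le_lintegral _ _).trans_eq ?_)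
        rw [lintegral_indicator hms]
    _ ≤ _ := by gcongr; exact hc φ hφ hb

theorem exists_pos_mul_ofReal_le {C : ℝ≥0∞} (hC : C ≠ ∞) {η : ℝ} (hη : 0 < η) :
    ∃ σ > (0 : ℝ), C * ENNReal.ofReal σ ≤ ENNReal.ofReal η := by
  refine ⟨η / (C.toReal + 1), by positivity, ?_⟩
  rw [← ENNReal.ofReal_toReal hC, ← ENNReal.ofReal_mul toReal_nonneg,
    ENNReal.toReal_ofReal toReal_nonneg]
  refine ENNReal.ofReal_le_ofReal ?_
  rw [mul_div_assoc', div_le_iff₀ (by positivity)]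
  nlinarith [C.toReal_nonneg]

/-- A map on a long rectangle that is close to the reference profile can be modified into a
competitor for `Kgam` at the price of an arbitrarily small amount of energy. -/
theorem exists_Kgam_le {W : M33 → ℝ} (hWc : Continuous W) {p : ℝ} (hp : 2 ≤ p)
    {a b : V3} (hW : WellBounds W p a b) (hW' : WellBounds W p (-a) (-b)) {γ : ℝ} (hγ : 0 < γ)
    {M η : ℝ} (hM : 0 ≤ M) (hη : 0 < η) :
    ∃ κ > (0 : ℝ), ∀ (R : ℝ) (v : Pt2 → V3), 1 ≤ κ * R → ContDiffOn ℝ 2 v (Rect R γ) →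
      ∫⁻ y in Rect R γ, energyDensity W v y ≤ ENNReal.ofReal M →
      ∫⁻ y in Rect R γ, ‖qd f2 v y - bb0 b y.1‖ₑ ≤ ENNReal.ofReal (κ * R) →
      ∫⁻ y in Rect R γ, ‖v y - ub0 a y.1‖ₑ ≤ ENNReal.ofReal (κ * R ^ 2) →
      Kgam W a b γ ≤ ENNReal.ofReal γ⁻¹ *
        ((∫⁻ y in Rect R γ, energyDensity W v y) + ENNReal.ofReal η) := by
  obtain ⟨K, hK, hcut⟩ := exists_cutoff
  obtain ⟨C, hC, hR⟩ := exists_lintegral_cut_le hWc hp hW hK hγ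
  obtain ⟨C', hC', hL⟩ := exists_lintegral_cut_le hWc hp hW' hK hγ
  obtain ⟨σ, hσ, hCσ⟩ := exists_pos_mul_ofReal_le hC (half_pos hη)
  obtain ⟨σ', hσ', hCσ'⟩ := exists_pos_mul_ofReal_le hC' (half_pos hη)
  obtain ⟨κ₁, hκ₁, hκ₁1, hsR⟩ := exists_cell_lintegral_wellDensity_le hWc hW hγ hM hσ
  obtain ⟨κ₂, hκ₂, hκ₂1, hsL⟩ := exists_cell_lintegral_wellDensity_le hWc hW' hγ hM hσ'
  refine ⟨min κ₁ κ₂ / 64, by positivity, fun R v hκR hv hE h2 h0 => ?_⟩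
  set κ := min κ₁ κ₂ / 64
  have hκ : 0 < κ := by positivity
  have m1 : κ ≤ κ₁ / 64 := div_le_div_of_nonneg_right (min_le_left _ _) (by norm_num)
  have m2 : κ ≤ κ₂ / 64 := div_le_div_of_nonneg_right (min_le_right _ _) (by norm_num)
  have hRpos : 0 < R := by
    by_contra h
    nlinarith
  obtain ⟨r, rfl⟩ : ∃ r, R = 8 * r := ⟨R / 8, by ring⟩
  have hr : 0 < r := by linarith
  set J := Ioo (-(γ / 2)) (γ / 2)
  have hopen : IsOpen (Rect (8 * r) γ) := isOpen_Ioo.prod isOpen_Ioo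
  have subR : Ioo 0 (0 + 4 * r) ×ˢ J ⊆ Rect (8 * r) γ :=
    prod_mono (Ioo_subset_Ioo (by linarith) (by linarith)) le_rfl
  have subL : Ioo (-(4 * r)) (-(4 * r) + 4 * r) ×ˢ J ⊆ Rect (8 * r) γ :=
    prod_mono (Ioo_subset_Ioo (by linarith) (by linarith)) le_rfl
  obtain ⟨τ, t1, t2, hτ⟩ := hsR 0 r v (by nlinarith) (hv.mono subR)
    ((lintegral_mono_set subR).trans hE)
    (by
      refine le_trans ?_ (h2.trans (ENNReal.ofReal_le_ofReal (by nlinarith)))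
      refine le_trans (setLIntegral_congr_fun (measurableSet_Ioo.prod measurableSet_Ioo)
        fun y hy => ?_).le (lintegral_mono_set subR)
      simp only [bb0, if_pos hy.1.1.le])
    (by
      refine le_trans ?_ (h0.trans (ENNReal.ofReal_le_ofReal (by nlinarith [sq_nonneg r])))
      refine le_trans (setLIntegral_congr_fun (measurableSet_Ioo.prod measurableSet_Ioo)
        fun y hy => ?_).le (lintegral_mono_set subR)
      simp only [ub0, abs_of_pos hy.1.1])
  obtain ⟨τ', t1', t2', hτ'⟩ := hsL (-(4 * r)) r v (by nlinarith) (hv.mono subL)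
    ((lintegral_mono_set subL).trans hE)
    (by
      refine le_trans ?_ (h2.trans (ENNReal.ofReal_le_ofReal (by nlinarith)))
      refine le_trans (setLIntegral_congr_fun (measurableSet_Ioo.prod measurableSet_Ioo)
        fun y hy => ?_).le (lintegral_mono_set subL)
      have : y.1 < 0 := by linarith [hy.1.2]
      simp only [bb0, if_neg this.not_ge])
    (by
      refine le_trans ?_ (h0.trans (ENNReal.ofReal_le_ofReal (by nlinarith [sq_nonneg r])))
      refine le_trans (setLIntegral_congr_fun (measurableSet_Ioo.prod measurableSet_Ioo)
        fun y hy => ?_).le (lintegral_mono_set subL)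
      have : y.1 < 0 := by linarith [hy.1.2]
      simp only [ub0, abs_of_neg this, neg_smul, smul_neg])
  have cellR : cell γ τ ⊆ Rect (8 * r) γ :=
    prod_mono (Ioo_subset_Ioo (by linarith) (by linarith)) le_rfl
  have cellL : cell γ τ' ⊆ Rect (8 * r) γ :=
    prod_mono (Ioo_subset_Ioo (by linarith) (by linarith)) le_rfl
  obtain ⟨ψ, hψ, hψ0, hψ1, hψb⟩ := hcut τ
  obtain ⟨φ', hφ', hφ'0, hφ'1, hφ'b⟩ := hcut τ'
  set φ : ℝ → ℝ := fun t => 1 - ψ t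
  have hφ : ContDiff ℝ 2 φ := contDiff_const.sub hψ
  have hφ0 : ∀ t, τ + 1 ≤ t → φ =ᶠ[𝓝 t] fun _ => 0 := fun t ht => by
    filter_upwards [hψ1 t ht] with s hs
    simp [φ, hs]
  have hφ1 : ∀ t ≤ τ, φ =ᶠ[𝓝 t] fun _ => 1 := fun t ht => by
    filter_upwards [hψ0 t ht] with s hs
    simp [φ, hs]
  have hφb : ∀ t ∈ Ioo τ (τ + 1), |φ t| ≤ 1 ∧ |deriv φ t| ≤ K ∧ |deriv (deriv φ) t| ≤ K := by
    intro t ht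
    obtain ⟨⟨h1, h2⟩, h3, h4⟩ := hψb t ht
    have d1 : deriv φ = fun t => -deriv ψ t := funext fun s => deriv_const_sub _
    have d2 : deriv (deriv φ) t = -deriv (deriv ψ) t := by rw [d1]; exact deriv.fun_neg
    rw [d2, d1, abs_neg, abs_neg]
    exact ⟨abs_le.2 ⟨by simp only [φ]; linarith, by simp only [φ]; linarith⟩, h3, h4⟩
  obtain ⟨c, hc⟩ := hR τ (Rect (8 * r) γ) v hopen.measurableSet (hv.mono cellR)
    fun y hy hy1 => ⟨hy1, hy.2⟩
  have hE1 := hc φ hφ hφb fun t ht => by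
    rcases le_or_gt t τ with h | h
    · exact Or.inr (hφ1 t h)
    · exact Or.inl (hφ0 t (not_lt.1 fun h' => ht ⟨h, h'⟩))
  set v₁ := blend φ a b c v
  have hv₁ : ContDiffOn ℝ 2 v₁ (Rect (8 * r) γ) := contDiffOn_blend hφ hv a b c
  obtain ⟨c', hc'⟩ := hL τ' (Rect (8 * r) γ) v₁ hopen.measurableSet (hv₁.mono cellL)
    fun y hy hy1 => ⟨hy1, hy.2⟩
  have hE2 := hc' φ' hφ'
    (fun t ht => ⟨abs_le.2 ⟨by linarith [(hφ'b t ht).1.1], (hφ'b t ht).1.2⟩, (hφ'b t ht).2⟩)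
    fun t ht => by
      rcases le_or_gt t τ' with h | h
      · exact Or.inl (hφ'0 t h)
      · exact Or.inr (hφ'1 t (not_lt.1 fun h' => ht ⟨h, h'⟩))
  have hwell : ∫⁻ y in cell γ τ', wellDensity W (-a) (-b) v₁ y =
      ∫⁻ y in cell γ τ', wellDensity W (-a) (-b) v y := by
    refine setLIntegral_congr_fun (isOpen_cell γ τ').measurableSet fun y hy => ?_
    have hev := blend_eventuallyEq_of_one (hφ1 y.1 (by linarith [hy.1.2])) a b c v
    simp only [wellDensity]
    rw [energyDensity_congr hev, qd_congr hev, qd_congr hev]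
  unfold Kgam
  refine sInf_le_of_le ⟨8 * r, hRpos, blend φ' (-a) (-b) c' v₁, contDiffOn_blend hφ' hv₁ _ _ _,
    ⟨r, hr, fun y hy hy1 => ?_⟩, ⟨r, hr, fun y hy hy1 => ?_⟩, rfl⟩ ?_
  · have hev := (blend_eventuallyEq_of_one (hφ'1 y.1 (by linarith)) (-a) (-b) c' v₁).trans
      (blend_eventuallyEq_of_zero (hφ0 y.1 (by linarith)) a b c v)
    rw [qd_congr hev, qd_congr hev, qd_affineMap2, qd_affineMap2]
    simp [f1, f2]
  · have hev := blend_eventuallyEq_of_zero (hφ'0 y.1 (by linarith)) (-a) (-b) c' v₁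
    rw [qd_congr hev, qd_congr hev, qd_affineMap2, qd_affineMap2]
    simp [f1, f2]
  · gcongr
    calc ∫⁻ y in Rect (8 * r) γ, energyDensity W (blend φ' (-a) (-b) c' v₁) y
        ≤ (∫⁻ y in Rect (8 * r) γ, energyDensity W v y) + C * ENNReal.ofReal σ +
            C' * ENNReal.ofReal σ' := by
          refine hE2.trans ?_
          rw [hwell]
          gcongr
          refine hE1.trans ?_
          gcongr
      _ ≤ (∫⁻ y in Rect (8 * r) γ, energyDensity W v y) + ENNReal.ofReal (η / 2) +
            ENNReal.ofReal (η / 2) := by gcongr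
      _ = _ := by
          rw [add_assoc, ← ENNReal.ofReal_add (by positivity) (by positivity), add_halves]

theorem measurable_pd (e : Pt) (u : Pt → V3) : Measurable (pd e u) :=
  measurable_fderiv_apply_const ℝ u e

theorem hessh_nonneg (h : ℝ) (u : Pt → V3) (x : Pt) : 0 ≤ hessh h u x := by
  unfold hessh; positivity

/-- The integrand of `F`. -/
noncomputable def thinDensity (W : M33 → ℝ) (h ε : ℝ) (u : Pt → V3) (x : Pt) : ℝ≥0∞ :=
  ENNReal.ofReal (ε⁻¹ * W (gradh h u x) + ε * hessh h u x)

theorem measurable_thinDensity {W : M33 → ℝ} (hW : Continuous W) (h ε : ℝ) (u : Pt → V3) :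
    Measurable (thinDensity W h ε u) := by
  have h1 : Measurable (gradh h u) := by
    refine measurable_pi_lambda _ fun j => ?_
    fin_cases j
    · exact measurable_pd e1 u
    · exact measurable_pd e2 u
    · exact (measurable_pd e3 u).const_smul h⁻¹
  have h2 : ∀ e e' : Pt, Measurable fun y => vnorm (pd e (pd e' u) y) ^ 2 := fun e e' =>
    (continuous_vnorm.measurable.comp (measurable_pd _ _)).pow_const 2
  have h3 : Measurable (hessh h u) := by
    unfold hessh
    exact (((((h2 _ _).add (h2 _ _)).add ((h2 _ _).const_mul _)).add ((h2 _ _).const_mul _)).add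
      ((h2 _ _).const_mul _)).add ((h2 _ _).const_mul _)
  exact (((hW.measurable.comp h1).const_mul _).add (h3.const_mul _)).ennreal_ofReal

theorem thinDensity_le {W : M33 → ℝ} (h0 : ∀ ξ, 0 ≤ W ξ) {h ε δ q : ℝ} (hq : 0 ≤ q)
    (h1 : δ⁻¹ ≤ q * ε⁻¹) (h2 : δ ≤ q * ε) (u : Pt → V3) (x : Pt) :
    thinDensity W h δ u x ≤ ENNReal.ofReal q * thinDensity W h ε u x := by
  unfold thinDensity
  rw [← ENNReal.ofReal_mul hq]
  refine ENNReal.ofReal_le_ofReal ?_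
  have a1 := mul_le_mul_of_nonneg_right h1 (h0 (gradh h u x))
  have a2 := mul_le_mul_of_nonneg_right h2 (hessh_nonneg h u x)
  linarith

/-- The anisotropic scaling sending the long rectangle to a slice of the cube. -/
noncomputable def sliceMap (δ γ s : ℝ) (y : Pt2) : Pt := (δ * y.1, s, γ⁻¹ * y.2)

/-- Blow-up of a slice of `u`. -/
noncomputable def blowup (δ γ s : ℝ) (u : Pt → V3) (y : Pt2) : V3 := δ⁻¹ • u (sliceMap δ γ s y)

theorem hasFDerivAt_sliceMap (δ γ s : ℝ) (y : Pt2) :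
    HasFDerivAt (sliceMap δ γ s) ((δ • ContinuousLinearMap.fst ℝ ℝ ℝ).prod
      ((0 : Pt2 →L[ℝ] ℝ).prod (γ⁻¹ • ContinuousLinearMap.snd ℝ ℝ ℝ))) y :=
  (hasFDerivAt_fst.const_mul δ).prodMk
    ((hasFDerivAt_const s y).prodMk (hasFDerivAt_snd.const_mul γ⁻¹))

theorem qd_comp_sliceMap {δ γ s : ℝ} {u : Pt → V3} {y : Pt2}
    (hu : DifferentiableAt ℝ u (sliceMap δ γ s y)) :
    qd f1 (fun z => u (sliceMap δ γ s z)) y = δ • pd e1 u (sliceMap δ γ s y) ∧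
    qd f2 (fun z => u (sliceMap δ γ s z)) y = γ⁻¹ • pd e3 u (sliceMap δ γ s y) := by
  have h := (hu.hasFDerivAt.comp y (hasFDerivAt_sliceMap δ γ s y)).fderiv
  have h' : fderiv ℝ (fun z => u (sliceMap δ γ s z)) y = _ := h
  have s1 : ((δ, 0, 0) : Pt) = δ • e1 := by simp [e1]
  have s2 : ((0, 0, γ⁻¹) : Pt) = γ⁻¹ • e3 := by simp [e3]
  simp only [qd, pd, h']
  constructor
  · simp [f1, s1]
  · simp [f2, s2]

theorem qd_const_smul {e : Pt2} {v : Pt2 → V3} {y : Pt2} (hv : DifferentiableAt ℝ v y) (r : ℝ) :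
    qd e (fun z => r • v z) y = r • qd e v y := by
  rw [qd, fderiv_fun_const_smul hv]
  rfl

theorem differentiableAt_pd {U : Set Pt} (hU : IsOpen U) {u : Pt → V3}
    (hu : ContDiffOn ℝ 2 u U) (e : Pt) {x : Pt} (hx : x ∈ U) :
    DifferentiableAt ℝ (pd e u) x := by
  have h : ContDiffOn ℝ 1 (fderiv ℝ u) U := hu.fderiv_of_isOpen hU (by norm_num [one_add_one_eq_two])
  exact ((h.differentiableOn one_ne_zero).differentiableAt (hU.mem_nhds hx)).clm_apply
    (differentiableAt_const e)

section Blowup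

variable {δ γ s : ℝ} (hδ : 0 < δ) (hγ : 0 < γ) (hs : s ∈ II) {u : Pt → V3}
  (hu : ContDiffOn ℝ 2 u (Jrho II 1))

theorem isOpen_Jrho : IsOpen (Jrho II 1) := isOpen_Ioo.prod (isOpen_Ioo.prod isOpen_Ioo)

include hδ hγ hs

theorem sliceMap_mem {y : Pt2} (hy : y ∈ Rect δ⁻¹ γ) : sliceMap δ γ s y ∈ Jrho II 1 := by
  obtain ⟨⟨a1, a2⟩, a3, a4⟩ := hy
  have i1 := mul_lt_mul_of_pos_left a1 hδ
  have i2 := mul_lt_mul_of_pos_left a2 hδ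
  have i3 := mul_lt_mul_of_pos_left a3 (inv_pos.2 hγ)
  have i4 := mul_lt_mul_of_pos_left a4 (inv_pos.2 hγ)
  have j1 : δ * (δ⁻¹ / 2) = 1 / 2 := by field_simp
  have j2 : γ⁻¹ * (γ / 2) = 1 / 2 := by field_simp
  rw [mul_neg, j1] at i1
  rw [j1] at i2
  rw [mul_neg, j2] at i3
  rw [j2] at i4
  exact ⟨⟨i1, i2⟩, hs, ⟨i3, i4⟩⟩

include hu

theorem contDiffOn_blowup : ContDiffOn ℝ 2 (blowup δ γ s u) (Rect δ⁻¹ γ) := by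
  have h1 : ContDiff ℝ 2 (sliceMap δ γ s) := by unfold sliceMap; fun_prop
  exact (hu.comp h1.contDiffOn fun y hy => sliceMap_mem hδ hγ hs hy).const_smul δ⁻¹

theorem qd_blowup {y : Pt2} (hy : y ∈ Rect δ⁻¹ γ) :
    qd f1 (blowup δ γ s u) y = pd e1 u (sliceMap δ γ s y) ∧
    qd f2 (blowup δ γ s u) y = (δ * γ)⁻¹ • pd e3 u (sliceMap δ γ s y) := by
  have hd := (hu.differentiableOn two_ne_zero).differentiableAt
    (isOpen_Jrho.mem_nhds (sliceMap_mem hδ hγ hs hy))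
  have hd' : DifferentiableAt ℝ (fun z => u (sliceMap δ γ s z)) y :=
    hd.comp y (hasFDerivAt_sliceMap δ γ s y).differentiableAt
  obtain ⟨h1, h2⟩ := qd_comp_sliceMap hd
  unfold blowup
  rw [qd_const_smul hd', qd_const_smul hd', h1, h2, smul_smul, smul_smul, inv_mul_cancel₀ hδ.ne',
    one_smul, mul_inv]
  exact ⟨rfl, rfl⟩

theorem energyDensity_blowup_le {W : M33 → ℝ} (h4 : H4 W) {y : Pt2} (hy : y ∈ Rect δ⁻¹ γ) :
    energyDensity W (blowup δ γ s u) y ≤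
      ENNReal.ofReal δ * thinDensity W (δ * γ) δ u (sliceMap δ γ s y) := by
  have hop : IsOpen (Rect δ⁻¹ γ) := isOpen_Ioo.prod isOpen_Ioo
  set x := sliceMap δ γ s y
  have hx : x ∈ Jrho II 1 := sliceMap_mem hδ hγ hs hy
  have ev1 : qd f1 (blowup δ γ s u) =ᶠ[𝓝 y] fun z => pd e1 u (sliceMap δ γ s z) := by
    filter_upwards [hop.mem_nhds hy] with z hz using (qd_blowup hδ hγ hs hu hz).1
  have ev2 : qd f2 (blowup δ γ s u) =ᶠ[𝓝 y]
      fun z => (δ * γ)⁻¹ • pd e3 u (sliceMap δ γ s z) := by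
    filter_upwards [hop.mem_nhds hy] with z hz using (qd_blowup hδ hγ hs hu hz).2
  have hd1 := differentiableAt_pd isOpen_Jrho hu e1 hx
  have hd3 := differentiableAt_pd isOpen_Jrho hu e3 hx
  have hd3' : DifferentiableAt ℝ (fun z => pd e3 u (sliceMap δ γ s z)) y :=
    DifferentiableAt.comp (f := sliceMap δ γ s) y hd3
      (hasFDerivAt_sliceMap δ γ s y).differentiableAt
  have s1 := qd_comp_sliceMap hd1
  have s3 := qd_comp_sliceMap hd3
  have q11 : qd f1 (qd f1 (blowup δ γ s u)) y = δ • pd e1 (pd e1 u) x :=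
    (qd_congr ev1).trans s1.1
  have q21 : qd f2 (qd f1 (blowup δ γ s u)) y = γ⁻¹ • pd e3 (pd e1 u) x :=
    (qd_congr ev1).trans s1.2
  have q22 : qd f2 (qd f2 (blowup δ γ s u)) y = ((δ * γ)⁻¹ * γ⁻¹) • pd e3 (pd e3 u) x := by
    rw [qd_congr ev2, qd_const_smul hd3', s3.2, smul_smul]
  have hWle : W2 W (blowup δ γ s u) y ≤ W (gradh (δ * γ) u x) := by
    have := h4 (gradh (δ * γ) u x)
    rw [W2, (qd_blowup hδ hγ hs hu hy).1, (qd_blowup hδ hγ hs hu hy).2]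
    exact this
  have hHle : hess2d (blowup δ γ s u) y ≤ δ ^ 2 * hessh (δ * γ) u x := by
    rw [hess2d, q11, q21, q22, vnorm_sq_smul, vnorm_sq_smul, vnorm_sq_smul, hessh]
    have c1 : δ ^ 2 * ((δ * γ)⁻¹) ^ 2 = γ⁻¹ ^ 2 := by field_simp
    have c2 : δ ^ 2 * ((δ * γ)⁻¹) ^ 4 = ((δ * γ)⁻¹ * γ⁻¹) ^ 2 := by field_simp
    rw [← c1, ← c2]
    have n1 : 0 ≤ δ ^ 2 * vnorm (pd e2 (pd e2 u) x) ^ 2 := by positivity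
    have n2 : 0 ≤ δ ^ 2 * vnorm (pd e2 (pd e1 u) x) ^ 2 := by positivity
    have n3 : 0 ≤ δ ^ 2 * ((δ * γ)⁻¹ ^ 2 * vnorm (pd e3 (pd e2 u) x) ^ 2) := by positivity
    linarith
  unfold energyDensity thinDensity
  rw [← ENNReal.ofReal_mul hδ.le]
  refine ENNReal.ofReal_le_ofReal ?_
  rw [mul_add, ← mul_assoc, ← mul_assoc, mul_inv_cancel₀ hδ.ne', one_mul, ← sq]
  exact add_le_add hWle hHle

end Blowup

theorem lintegral_comp_sliceMap {δ γ : ℝ} (hδ : 0 < δ) (hγ : 0 < γ) (s : ℝ) (f : Pt → ℝ≥0∞) :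
    ∫⁻ y in Rect δ⁻¹ γ, f (sliceMap δ γ s y) =
      ENNReal.ofReal (γ / δ) * ∫⁻ z in II ×ˢ II, f (z.1, s, z.2) := by
  set e : ℝ × ℝ ≃ₜ ℝ × ℝ := (Homeomorph.mulLeft₀ δ hδ.ne').prodCongr
    (Homeomorph.mulLeft₀ γ⁻¹ (inv_ne_zero hγ.ne'))
  have hmap : Measure.map e (volume : Measure (ℝ × ℝ)) = ENNReal.ofReal (γ / δ) • volume := by
    have h1 : Measure.map (fun t : ℝ => δ * t) volume = ENNReal.ofReal δ⁻¹ • volume := by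
      rw [Real.map_volume_mul_left hδ.ne', abs_of_pos (inv_pos.2 hδ)]
    have h2 : Measure.map (fun t : ℝ => γ⁻¹ * t) volume = ENNReal.ofReal γ • volume := by
      rw [Real.map_volume_mul_left (inv_ne_zero hγ.ne'), inv_inv, abs_of_pos hγ]
    have h3 := Measure.map_prod_map (volume : Measure ℝ) (volume : Measure ℝ)
      (measurable_const_mul δ) (measurable_const_mul γ⁻¹)
    rw [h1, h2, Measure.prod_smul_left, Measure.prod_smul_right, smul_smul,
      ← ENNReal.ofReal_mul (inv_nonneg.2 hδ.le), ← Measure.volume_eq_prod] at h3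
    rw [div_eq_inv_mul]
    exact h3.symm
  have hmp : MeasurePreserving e volume (ENNReal.ofReal (γ / δ) • volume) :=
    ⟨e.continuous.measurable, hmap⟩
  have hpre : e ⁻¹' (II ×ˢ II) = Rect δ⁻¹ γ := by
    ext y
    have j1 : ∀ t : ℝ, δ * t ∈ II ↔ t ∈ Ioo (-(δ⁻¹ / 2)) (δ⁻¹ / 2) := fun t => by
      simp only [II, mem_Ioo]
      rw [show -(δ⁻¹ / 2) = -(1 / 2) / δ by field_simp, show δ⁻¹ / 2 = 1 / 2 / δ by field_simp,
        div_lt_iff₀' hδ, lt_div_iff₀' hδ]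
    have j2 : ∀ t : ℝ, γ⁻¹ * t ∈ II ↔ t ∈ Ioo (-(γ / 2)) (γ / 2) := fun t => by
      simp only [II, mem_Ioo]
      rw [inv_mul_eq_div, lt_div_iff₀' hγ, div_lt_iff₀' hγ, show γ * -(1 / 2) = -(γ / 2) by ring,
        show γ * (1 / 2) = γ / 2 by ring]
    exact and_congr (j1 y.1) (j2 y.2)
  have h := hmp.setLIntegral_comp_preimage_emb e.measurableEmbedding
    (fun z => f (z.1, s, z.2)) (II ×ˢ II)
  rw [hpre, Measure.restrict_smul, lintegral_smul_measure] at h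
  exact h

/-- Some slice of a function on the cube has at most the mean integral. -/
theorem exists_slice_lintegral_le {f : Pt → ℝ≥0∞} (hf : Measurable f) :
    ∃ s ∈ II, ∫⁻ z in II ×ˢ II, f (z.1, s, z.2) ≤ ∫⁻ x in Jrho II 1, f x := by
  have hfub : ∫⁻ x in Jrho II 1, f x = ∫⁻ s in II, ∫⁻ z in II ×ˢ II, f (z.1, s, z.2) := by
    have hJ : Jrho II 1 = II ×ˢ (II ×ˢ II) := rfl
    rw [hJ, Measure.volume_eq_prod, ← Measure.prod_restrict, lintegral_prod _ hf.aemeasurable,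
      Measure.volume_eq_prod, ← Measure.prod_restrict]
    have e1 : ∀ x : ℝ, ∫⁻ y, f (x, y) ∂((volume.restrict II).prod (volume.restrict II)) =
        ∫⁻ s in II, ∫⁻ t in II, f (x, s, t) := fun x =>
      lintegral_prod _ (hf.comp measurable_prodMk_left).aemeasurable
    have e2 : ∀ s : ℝ, ∫⁻ z, f (z.1, s, z.2) ∂((volume.restrict II).prod (volume.restrict II)) =
        ∫⁻ x in II, ∫⁻ t in II, f (x, s, t) := fun s =>
      lintegral_prod _ (hf.comp (by fun_prop)).aemeasurable
    simp only [e1, e2]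
    refine lintegral_lintegral_swap (f := fun x s => ∫⁻ t in II, f (x, s, t)) ?_
    have : Measurable fun q : (ℝ × ℝ) × ℝ => f (q.1.1, q.1.2, q.2) := hf.comp (by fun_prop)
    exact this.lintegral_prod_right'.aemeasurable
  have hm : Measurable fun s : ℝ => ∫⁻ z in II ×ˢ II, f (z.1, s, z.2) := by
    have : Measurable fun q : ℝ × (ℝ × ℝ) => f (q.2.1, q.1, q.2.2) := hf.comp (by fun_prop)
    exact this.lintegral_prod_right'
  obtain ⟨s, hs, hle⟩ := exists_mul_le_setLIntegral_Ioo (α := -(1 / 2 : ℝ)) (β := 1 / 2)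
    (by norm_num) hm.aemeasurable
  refine ⟨s, hs, ?_⟩
  rw [hfub]
  norm_num at hle
  convert hle using 2
  norm_num [II]

theorem enorm_le_ofReal_vnorm (v : V3) : ‖v‖ₑ ≤ ENNReal.ofReal (vnorm v) := by
  rw [← ofReal_norm]
  exact ENNReal.ofReal_le_ofReal (norm_le_vnorm v)

theorem le_ofReal_of_mul_le {x : ℝ≥0∞} {T E : ℝ} (hT : 0 < T)
    (h : ENNReal.ofReal T * x ≤ ENNReal.ofReal E) : x ≤ ENNReal.ofReal (T⁻¹ * E) := by
  calc x = ENNReal.ofReal T⁻¹ * (ENNReal.ofReal T * x) := by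
        rw [← mul_assoc, ← ENNReal.ofReal_mul (inv_nonneg.2 hT.le), inv_mul_cancel₀ hT.ne',
          ENNReal.ofReal_one, one_mul]
    _ ≤ ENNReal.ofReal T⁻¹ * ENNReal.ofReal E := by gcongr
    _ = _ := (ENNReal.ofReal_mul (inv_nonneg.2 hT.le)).symm

/-- The blow-up of a good slice of a map `u` on the cube is almost a competitor for `Kgam`. -/
theorem Kgam_le_of_thinDensity_le {W : M33 → ℝ} (hWc : Continuous W) (h4 : H4 W) {a b : V3}
    {γ : ℝ} (hγ : 0 < γ) {E η κ : ℝ} (hE : 0 < E) (hη : 0 < η) (hκ : 0 < κ)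
    (hrect : ∀ (R : ℝ) (v : Pt2 → V3), 1 ≤ κ * R → ContDiffOn ℝ 2 v (Rect R γ) →
      ∫⁻ y in Rect R γ, energyDensity W v y ≤ ENNReal.ofReal (γ * E) →
      ∫⁻ y in Rect R γ, ‖qd f2 v y - bb0 b y.1‖ₑ ≤ ENNReal.ofReal (κ * R) →
      ∫⁻ y in Rect R γ, ‖v y - ub0 a y.1‖ₑ ≤ ENNReal.ofReal (κ * R ^ 2) →
      Kgam W a b γ ≤ ENNReal.ofReal γ⁻¹ *
        ((∫⁻ y in Rect R γ, energyDensity W v y) + ENNReal.ofReal η))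
    {δ : ℝ} (hδ : 0 < δ) (hδκ : δ ≤ κ) {u : Pt → V3} (hu : ContDiffOn ℝ 2 u (Jrho II 1))
    (hle : (∫⁻ x in Jrho II 1, thinDensity W (δ * γ) δ u x) + ENNReal.ofReal (γ * E / κ) *
      ((∫⁻ x in Jrho II 1, ‖u x - u0 a x‖ₑ) +
        ∫⁻ x in Jrho II 1, ‖(δ * γ)⁻¹ • pd e3 u x - b0 b x‖ₑ) ≤ ENNReal.ofReal E) :
    Kgam W a b γ ≤ ENNReal.ofReal (E + γ⁻¹ * η) := by
  classical
  set T := γ * E / κ with hTdef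
  have hT : 0 < T := by positivity
  have hJ : MeasurableSet (Jrho II 1) := isOpen_Jrho.measurableSet
  set w : Pt → V3 := (Jrho II 1).piecewise u 0
  have hw : Measurable w := hu.continuousOn.measurable_piecewise continuousOn_const hJ
  have hu0 : Measurable (u0 a) := by
    have : Continuous (u0 a) := by unfold u0 ub0; fun_prop
    exact this.measurable
  have hb0 : Measurable (b0 b) :=
    Measurable.ite (measurableSet_le measurable_const measurable_fst) measurable_const
      measurable_const
  have hmt := measurable_thinDensity hWc (δ * γ) δ u
  have hm1 : Measurable fun x => ‖w x - u0 a x‖ₑ := (hw.sub hu0).enorm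
  have hm2 : Measurable fun x => ‖(δ * γ)⁻¹ • pd e3 u x - b0 b x‖ₑ :=
    (((measurable_pd e3 u).const_smul (δ * γ)⁻¹).sub hb0).enorm
  have hm12 : Measurable fun x =>
      ‖w x - u0 a x‖ₑ + ‖(δ * γ)⁻¹ • pd e3 u x - b0 b x‖ₑ := hm1.add hm2
  obtain ⟨s, hs, hsle⟩ := exists_slice_lintegral_le
    (hmt.add (hm12.const_mul (ENNReal.ofReal T)))
  simp only [Pi.add_apply] at hsle
  have hmap : Measurable fun z : ℝ × ℝ => ((z.1, s, z.2) : Pt) := by fun_prop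
  have hst : Measurable fun z : ℝ × ℝ => thinDensity W (δ * γ) δ u (z.1, s, z.2) :=
    hmt.comp hmap
  have hs1 : Measurable fun z : ℝ × ℝ => ‖w (z.1, s, z.2) - u0 a (z.1, s, z.2)‖ₑ :=
    hm1.comp hmap
  rw [lintegral_add_left hmt, lintegral_const_mul' _ _ ofReal_ne_top, lintegral_add_left hm1,
    lintegral_add_left hst, lintegral_const_mul' _ _ ofReal_ne_top,
    lintegral_add_left hs1] at hsle
  have hwu : ∫⁻ x in Jrho II 1, ‖w x - u0 a x‖ₑ = ∫⁻ x in Jrho II 1, ‖u x - u0 a x‖ₑ :=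
    setLIntegral_congr_fun hJ fun x hx => by simp only [w, piecewise_eq_of_mem _ _ _ hx]
  rw [hwu] at hsle
  have htot := hsle.trans hle
  have ht := le_self_add.trans htot
  have hd := le_add_self.trans htot
  have hd1 := le_ofReal_of_mul_le hT ((mul_le_mul' le_rfl le_self_add).trans hd)
  have hd2 := le_ofReal_of_mul_le hT ((mul_le_mul' le_rfl le_add_self).trans hd)
  have hTE : γ * (T⁻¹ * E) = κ := by
    rw [hTdef]; field_simp
  have hRm : MeasurableSet (Rect δ⁻¹ γ) := (isOpen_Ioo.prod isOpen_Ioo).measurableSet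
  have hen : ∫⁻ y in Rect δ⁻¹ γ, energyDensity W (blowup δ γ s u) y ≤
      ENNReal.ofReal (γ * E) := by
    calc ∫⁻ y in Rect δ⁻¹ γ, energyDensity W (blowup δ γ s u) y
        ≤ ∫⁻ y in Rect δ⁻¹ γ, ENNReal.ofReal δ *
            thinDensity W (δ * γ) δ u (sliceMap δ γ s y) :=
          setLIntegral_mono' hRm fun y hy => energyDensity_blowup_le hδ hγ hs hu h4 hy
      _ = ENNReal.ofReal δ * (ENNReal.ofReal (γ / δ) *
            ∫⁻ z in II ×ˢ II, thinDensity W (δ * γ) δ u (z.1, s, z.2)) := by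
          rw [lintegral_const_mul' _ _ ofReal_ne_top, lintegral_comp_sliceMap hδ hγ s]
      _ ≤ ENNReal.ofReal δ * (ENNReal.ofReal (γ / δ) * ENNReal.ofReal E) := by gcongr
      _ = _ := by
          rw [← ENNReal.ofReal_mul (by positivity), ← ENNReal.ofReal_mul hδ.le]
          congr 1; field_simp
  refine (hrect δ⁻¹ (blowup δ γ s u) ?_ (contDiffOn_blowup hδ hγ hs hu) hen ?_ ?_).trans ?_
  · rw [← div_eq_mul_inv, one_le_div hδ]
    exact hδκ
  · calc ∫⁻ y in Rect δ⁻¹ γ, ‖qd f2 (blowup δ γ s u) y - bb0 b y.1‖ₑ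
        = ∫⁻ y in Rect δ⁻¹ γ, ‖(δ * γ)⁻¹ • pd e3 u (sliceMap δ γ s y) -
            b0 b (sliceMap δ γ s y)‖ₑ := by
          refine setLIntegral_congr_fun hRm fun y hy => ?_
          have hsgn : 0 ≤ δ * y.1 ↔ 0 ≤ y.1 := mul_nonneg_iff_of_pos_left hδ
          simp only [(qd_blowup hδ hγ hs hu hy).2, b0, bb0, sliceMap, hsgn]
      _ = ENNReal.ofReal (γ / δ) *
            ∫⁻ z in II ×ˢ II, ‖(δ * γ)⁻¹ • pd e3 u (z.1, s, z.2) - b0 b (z.1, s, z.2)‖ₑ :=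
          lintegral_comp_sliceMap hδ hγ s (fun x => ‖(δ * γ)⁻¹ • pd e3 u x - b0 b x‖ₑ)
      _ ≤ ENNReal.ofReal (γ / δ) * ENNReal.ofReal (T⁻¹ * E) := mul_le_mul' le_rfl hd2
      _ = _ := by
          rw [← ENNReal.ofReal_mul (by positivity), ← hTE]
          congr 1; ring
  · calc ∫⁻ y in Rect δ⁻¹ γ, ‖blowup δ γ s u y - ub0 a y.1‖ₑ
        = ∫⁻ y in Rect δ⁻¹ γ, ENNReal.ofReal δ⁻¹ *
            ‖w (sliceMap δ γ s y) - u0 a (sliceMap δ γ s y)‖ₑ := by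
          refine setLIntegral_congr_fun hRm fun y hy => ?_
          have hmem := sliceMap_mem hδ hγ hs hy
          have hwx : w (sliceMap δ γ s y) = u (sliceMap δ γ s y) := piecewise_eq_of_mem _ _ _ hmem
          have hsc : ub0 a y.1 = δ⁻¹ • u0 a (sliceMap δ γ s y) := by
            simp only [u0, ub0, sliceMap, abs_mul, abs_of_pos hδ, smul_smul]
            congr 1; field_simp
          simp only [hwx, hsc, blowup]
          rw [← smul_sub, enorm_smul, Real.enorm_of_nonneg (inv_nonneg.2 hδ.le)]
      _ = ENNReal.ofReal δ⁻¹ * (ENNReal.ofReal (γ / δ) *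
            ∫⁻ z in II ×ˢ II, ‖w (z.1, s, z.2) - u0 a (z.1, s, z.2)‖ₑ) := by
          rw [lintegral_const_mul' _ _ ofReal_ne_top,
            lintegral_comp_sliceMap hδ hγ s (fun x => ‖w x - u0 a x‖ₑ)]
      _ ≤ ENNReal.ofReal δ⁻¹ * (ENNReal.ofReal (γ / δ) * ENNReal.ofReal (T⁻¹ * E)) :=
          mul_le_mul' le_rfl (mul_le_mul' le_rfl hd1)
      _ = _ := by
          rw [← ENNReal.ofReal_mul (by positivity), ← ENNReal.ofReal_mul (by positivity), ← hTE]
          congr 1; ring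
  · calc ENNReal.ofReal γ⁻¹ * ((∫⁻ y in Rect δ⁻¹ γ, energyDensity W (blowup δ γ s u) y) +
          ENNReal.ofReal η)
        ≤ ENNReal.ofReal γ⁻¹ * (ENNReal.ofReal (γ * E) + ENNReal.ofReal η) := by gcongr
      _ = _ := by
          rw [← ENNReal.ofReal_add (by positivity) hη.le,
            ← ENNReal.ofReal_mul (inv_nonneg.2 hγ.le)]
          congr 1; field_simp

/-- Lower bound for a recovery sequence, up to an arbitrarily small error. -/
theorem Kgam_le_of_liminf {W : M33 → ℝ} (hWc : Continuous W) (h4 : H4 W) {p : ℝ} (hp : 2 ≤ p)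
    {a b : V3} (hW : WellBounds W p a b) (hW' : WellBounds W p (-a) (-b)) {γ : ℝ} (hγ : 0 < γ)
    {h ε : ℕ → ℝ} {u : ℕ → Pt → V3} (hh : ∀ n, 0 < h n) (hε : ∀ n, 0 < ε n)
    (hh0 : Tendsto h atTop (𝓝 0)) (hhε : Tendsto (fun n => h n / ε n) atTop (𝓝 γ))
    (hu : ∀ n, ContDiffOn ℝ 2 (u n) (Jrho II 1)) (hu0 : TendsL1 (Jrho II 1) u (u0 a))
    (hub : TendsL1 (Jrho II 1) (fun n x => (h n)⁻¹ • pd e3 (u n) x) (b0 b))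
    {ℓ : ℝ} (hℓ : 0 ≤ ℓ)
    (hlim : liminf (fun n => F W (h n) (ε n) (u n) (Jrho II 1)) atTop ≤ ENNReal.ofReal ℓ)
    {η : ℝ} (hη : 0 < η) :
    Kgam W a b γ ≤ ENNReal.ofReal ((1 + η) * (ℓ + η) + η + γ⁻¹ * η) := by
  set E := (1 + η) * (ℓ + η) + η
  have hE : 0 < E := by positivity
  obtain ⟨κ, hκ, hrect⟩ := exists_Kgam_le hWc hp hW hW' hγ (mul_pos hγ hE).le hη
  have hfreq : ∃ᶠ n in atTop, F W (h n) (ε n) (u n) (Jrho II 1) < ENNReal.ofReal (ℓ + η) :=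
    frequently_lt_of_liminf_lt (by isBoundedDefault) (hlim.trans_lt
      ((ENNReal.ofReal_lt_ofReal_iff (by linarith)).2 (by linarith)))
  have hT : ENNReal.ofReal (γ * E / κ) ≠ ∞ := ofReal_ne_top
  have hsmall : ∀ᶠ n in atTop, ENNReal.ofReal (γ * E / κ) *
      ((∫⁻ x in Jrho II 1, ENNReal.ofReal (vnorm (u n x - u0 a x))) +
        ∫⁻ x in Jrho II 1, ENNReal.ofReal (vnorm ((h n)⁻¹ • pd e3 (u n) x - b0 b x))) <
          ENNReal.ofReal η := by
    have h1 := ENNReal.Tendsto.const_mul (hu0.add hub) (Or.inr hT)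
    rw [add_zero, mul_zero] at h1
    exact h1.eventually_lt_const (by simpa using hη)
  have hlo : ∀ᶠ n in atTop, γ / (1 + η) < h n / ε n :=
    hhε.eventually_const_lt (by rw [div_lt_iff₀ (by positivity)]; nlinarith)
  have hhi : ∀ᶠ n in atTop, h n / ε n < γ * (1 + η) :=
    hhε.eventually_lt_const (by nlinarith)
  have hhκ : ∀ᶠ n in atTop, h n < κ * γ := hh0.eventually_lt_const (by positivity)
  obtain ⟨n, hF, hn, hlo, hhi, hhκ⟩ :=
    (hfreq.and_eventually (hsmall.and (hlo.and (hhi.and hhκ)))).exists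
  have hhn := hh n
  have hεn := hε n
  have hδγ : h n / γ * γ = h n := div_mul_cancel₀ _ hγ.ne'
  refine Kgam_le_of_thinDensity_le hWc h4 hγ hE hη hκ hrect (δ := h n / γ) (by positivity)
    ((div_le_iff₀ hγ).2 hhκ.le) (hu n) ?_
  rw [hδγ]
  have hth : ∫⁻ x in Jrho II 1, thinDensity W (h n) (h n / γ) (u n) x ≤
      ENNReal.ofReal ((1 + η) * (ℓ + η)) := by
    rw [ENNReal.ofReal_mul (by positivity)]
    refine le_trans ?_ (mul_le_mul' le_rfl hF.le)
    rw [F, ← lintegral_const_mul' _ _ ofReal_ne_top]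
    refine lintegral_mono fun x => thinDensity_le hW.nonneg (by positivity) ?_ ?_ (u n) x
    · rw [div_lt_div_iff₀ (by positivity) hεn] at hlo
      rw [inv_div, ← div_eq_mul_inv, div_le_div_iff₀ hhn hεn]
      linarith
    · rw [div_lt_iff₀ hεn] at hhi
      rw [div_le_iff₀ hγ]
      linarith
  rw [ENNReal.ofReal_add (by positivity) hη.le]
  refine add_le_add hth (le_trans ?_ hn.le)
  gcongr <;> exact enorm_le_ofReal_vnorm _

/-- Corollary 4.8: K*_γ ≥ K_γ. -/
theorem statement10 (p : ℝ) (hp : 2 ≤ p) (A B : M33) (W : M33 → ℝ) (a : V3)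
    (hWc : Continuous W) (h1 : H1 W A B) (h2 : H2 W p) (h3 : H3 W A B p) (h4 : H4 W)
    (hwells : Wells A B a) (γ : ℝ) (hγ : 0 < γ) :
    Kgam W a (A 2) γ ≤ Kstar W a (A 2) γ := by
  obtain ⟨h0, hz, -, -⟩ := h1
  obtain ⟨hAB, hA0, hA1⟩ := hwells
  have hA : A = ![a, 0, A 2] := by
    funext j
    fin_cases j
    · exact hA0
    · exact hA1
    · rfl
  have hB : B = ![-a, 0, -A 2] := by
    rw [← neg_eq_iff_eq_neg.2 hAB]
    funext j
    fin_cases j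
    · simp [hA0]
    · simp [hA1]
    · rfl
  set b := A 2
  rw [hA, hB] at hz h3
  have hW : WellBounds W p a b := wellBounds_of_hypotheses hp hWc h0 hz h2 h3
  have hW' : WellBounds W p (-a) (-b) := by
    refine wellBounds_of_hypotheses hp hWc h0 (fun ξ => ?_) h2 ?_
    · rw [hz, neg_neg, neg_neg, or_comm]
    · rw [neg_neg, neg_neg]
      simpa only [H3, mdist, min_comm] using h3
  refine le_sInf ?_
  rintro L ⟨h, ε, u, hh, hε, hh0, -, hhε, hu, hu0, hub, rfl⟩
  set L := liminf (fun n => F W (h n) (ε n) (u n) (Jrho II 1)) atTop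
  rcases eq_or_ne L ∞ with hL | hL
  · rw [hL]; exact le_top
  have hlim : Tendsto (fun η : ℝ => ENNReal.ofReal
      ((1 + η) * (L.toReal + η) + η + γ⁻¹ * η)) (𝓝[>] 0) (𝓝 L) := by
    have hc : Continuous fun η : ℝ => ENNReal.ofReal
        ((1 + η) * (L.toReal + η) + η + γ⁻¹ * η) :=
      ENNReal.continuous_ofReal.comp (by fun_prop)
    have := hc.tendsto 0
    simp only [add_zero, mul_zero, one_mul, ENNReal.ofReal_toReal hL] at this
    exact this.mono_left nhdsWithin_le_nhds
  refine ge_of_tendsto hlim ?_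
  filter_upwards [self_mem_nhdsWithin] with η hη
  exact Kgam_le_of_liminf hWc h4 hp hW hW' hγ hh hε hh0 hhε hu hu0 hub toReal_nonneg
    (ENNReal.ofReal_toReal hL).ge hη
end

section
/- (Lemma 6.1.) Assume W is continuous and satisfies (H1), (H2), (H3), and that the wells are the supercritical wells A = −B = a ⊗ (e₁ + λe₃) for some a ∈ ℝ³∖{0} and λ ∈ ℝ. Then 0 < K*_∞ < ∞. -/
open MeasureTheory Filter Topology ENNReal NNReal Set

/-! ### Elementary facts on the norms -/

theorem vnorm_nonneg (v : V3) : 0 ≤ vnorm v := Real.sqrt_nonneg _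

theorem vnorm_sq (v : V3) : vnorm v ^ 2 = ∑ i, v i ^ 2 :=
  Real.sq_sqrt (Finset.sum_nonneg fun _ _ => sq_nonneg _)

theorem vnorm_smul (c : ℝ) (v : V3) : vnorm (c • v) = |c| * vnorm v := by
  unfold vnorm
  rw [← Real.sqrt_sq_eq_abs, ← Real.sqrt_mul (sq_nonneg c), Finset.mul_sum]
  simp [mul_pow]

theorem vnorm_sq_pos {a : V3} (ha : a ≠ 0) : 0 < vnorm a ^ 2 := by
  rw [vnorm_sq]
  obtain ⟨i, hi⟩ := Function.ne_iff.1 ha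
  exact Finset.sum_pos' (fun _ _ => sq_nonneg _) ⟨i, Finset.mem_univ _, sq_pos_of_ne_zero hi⟩

theorem vnorm_pos {a : V3} (ha : a ≠ 0) : 0 < vnorm a :=
  lt_of_le_of_ne (vnorm_nonneg a) fun h0 => by simpa [← h0] using vnorm_sq_pos ha

theorem mnorm_nonneg (ξ : M33) : 0 ≤ mnorm ξ := Real.sqrt_nonneg _

theorem mnorm_smul (c : ℝ) (ξ : M33) : mnorm (c • ξ) = |c| * mnorm ξ := by
  unfold mnorm
  rw [← Real.sqrt_sq_eq_abs, ← Real.sqrt_mul (sq_nonneg c), Finset.mul_sum]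
  simp [mul_pow, Finset.mul_sum]

/-- The coordinate `v ↦ (a · v) / |a|²` of a vector along `a`. -/
noncomputable def coord (a : V3) : V3 →L[ℝ] ℝ :=
  ∑ i, (a i / vnorm a ^ 2) • ContinuousLinearMap.proj (R := ℝ) (φ := fun _ : Fin 3 => ℝ) i

theorem coord_apply (a v : V3) : coord a v = (∑ i, a i * v i) / vnorm a ^ 2 := by
  simp [coord, Finset.sum_div, div_mul_eq_mul_div]

theorem coord_self {a : V3} (ha : a ≠ 0) : coord a a = 1 := by
  rw [coord_apply, div_eq_one_iff_eq (vnorm_sq_pos ha).ne', vnorm_sq]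
  simp [sq]

theorem sq_mul_sq_coord_le {a : V3} (ha : a ≠ 0) (v : V3) :
    vnorm a ^ 2 * coord a v ^ 2 ≤ vnorm v ^ 2 := by
  have h := Finset.sum_mul_sq_le_sq_mul_sq Finset.univ a v
  rw [← vnorm_sq, ← vnorm_sq] at h
  have hp := vnorm_sq_pos ha
  rw [coord_apply, div_pow, mul_div_assoc', div_le_iff₀ (by positivity)]
  nlinarith

/-! ### The cube -/

theorem isOpen_II : IsOpen II := isOpen_Ioo

theorem measurableSet_II : MeasurableSet II := measurableSet_Ioo

theorem volume_II : volume II = 1 := by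
  unfold II; rw [Real.volume_Ioo]; norm_num

theorem isOpen_Q3 : IsOpen Q3 := isOpen_II.prod (isOpen_II.prod isOpen_II)

theorem measurableSet_Q3 : MeasurableSet Q3 := isOpen_Q3.measurableSet

theorem volume_IIxII : volume (II ×ˢ II) = 1 := by
  rw [Measure.volume_eq_prod, Measure.prod_prod, volume_II, one_mul]

theorem volume_Q3 : volume Q3 = 1 := by
  unfold Q3
  rw [Measure.volume_eq_prod, Measure.prod_prod, volume_II, volume_IIxII, one_mul]

theorem restrict_Q3 : (volume : Measure Pt).restrict Q3 =
    (volume.restrict II).prod ((volume : Measure (ℝ × ℝ)).restrict (II ×ˢ II)) := by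
  unfold Q3
  rw [Measure.prod_restrict]; rfl

/-- Tonelli's theorem on the cube, integrating first in the direction `e1`. -/
theorem lintegral_Q3 {f : Pt → ℝ≥0∞} (hf : AEMeasurable f (volume.restrict Q3)) :
    ∫⁻ x in Q3, f x = ∫⁻ y in II ×ˢ II, ∫⁻ t in II, f (t, y) := by
  rw [restrict_Q3] at hf ⊢
  exact lintegral_prod_symm f hf

/-! ### Positivity: lower bound on one-dimensional slices -/

/-- A continuous bump supported in `[-1/2, 1/2]`. -/
noncomputable def bump (s : ℝ) : ℝ := max 0 (1 - 2 * |s|)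

theorem bump_nonneg (s : ℝ) : 0 ≤ bump s := le_max_left _ _

theorem bump_le_one (s : ℝ) : bump s ≤ 1 := by
  unfold bump; exact max_le zero_le_one (by linarith [abs_nonneg s])

theorem continuous_bump : Continuous bump := by
  unfold bump; fun_prop

/-- The mass of `bump`. -/
noncomputable def bumpMass : ℝ := ∫ s in (-(1 / 2) : ℝ)..(1 / 2), bump s

theorem bumpMass_pos : 0 < bumpMass := by
  refine intervalIntegral.intervalIntegral_pos_of_pos_on
    (continuous_bump.intervalIntegrable _ _) (fun x hx => ?_) (by norm_num)
  refine lt_max_of_lt_right ?_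
  have : |x| < 1 / 2 := abs_lt.2 ⟨by linarith [hx.1], hx.2⟩
  linarith

theorem exists_mul_sq_bump_le {p : ℝ} (hp : 2 ≤ p) {A B : M33} {W : M33 → ℝ} {a : V3}
    (ha : a ≠ 0) (hWc : Continuous W) (h1 : H1 W A B) (h2 : H2 W p) (hAB : A = -B)
    (hA0 : A 0 = a) : ∃ c > 0, ∀ ξ, c * bump (coord a (ξ 0)) ^ 2 ≤ W ξ := by
  obtain ⟨hW0, hWz, -, -⟩ := h1
  obtain ⟨C, hC, hCW⟩ := h2
  set R : ℝ := max 1 (C * (1 + C)) with hR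
  have hout : ∀ ξ : M33, ξ ∉ Metric.closedBall (0 : M33) R → 1 ≤ W ξ := by
    intro ξ hξ
    rw [mem_closedBall_zero_iff, not_le] at hξ
    have hm := hξ.trans_le (norm_le_mnorm ξ)
    have h1m : 1 ≤ mnorm ξ := (le_max_left _ _).trans hm.le
    have hpow : mnorm ξ ≤ mnorm ξ ^ p := by
      simpa using Real.rpow_le_rpow_of_exponent_le h1m (show (1 : ℝ) ≤ p by linarith)
    have hK : C * (1 + C) ≤ mnorm ξ ^ p := ((le_max_right _ _).trans hm.le).trans hpow
    have := (hCW ξ).1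
    have h3 : 1 + C ≤ C⁻¹ * mnorm ξ ^ p := by
      rw [inv_mul_eq_div, le_div_iff₀ hC]; linarith
    linarith
  let S : Set M33 := {ξ | |coord a (ξ 0)| ≤ 1 / 2} ∩ Metric.closedBall 0 R
  have hcl : IsClosed {ξ : M33 | |coord a (ξ 0)| ≤ 1 / 2} := isClosed_le (by fun_prop) (by fun_prop)
  have hS : IsCompact S := (isCompact_closedBall 0 R).inter_left hcl
  have h0 : (0 : M33) ∈ S := by
    refine ⟨by simp, ?_⟩
    rw [mem_closedBall_zero_iff, norm_zero, hR]; positivity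
  obtain ⟨ξ₀, hξ₀, hmin⟩ := hS.exists_isMinOn ⟨0, h0⟩ hWc.continuousOn
  have hpos : 0 < W ξ₀ := by
    refine lt_of_le_of_ne (hW0 _) fun h => ?_
    have hs : |coord a (ξ₀ 0)| ≤ 1 / 2 := hξ₀.1
    rcases (hWz ξ₀).1 h.symm with rfl | rfl
    · rw [hA0, coord_self ha] at hs; norm_num at hs
    · have : ξ₀ 0 = -a := by rw [← hA0, hAB]; simp
      rw [this, map_neg, coord_self ha] at hs; norm_num at hs
  refine ⟨min 1 (W ξ₀), lt_min one_pos hpos, fun ξ => ?_⟩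
  have hb1 : bump (coord a (ξ 0)) ^ 2 ≤ 1 := pow_le_one₀ (bump_nonneg _) (bump_le_one _)
  have hc0 : 0 < min 1 (W ξ₀) := lt_min one_pos hpos
  by_cases hs : |coord a (ξ 0)| ≤ 1 / 2
  · have : min 1 (W ξ₀) ≤ W ξ := by
      by_cases hξ : ξ ∈ Metric.closedBall (0 : M33) R
      · exact (min_le_right _ _).trans (hmin ⟨hs, hξ⟩)
      · exact (min_le_left _ _).trans (hout ξ hξ)
    nlinarith
  · have : bump (coord a (ξ 0)) = 0 := max_eq_left (by linarith [not_le.1 hs])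
    rw [this]; simpa using hW0 ξ

/-- A function with small integral is small somewhere in every subinterval of length `1/8`. -/
theorem exists_small_of_lintegral_le {g : ℝ → ℝ}
    (hg : ∫⁻ t in II, ENNReal.ofReal (g t) ≤ ENNReal.ofReal (1 / 256)) {l : ℝ}
    (hl : Ioo l (l + 1 / 8) ⊆ II) : ∃ t ∈ Ioo l (l + 1 / 8), g t ≤ 1 / 16 := by
  by_contra! h
  have h1 : ∫⁻ _ in Ioo l (l + 1 / 8), ENNReal.ofReal (1 / 16)
      ≤ ∫⁻ t in Ioo l (l + 1 / 8), ENNReal.ofReal (g t) :=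
    setLIntegral_mono' measurableSet_Ioo fun t ht => ENNReal.ofReal_le_ofReal (h t ht).le
  have h2 := (h1.trans (lintegral_mono_set hl)).trans hg
  rw [setLIntegral_const, Real.volume_Ioo, ← ENNReal.ofReal_mul (by norm_num),
    ENNReal.ofReal_le_ofReal_iff (by norm_num)] at h2
  norm_num at h2

/-- A `C¹` function close to `|t|` in `L¹` has slopes beyond `±1/2`. -/
theorem exists_slopes {v s : ℝ → ℝ} (hv : ∀ t ∈ II, HasDerivAt v (s t) t)
    (hint : ∫⁻ t in II, ENNReal.ofReal |v t - (|t|)| ≤ ENNReal.ofReal (1 / 256)) :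
    ∃ t₁ ∈ II, ∃ t₂ ∈ II, t₁ ≤ t₂ ∧ s t₁ ≤ -(1 / 2) ∧ 1 / 2 ≤ s t₂ := by
  have hsub : ∀ l : ℝ, -(1 / 2) ≤ l → l ≤ 3 / 8 → Ioo l (l + 1 / 8) ⊆ II := fun l h1 h2 =>
    Ioo_subset_Ioo h1 (by linarith)
  have hmv : ∀ l r : ℝ, l ∈ II → r ∈ II → l < r →
      ∃ c ∈ Ioo l r, s c = (v r - v l) / (r - l) := by
    intro l r hl hr hlr
    have hI : Icc l r ⊆ II := fun t ht => ⟨hl.1.trans_le ht.1, ht.2.trans_lt hr.2⟩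
    exact exists_hasDerivAt_eq_slope v s hlr
      (fun t ht => (hv t (hI ht)).continuousAt.continuousWithinAt)
      (fun t ht => hv t (hI (Ioo_subset_Icc_self ht)))
  obtain ⟨q₁, hq₁, g₁⟩ := exists_small_of_lintegral_le hint
    (hsub (-(1 / 2)) (by norm_num) (by norm_num))
  obtain ⟨q₂, hq₂, g₂⟩ := exists_small_of_lintegral_le hint
    (hsub (-(1 / 8)) (by norm_num) (by norm_num))
  obtain ⟨q₃, hq₃, g₃⟩ := exists_small_of_lintegral_le hint (hsub 0 (by norm_num) (by norm_num))
  obtain ⟨q₄, hq₄, g₄⟩ := exists_small_of_lintegral_le hint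
    (hsub (3 / 8) (by norm_num) (by norm_num))
  obtain ⟨c₁, hc₁, e₁⟩ := hmv q₁ q₂ (hsub _ (by norm_num) (by norm_num) hq₁)
    (hsub _ (by norm_num) (by norm_num) hq₂) (by linarith [hq₁.2, hq₂.1])
  obtain ⟨c₂, hc₂, e₂⟩ := hmv q₃ q₄ (hsub _ (by norm_num) (by norm_num) hq₃)
    (hsub _ (by norm_num) (by norm_num) hq₄) (by linarith [hq₃.2, hq₄.1])
  simp only [mem_Ioo] at hq₁ hq₂ hq₃ hq₄ hc₁ hc₂
  rw [abs_of_neg (show q₁ < 0 by linarith), abs_le] at g₁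
  rw [abs_of_nonpos (show q₂ ≤ 0 by linarith), abs_le] at g₂
  rw [abs_of_pos (show 0 < q₃ by linarith), abs_le] at g₃
  rw [abs_of_pos (show 0 < q₄ by linarith), abs_le] at g₄
  refine ⟨c₁, ⟨by linarith, by linarith⟩, c₂, ⟨by linarith, by linarith⟩, by linarith, ?_, ?_⟩
  · rw [e₁, div_le_iff₀ (by linarith)]; linarith
  · rw [e₂, le_div_iff₀ (by linarith)]; linarith

theorem bumpMass_le_lintegral {s s' : ℝ → ℝ} (hs : ∀ t ∈ II, HasDerivAt s (s' t) t)
    (hs' : ContinuousOn s' II) {t₁ t₂ : ℝ} (ht₁ : t₁ ∈ II) (ht₂ : t₂ ∈ II) (ht : t₁ ≤ t₂)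
    (h₁ : s t₁ ≤ -(1 / 2)) (h₂ : 1 / 2 ≤ s t₂) :
    ENNReal.ofReal bumpMass ≤ ∫⁻ t in II, ENNReal.ofReal (bump (s t) * |s' t|) := by
  have hI : Icc t₁ t₂ ⊆ II := fun t ht => ⟨ht₁.1.trans_le ht.1, ht.2.trans_lt ht₂.2⟩
  have hu : uIcc t₁ t₂ = Icc t₁ t₂ := uIcc_of_le ht
  have hsc : ContinuousOn s (Icc t₁ t₂) := fun t ht =>
    (hs t (hI ht)).continuousAt.continuousWithinAt
  have hcv : ∫ t in t₁..t₂, (bump ∘ s) t * s' t = ∫ x in s t₁..s t₂, bump x :=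
    intervalIntegral.integral_comp_mul_deriv (fun t ht => hs t (hI (hu ▸ ht)))
      (hs'.mono (hu ▸ hI)) continuous_bump
  have hmono : bumpMass ≤ ∫ x in s t₁..s t₂, bump x :=
    intervalIntegral.integral_mono_interval h₁ (by norm_num) h₂
      (Eventually.of_forall bump_nonneg) (continuous_bump.intervalIntegrable _ _)
  have hc1 : ContinuousOn (fun t => (bump ∘ s) t * s' t) (Icc t₁ t₂) :=
    (continuous_bump.comp_continuousOn hsc).mul (hs'.mono hI)
  have hc2 : ContinuousOn (fun t => bump (s t) * |s' t|) (Icc t₁ t₂) :=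
    (continuous_bump.comp_continuousOn hsc).mul (hs'.mono hI).abs
  have hle : ∫ t in t₁..t₂, (bump ∘ s) t * s' t ≤ ∫ t in t₁..t₂, bump (s t) * |s' t| :=
    intervalIntegral.integral_mono_on ht (hc1.intervalIntegrable_of_Icc ht)
      (hc2.intervalIntegrable_of_Icc ht)
      fun t _ => mul_le_mul_of_nonneg_left (le_abs_self _) (bump_nonneg _)
  calc ENNReal.ofReal bumpMass
      ≤ ENNReal.ofReal (∫ t in t₁..t₂, bump (s t) * |s' t|) :=
        ENNReal.ofReal_le_ofReal (by linarith)
    _ = ∫⁻ t in Ioc t₁ t₂, ENNReal.ofReal (bump (s t) * |s' t|) := by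
        rw [intervalIntegral.integral_of_le ht, ofReal_integral_eq_lintegral_ofReal]
        · exact (hc2.integrableOn_Icc).mono_set Ioc_subset_Icc_self
        · exact Eventually.of_forall fun t => mul_nonneg (bump_nonneg _) (abs_nonneg _)
    _ ≤ _ := lintegral_mono_set (Ioc_subset_Icc_self.trans hI)

theorem contDiffOn_pd {u : Pt → V3} {n m : WithTop ℕ∞} (hu : ContDiffOn ℝ n u Q3)
    (hmn : m + 1 ≤ n) (e : Pt) : ContDiffOn ℝ m (pd e u) Q3 :=
  (hu.fderiv_of_isOpen isOpen_Q3 hmn).clm_apply contDiffOn_const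

theorem hasDerivAt_slice {u : Pt → V3} (hu : ContDiffOn ℝ 1 u Q3) {y : ℝ × ℝ}
    (hy : y ∈ II ×ˢ II) {t : ℝ} (ht : t ∈ II) :
    HasDerivAt (fun r : ℝ => u (r, y)) (pd e1 u (t, y)) t := by
  have hd : DifferentiableAt ℝ u (t, y) :=
    (hu.differentiableOn (by norm_num)).differentiableAt (isOpen_Q3.mem_nhds ⟨ht, hy⟩)
  have hl : HasDerivAt (fun r : ℝ => ((r, y) : Pt)) e1 t := by
    exact (hasDerivAt_id t).prodMk (hasDerivAt_const t y)
  exact hd.hasFDerivAt.comp_hasDerivAt t hl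

theorem continuousOn_slice {E : Type*} [TopologicalSpace E] {f : Pt → E} (hf : ContinuousOn f Q3)
    {y : ℝ × ℝ} (hy : y ∈ II ×ˢ II) : ContinuousOn (fun t : ℝ => f (t, y)) II :=
  hf.comp (by fun_prop) fun _ ht => ⟨ht, hy⟩

/-- Modica–Mortola lower bound for the energy density. -/
theorem mul_bump_le_energy {W : M33 → ℝ} {a : V3} (ha : a ≠ 0) {c : ℝ} (hc : 0 < c)
    (hcW : ∀ ξ, c * bump (coord a (ξ 0)) ^ 2 ≤ W ξ) {h ε : ℝ} (hε : 0 < ε)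
    (u : Pt → V3) (x : Pt) :
    2 * (√c * vnorm a) * (bump (coord a (pd e1 u x)) * |coord a (pd e1 (pd e1 u) x)|) ≤
      ε⁻¹ * W (gradh h u x) + ε * hessh h u x := by
  have hW : c * bump (coord a (pd e1 u x)) ^ 2 ≤ W (gradh h u x) := hcW (gradh h u x)
  have hH : vnorm a ^ 2 * coord a (pd e1 (pd e1 u) x) ^ 2 ≤ hessh h u x := by
    refine (sq_mul_sq_coord_le ha _).trans ?_
    unfold hessh
    have h4 : 0 ≤ h⁻¹ ^ 4 := by positivity
    nlinarith [sq_nonneg (vnorm (pd e2 (pd e2 u) x)), sq_nonneg (vnorm (pd e2 (pd e1 u) x)),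
      mul_nonneg h4 (sq_nonneg (vnorm (pd e3 (pd e3 u) x))),
      mul_nonneg (sq_nonneg h⁻¹) (sq_nonneg (vnorm (pd e3 (pd e1 u) x))),
      mul_nonneg (sq_nonneg h⁻¹) (sq_nonneg (vnorm (pd e3 (pd e2 u) x)))]
  set b := bump (coord a (pd e1 u x))
  set d := coord a (pd e1 (pd e1 u) x)
  have h1 : ε⁻¹ * (c * b ^ 2) + ε * (vnorm a ^ 2 * d ^ 2) ≤
      ε⁻¹ * W (gradh h u x) + ε * hessh h u x := by gcongr
  refine le_trans ?_ h1
  have hs : √c ^ 2 = c := Real.sq_sqrt hc.le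
  have hd : |d| ^ 2 = d ^ 2 := sq_abs d
  have key : 0 ≤ ε⁻¹ * (√c * b - ε * (vnorm a * |d|)) ^ 2 := by positivity
  have e : ε⁻¹ * (√c * b - ε * (vnorm a * |d|)) ^ 2 =
      ε⁻¹ * (√c ^ 2 * b ^ 2) + ε * (vnorm a ^ 2 * |d| ^ 2)
        - 2 * (√c * vnorm a) * (b * |d|) := by
    field_simp; ring
  rw [e, hs, hd] at key
  linarith

theorem slice_lower_bound {W : M33 → ℝ} {a : V3} (ha : a ≠ 0) {c : ℝ} (hc : 0 < c)
    (hcW : ∀ ξ, c * bump (coord a (ξ 0)) ^ 2 ≤ W ξ) {h ε : ℝ} (hε : 0 < ε)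
    {u : Pt → V3} (hu : ContDiffOn ℝ 2 u Q3) {y : ℝ × ℝ} (hy : y ∈ II ×ˢ II)
    (hsmall : ∫⁻ t in II, ENNReal.ofReal (vnorm (u (t, y) - u0 a (t, y))) ≤
      ENNReal.ofReal (vnorm a / 256)) :
    ENNReal.ofReal (2 * (√c * vnorm a) * bumpMass) ≤
      ∫⁻ t in II, ENNReal.ofReal (ε⁻¹ * W (gradh h u (t, y)) + ε * hessh h u (t, y)) := by
  have hapos := vnorm_pos ha
  have hu1 : ContDiffOn ℝ 1 u Q3 := hu.of_le (by norm_num)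
  have hp1 : ContDiffOn ℝ 1 (pd e1 u) Q3 := contDiffOn_pd hu (by norm_num) e1
  have hp2 : ContDiffOn ℝ 0 (pd e1 (pd e1 u)) Q3 := contDiffOn_pd hp1 (by norm_num) e1
  have hv : ∀ t ∈ II, HasDerivAt (fun r => coord a (u (r, y))) (coord a (pd e1 u (t, y))) t :=
    fun t ht => (coord a).hasFDerivAt.comp_hasDerivAt t (hasDerivAt_slice hu1 hy ht)
  have hs : ∀ t ∈ II, HasDerivAt (fun r => coord a (pd e1 u (r, y)))
      (coord a (pd e1 (pd e1 u) (t, y))) t :=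
    fun t ht => (coord a).hasFDerivAt.comp_hasDerivAt t (hasDerivAt_slice hp1 hy ht)
  have hs' : ContinuousOn (fun t => coord a (pd e1 (pd e1 u) (t, y))) II :=
    (coord a).continuous.comp_continuousOn (continuousOn_slice hp2.continuousOn hy)
  have hclose : ∫⁻ t in II, ENNReal.ofReal |coord a (u (t, y)) - (|t|)| ≤
      ENNReal.ofReal (1 / 256) := by
    have hpt : ∀ t : ℝ, ENNReal.ofReal |coord a (u (t, y)) - (|t|)| ≤
        ENNReal.ofReal (vnorm a)⁻¹ * ENNReal.ofReal (vnorm (u (t, y) - u0 a (t, y))) := by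
      intro t
      rw [← ENNReal.ofReal_mul (by positivity)]
      refine ENNReal.ofReal_le_ofReal ?_
      rw [inv_mul_eq_div, le_div_iff₀ hapos]
      have hq := sq_mul_sq_coord_le ha (u (t, y) - u0 a (t, y))
      have hco : coord a (u (t, y) - u0 a (t, y)) = coord a (u (t, y)) - |t| := by
        simp [u0, ub0, coord_self ha]
      rw [hco] at hq
      refine abs_le_of_sq_le_sq' ?_ (vnorm_nonneg _) |>.2
      rw [mul_pow, sq_abs]; linarith
    calc _ ≤ ∫⁻ t in II, ENNReal.ofReal (vnorm a)⁻¹ *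
          ENNReal.ofReal (vnorm (u (t, y) - u0 a (t, y))) := lintegral_mono hpt
      _ = ENNReal.ofReal (vnorm a)⁻¹ *
          ∫⁻ t in II, ENNReal.ofReal (vnorm (u (t, y) - u0 a (t, y))) :=
        lintegral_const_mul' _ _ ENNReal.ofReal_ne_top
      _ ≤ ENNReal.ofReal (vnorm a)⁻¹ * ENNReal.ofReal (vnorm a / 256) := by gcongr
      _ = ENNReal.ofReal (1 / 256) := by
        rw [← ENNReal.ofReal_mul (by positivity)]; congr 1; field_simp
  obtain ⟨t₁, ht₁, t₂, ht₂, ht, g₁, g₂⟩ := exists_slopes hv hclose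
  have hk : 0 ≤ 2 * (√c * vnorm a) := by positivity
  calc ENNReal.ofReal (2 * (√c * vnorm a) * bumpMass)
      = ENNReal.ofReal (2 * (√c * vnorm a)) * ENNReal.ofReal bumpMass := ENNReal.ofReal_mul hk
    _ ≤ ENNReal.ofReal (2 * (√c * vnorm a)) * ∫⁻ t in II, ENNReal.ofReal
        (bump (coord a (pd e1 u (t, y))) * |coord a (pd e1 (pd e1 u) (t, y))|) := by
        gcongr
        exact bumpMass_le_lintegral hs hs' ht₁ ht₂ ht g₁ g₂
    _ = ∫⁻ t in II, ENNReal.ofReal (2 * (√c * vnorm a)) * ENNReal.ofReal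
        (bump (coord a (pd e1 u (t, y))) * |coord a (pd e1 (pd e1 u) (t, y))|) :=
        (lintegral_const_mul' _ _ ENNReal.ofReal_ne_top).symm
    _ ≤ _ := lintegral_mono fun t => by
        rw [← ENNReal.ofReal_mul hk]
        exact ENNReal.ofReal_le_ofReal (mul_bump_le_energy ha hc hcW hε u (t, y))

theorem continuousOn_energy {W : M33 → ℝ} (hWc : Continuous W) (h ε : ℝ) {u : Pt → V3}
    (hu : ContDiffOn ℝ 2 u Q3) :
    ContinuousOn (fun x => ε⁻¹ * W (gradh h u x) + ε * hessh h u x) Q3 := by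
  have hp1 : ∀ e, ContDiffOn ℝ 1 (pd e u) Q3 := contDiffOn_pd hu (by norm_num)
  have hc1 : ∀ e, ContinuousOn (pd e u) Q3 := fun e => (hp1 e).continuousOn
  have hv : ∀ e e', ContinuousOn (fun x => vnorm (pd e' (pd e u) x)) Q3 := fun e e' =>
    continuous_vnorm.comp_continuousOn
      (contDiffOn_pd (m := 0) (hp1 e) (by norm_num) e').continuousOn
  have hg : ContinuousOn (gradh h u) Q3 := by
    refine continuousOn_pi.2 fun j => ?_
    fin_cases j
    · exact hc1 e1
    · exact hc1 e2
    · exact (hc1 e3).const_smul h⁻¹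
  have hH : ContinuousOn (hessh h u) Q3 := by
    have h11 := hv e1 e1
    have h22 := hv e2 e2
    have h33 := hv e3 e3
    have h12 := hv e1 e2
    have h13 := hv e1 e3
    have h23 := hv e2 e3
    unfold hessh
    fun_prop
  exact (continuousOn_const.mul (hWc.comp_continuousOn hg)).add (continuousOn_const.mul hH)

theorem continuous_u0 (a : V3) : Continuous (u0 a) := by
  unfold u0 ub0; fun_prop

/-- The energy together with a multiple of the `L¹` distance to `u0` is bounded below. -/
theorem lower_bound {W : M33 → ℝ} (hWc : Continuous W) {a : V3} (ha : a ≠ 0) {c : ℝ} (hc : 0 < c)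
    (hcW : ∀ ξ, c * bump (coord a (ξ 0)) ^ 2 ≤ W ξ) {h ε : ℝ} (hε : 0 < ε)
    {u : Pt → V3} (hu : ContDiffOn ℝ 2 u Q3) :
    ENNReal.ofReal (2 * (√c * vnorm a) * bumpMass) ≤ F W h ε u Q3 +
      ENNReal.ofReal (512 * √c * bumpMass) *
        ∫⁻ x in Q3, ENNReal.ofReal (vnorm (u x - u0 a x)) := by
  have hE : AEMeasurable (fun x => ENNReal.ofReal (ε⁻¹ * W (gradh h u x) + ε * hessh h u x))
      (volume.restrict Q3) :=
    ((continuousOn_energy hWc h ε hu).aemeasurable measurableSet_Q3).ennreal_ofReal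
  have hD : AEMeasurable (fun x => ENNReal.ofReal (vnorm (u x - u0 a x)))
      (volume.restrict Q3) :=
    ((continuous_vnorm.comp_continuousOn (hu.continuousOn.sub
      (continuous_u0 a).continuousOn)).aemeasurable measurableSet_Q3).ennreal_ofReal
  rw [F, lintegral_Q3 hE, lintegral_Q3 hD, ← lintegral_const_mul' _ _ ENNReal.ofReal_ne_top,
    ← lintegral_add_left']
  · calc ENNReal.ofReal (2 * (√c * vnorm a) * bumpMass)
        = ∫⁻ _ in II ×ˢ II, ENNReal.ofReal (2 * (√c * vnorm a) * bumpMass) := by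
          rw [setLIntegral_const, volume_IIxII, mul_one]
      _ ≤ _ := setLIntegral_mono' (measurableSet_II.prod measurableSet_II) fun y hy => ?_
    by_cases hs : ∫⁻ t in II, ENNReal.ofReal (vnorm (u (t, y) - u0 a (t, y))) ≤
      ENNReal.ofReal (vnorm a / 256)
    · exact (slice_lower_bound ha hc hcW hε hu hy hs).trans le_self_add
    · refine le_trans ?_ le_add_self
      refine le_trans (le_of_eq ?_) (mul_le_mul_right (not_le.1 hs).le _)
      have := bumpMass_pos
      rw [← ENNReal.ofReal_mul (by positivity)]
      congr 1; ring
  · rw [restrict_Q3] at hE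
    exact hE.prod_swap.lintegral_prod_right'

theorem KstarInf_pos {p : ℝ} (hp : 2 ≤ p) {A B : M33} {W : M33 → ℝ} {a : V3}
    (ha : a ≠ 0) (hWc : Continuous W) (h1 : H1 W A B) (h2 : H2 W p) (hAB : A = -B)
    (hA0 : A 0 = a) : 0 < KstarInf W a (A 2) := by
  obtain ⟨c, hc, hcW⟩ := exists_mul_sq_bump_le hp ha hWc h1 h2 hAB hA0
  have hapos := vnorm_pos ha
  have hm := bumpMass_pos
  set κ : ℝ≥0∞ := ENNReal.ofReal (2 * (√c * vnorm a) * bumpMass) with hκ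
  have hκ0 : 0 < κ := by rw [hκ, ENNReal.ofReal_pos]; positivity
  refine (ENNReal.half_pos hκ0.ne').trans_le (le_sInf ?_)
  rintro L ⟨h, ε, u, -, hε, -, -, -, hu, hL1, -, rfl⟩
  refine le_liminf_of_le (by isBoundedDefault) ?_
  have hT := ENNReal.Tendsto.const_mul (a := ENNReal.ofReal (512 * √c * bumpMass)) hL1
    (Or.inr ENNReal.ofReal_ne_top)
  rw [mul_zero] at hT
  filter_upwards [hT.eventually_le_const (ENNReal.half_pos hκ0.ne')] with n hn
  have hlb := (lower_bound hWc ha hc hcW (h := h n) (hε n) (hu n)).trans (add_le_add_right hn _)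
  rw [← hκ] at hlb
  nth_rewrite 1 [← ENNReal.add_halves κ] at hlb
  exact (ENNReal.add_le_add_iff_right
    (ENNReal.div_ne_top ENNReal.ofReal_ne_top two_ne_zero)).1 hlb

/-! ### Finiteness: an explicit recovery sequence -/

theorem exists_W_smul_le {p : ℝ} (hp : 2 ≤ p) {A B : M33} {W : M33 → ℝ} (h2 : H2 W p)
    (h3 : H3 W A B p) (hAB : A = -B) :
    ∃ K ≥ 0, ∀ s : ℝ, |s| ≤ 1 → W (s • A) ≤ K * (1 - s ^ 2) := by
  obtain ⟨C, hC, hCW⟩ := h2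
  obtain ⟨ϱ, hϱ, C', hC', hW⟩ := h3
  set r := min ϱ 1 with hr
  have hr0 : 0 < r := lt_min hϱ one_pos
  set M := C * mnorm A ^ p + C with hM
  have hA := mnorm_nonneg A
  have hM0 : 0 ≤ M := by positivity
  refine ⟨C' * mnorm A + M * mnorm A / r, by positivity, fun s hs => ?_⟩
  have hdist : mdist A B (s • A) ≤ (1 - |s|) * mnorm A := by
    rcases le_total 0 s with h0 | h0
    · refine (min_le_left _ _).trans ?_
      have e : s • A - A = (s - 1) • A := by rw [sub_smul, one_smul]
      rw [abs_of_nonneg h0] at hs ⊢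
      rw [e, mnorm_smul, abs_of_nonpos (by linarith)]
      linarith
    · refine (min_le_right _ _).trans ?_
      have e : s • A - B = (s + 1) • A := by rw [add_smul, one_smul, hAB]; abel
      rw [abs_of_nonpos h0] at hs ⊢
      rw [e, mnorm_smul, abs_of_nonneg (by linarith)]
      linarith
  have hd0 : 0 ≤ mdist A B (s • A) := le_min (mnorm_nonneg _) (mnorm_nonneg _)
  have hs2 : 1 - |s| ≤ 1 - s ^ 2 := by
    rw [← sq_abs]; nlinarith [abs_nonneg s]
  have hs1 : 0 ≤ 1 - |s| := by linarith
  refine le_trans ?_ (mul_le_mul_of_nonneg_left hs2 (by positivity))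
  by_cases hd : mdist A B (s • A) ≤ r
  · have h1 := (hW _ (hd.trans (min_le_left _ _))).2
    have h2 : mdist A B (s • A) ^ p ≤ mdist A B (s • A) := by
      simpa using Real.rpow_le_rpow_of_exponent_ge' hd0 (hd.trans (min_le_right _ _))
        zero_le_one (show (1 : ℝ) ≤ p by linarith)
    calc W (s • A) ≤ C' * ((1 - |s|) * mnorm A) :=
          h1.trans (mul_le_mul_of_nonneg_left (h2.trans hdist) hC'.le)
      _ = (C' * mnorm A) * (1 - |s|) := by ring
      _ ≤ _ := by gcongr; exact le_add_of_nonneg_right (by positivity)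
  · have hlt : r ≤ (1 - |s|) * mnorm A := (not_le.1 hd).le.trans hdist
    have hWM : W (s • A) ≤ M := by
      refine (hCW _).2.trans ?_
      rw [hM, mnorm_smul]
      gcongr
      exact mul_le_of_le_one_left hA hs
    calc W (s • A) ≤ M * 1 := by linarith
      _ ≤ M * ((1 - |s|) * mnorm A / r) := by
          gcongr; rwa [one_le_div hr0]
      _ = (M * mnorm A / r) * (1 - |s|) := by ring
      _ ≤ _ := by gcongr; exact le_add_of_nonneg_left (by positivity)

/-- Smoothed modulus `√(t² + ε²)`. -/
noncomputable def smabs (ε t : ℝ) : ℝ := √(t ^ 2 + ε ^ 2)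

theorem smabs_sq (ε t : ℝ) : smabs ε t ^ 2 = t ^ 2 + ε ^ 2 := Real.sq_sqrt (by positivity)

theorem smabs_pos {ε : ℝ} (hε : 0 < ε) (t : ℝ) : 0 < smabs ε t :=
  Real.sqrt_pos.2 (by positivity)

theorem hasDerivAt_smabs {ε : ℝ} (hε : 0 < ε) (t : ℝ) :
    HasDerivAt (smabs ε) (t / smabs ε t) t := by
  have h : HasDerivAt (fun t : ℝ => t ^ 2 + ε ^ 2) (2 * t) t := by
    simpa using (hasDerivAt_pow 2 t).add_const (ε ^ 2)
  have h' := h.sqrt (by positivity)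
  rw [mul_div_mul_left _ _ two_ne_zero] at h'
  exact h'

theorem hasDerivAt_div_smabs {ε : ℝ} (hε : 0 < ε) (t : ℝ) :
    HasDerivAt (fun t => t / smabs ε t) (ε ^ 2 / smabs ε t ^ 3) t := by
  have hp := smabs_pos hε t
  have hsq := smabs_sq ε t
  have e : ε ^ 2 / smabs ε t ^ 3 =
      (1 * smabs ε t - t * (t / smabs ε t)) / smabs ε t ^ 2 := by
    field_simp
    linarith
  rw [e]
  exact (hasDerivAt_id t).fun_div (hasDerivAt_smabs hε t) hp.ne'

theorem contDiff_smabs {ε : ℝ} (hε : 0 < ε) : ContDiff ℝ 2 (smabs ε) := by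
  unfold smabs
  exact ContDiff.sqrt (by fun_prop) fun t => by positivity

theorem abs_div_smabs_le {ε : ℝ} (hε : 0 < ε) (t : ℝ) : |t / smabs ε t| ≤ 1 := by
  rw [abs_div, abs_of_pos (smabs_pos hε t), div_le_one (smabs_pos hε t)]
  exact Real.abs_le_sqrt (by nlinarith)

/-- The linear functional `x ↦ x₁ + c x₃`. -/
noncomputable def tilt (c : ℝ) : Pt →L[ℝ] ℝ :=
  ContinuousLinearMap.fst ℝ ℝ (ℝ × ℝ) + c •
    (ContinuousLinearMap.snd ℝ ℝ ℝ).comp (ContinuousLinearMap.snd ℝ ℝ (ℝ × ℝ))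

theorem tilt_apply (c : ℝ) (x : Pt) : tilt c x = x.1 + c * x.2.2 := rfl

theorem pd_ridge (c k : ℝ) {g g' : ℝ → ℝ} (hg : ∀ t, HasDerivAt g (g' t) t) (a : V3) (e : Pt) :
    pd e (fun x => (k * g (tilt c x)) • a) = fun x => (k * tilt c e * g' (tilt c x)) • a := by
  funext x
  have h : HasFDerivAt (fun x => (k * g (tilt c x)) • a)
      ((k • (g' (tilt c x) • tilt c)).smulRight a) x :=
    (((hg (tilt c x)).comp_hasFDerivAt x (tilt c).hasFDerivAt).const_mul k).smul_const a
  rw [pd, h.fderiv]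
  simp only [ContinuousLinearMap.smulRight_apply, smul_apply, smul_eq_mul]
  congr 1; ring

/-- The recovery map `√((x₁ + c x₃)² + ε²) a`. -/
noncomputable def ridge (a : V3) (ε c : ℝ) (x : Pt) : V3 := smabs ε (tilt c x) • a

theorem pd_ridge_one {ε : ℝ} (hε : 0 < ε) (c : ℝ) (a : V3) (e : Pt) :
    pd e (ridge a ε c) = fun x => (tilt c e * (tilt c x / smabs ε (tilt c x))) • a := by
  have h := pd_ridge c 1 (hasDerivAt_smabs hε) a e
  simp only [one_mul] at h
  exact h

theorem pd_ridge_two {ε : ℝ} (hε : 0 < ε) (c : ℝ) (a : V3) (e e' : Pt) :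
    pd e' (pd e (ridge a ε c)) =
      fun x => (tilt c e * tilt c e' * (ε ^ 2 / smabs ε (tilt c x) ^ 3)) • a := by
  rw [pd_ridge_one hε]
  exact pd_ridge c (tilt c e) (hasDerivAt_div_smabs hε) a e'

theorem tilt_e1 (c : ℝ) : tilt c e1 = 1 := by simp [tilt_apply, e1]
theorem tilt_e2 (c : ℝ) : tilt c e2 = 0 := by simp [tilt_apply, e2]
theorem tilt_e3 (c : ℝ) : tilt c e3 = c := by simp [tilt_apply, e3]

theorem contDiff_ridge {ε : ℝ} (hε : 0 < ε) (c : ℝ) (a : V3) : ContDiff ℝ 2 (ridge a ε c) :=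
  ((contDiff_smabs hε).comp (tilt c).contDiff).smul contDiff_const

theorem gradh_ridge {A : M33} {a : V3} {lam : ℝ} (hA0 : A 0 = a) (hA1 : A 1 = 0)
    (hA2 : A 2 = lam • a) {h ε : ℝ} (hh : 0 < h) (hε : 0 < ε) (x : Pt) :
    gradh h (ridge a ε (lam * h)) x =
      (tilt (lam * h) x / smabs ε (tilt (lam * h) x)) • A := by
  funext j
  fin_cases j
  · simp [gradh, pd_ridge_one hε, tilt_e1, hA0]
  · simp [gradh, pd_ridge_one hε, tilt_e2, hA1]
  · simp only [gradh, pd_ridge_one hε, tilt_e3, Fin.reduceFinMk, Matrix.cons_val, Pi.smul_apply,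
      hA2, smul_smul]
    congr 1; field_simp

theorem hessh_ridge (a : V3) (lam : ℝ) {h ε : ℝ} (hh : 0 < h) (hε : 0 < ε) (x : Pt) :
    hessh h (ridge a ε (lam * h)) x =
      (1 + lam ^ 2) ^ 2 * vnorm a ^ 2 * (ε ^ 2 / smabs ε (tilt (lam * h) x) ^ 3) ^ 2 := by
  unfold hessh
  simp only [pd_ridge_two hε, tilt_e1, tilt_e2, tilt_e3, vnorm_smul, mul_pow, sq_abs]
  field_simp
  ring

theorem energy_ridge_le {A : M33} {W : M33 → ℝ} {a : V3} {lam : ℝ} (hA0 : A 0 = a)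
    (hA1 : A 1 = 0) (hA2 : A 2 = lam • a) {K : ℝ}
    (hK : ∀ s : ℝ, |s| ≤ 1 → W (s • A) ≤ K * (1 - s ^ 2))
    {h ε : ℝ} (hh : 0 < h) (hε : 0 < ε) (x : Pt) :
    ε⁻¹ * W (gradh h (ridge a ε (lam * h)) x) + ε * hessh h (ridge a ε (lam * h)) x ≤
      (K + (1 + lam ^ 2) ^ 2 * vnorm a ^ 2) *
        (ε⁻¹ * (1 + (tilt (lam * h) x / ε) ^ 2)⁻¹) := by
  rw [gradh_ridge hA0 hA1 hA2 hh hε, hessh_ridge a lam hh hε]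
  set t := tilt (lam * h) x
  have hp := smabs_pos hε t
  have hsq := smabs_sq ε t
  set m := smabs ε t
  have hW := hK (t / m) (abs_div_smabs_le hε t)
  have e1 : 1 - (t / m) ^ 2 = (1 + (t / ε) ^ 2)⁻¹ := by
    have : 1 + (t / ε) ^ 2 = m ^ 2 / ε ^ 2 := by rw [hsq]; field_simp; ring
    rw [this, inv_div]; field_simp; linarith
  have e2 : (1 + (t / ε) ^ 2)⁻¹ = ε ^ 2 / m ^ 2 := by
    have : 1 + (t / ε) ^ 2 = m ^ 2 / ε ^ 2 := by rw [hsq]; field_simp; ring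
    rw [this, inv_div]
  have hm : ε ^ 2 ≤ m ^ 2 := by rw [hsq]; nlinarith
  have e3 : ε * (ε ^ 2 / m ^ 3) ^ 2 ≤ ε⁻¹ * (1 + (t / ε) ^ 2)⁻¹ := by
    rw [e2]
    have : ε * (ε ^ 2 / m ^ 3) ^ 2 = ε⁻¹ * (ε ^ 2 / m ^ 2) * ((ε ^ 2) ^ 2 / (m ^ 2) ^ 2) := by
      field_simp
    rw [this]
    refine mul_le_of_le_one_right (by positivity) ?_
    rw [div_le_one (by positivity)]
    gcongr
  rw [e1] at hW
  have hW' : ε⁻¹ * W ((t / m) • A) ≤ ε⁻¹ * (K * (1 + (t / ε) ^ 2)⁻¹) := by gcongr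
  have hH := mul_le_mul_of_nonneg_left e3
    (show 0 ≤ (1 + lam ^ 2) ^ 2 * vnorm a ^ 2 by positivity)
  linarith

theorem lintegral_lorentz {ε : ℝ} (hε : 0 < ε) (b : ℝ) :
    ∫⁻ t : ℝ, ENNReal.ofReal (ε⁻¹ * (1 + ((t + b) / ε) ^ 2)⁻¹) = ENNReal.ofReal Real.pi := by
  rw [lintegral_add_right_eq_self
    (fun t : ℝ => ENNReal.ofReal (ε⁻¹ * (1 + (t / ε) ^ 2)⁻¹)) b,
    ← ofReal_integral_eq_lintegral_ofReal]
  · rw [integral_const_mul, Measure.integral_comp_div (fun x : ℝ => (1 + x ^ 2)⁻¹) ε,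
      integral_univ_inv_one_add_sq, abs_of_pos hε, smul_eq_mul, inv_mul_cancel_left₀ hε.ne']
  · exact (integrable_inv_one_add_sq.comp_div hε.ne').const_mul _
  · exact Eventually.of_forall fun t => by positivity

theorem F_ridge_le {A : M33} {W : M33 → ℝ} {a : V3} {lam : ℝ} (hA0 : A 0 = a)
    (hA1 : A 1 = 0) (hA2 : A 2 = lam • a) {K : ℝ} (hK0 : 0 ≤ K)
    (hK : ∀ s : ℝ, |s| ≤ 1 → W (s • A) ≤ K * (1 - s ^ 2)) {h ε : ℝ} (hh : 0 < h) (hε : 0 < ε) :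
    F W h ε (ridge a ε (lam * h)) Q3 ≤
      ENNReal.ofReal (K + (1 + lam ^ 2) ^ 2 * vnorm a ^ 2) * ENNReal.ofReal Real.pi := by
  set D := K + (1 + lam ^ 2) ^ 2 * vnorm a ^ 2 with hD
  have hD0 : 0 ≤ D := by positivity
  have hmeas : Measurable fun x : Pt =>
      ENNReal.ofReal (ε⁻¹ * (1 + (tilt (lam * h) x / ε) ^ 2)⁻¹) := by
    have := (tilt (lam * h)).continuous.measurable
    fun_prop
  calc F W h ε (ridge a ε (lam * h)) Q3
      ≤ ∫⁻ x in Q3, ENNReal.ofReal D *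
        ENNReal.ofReal (ε⁻¹ * (1 + (tilt (lam * h) x / ε) ^ 2)⁻¹) := by
        refine lintegral_mono fun x => ?_
        rw [← ENNReal.ofReal_mul hD0]
        exact ENNReal.ofReal_le_ofReal (energy_ridge_le hA0 hA1 hA2 hK hh hε x)
    _ = ENNReal.ofReal D * ∫⁻ y in II ×ˢ II, ∫⁻ t in II,
        ENNReal.ofReal (ε⁻¹ * (1 + (tilt (lam * h) (t, y) / ε) ^ 2)⁻¹) := by
        rw [lintegral_const_mul' _ _ ENNReal.ofReal_ne_top, lintegral_Q3 hmeas.aemeasurable]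
    _ ≤ ENNReal.ofReal D * ∫⁻ _ in II ×ˢ II, ENNReal.ofReal Real.pi := by
        refine mul_le_mul_right (lintegral_mono fun y => ?_) _
        simp only [tilt_apply]
        exact (setLIntegral_le_lintegral _ _).trans (lintegral_lorentz hε (lam * h * y.2)).le
    _ = _ := by rw [setLIntegral_const, volume_IIxII, mul_one]

theorem abs_smabs_sub_abs_le {ε : ℝ} (hε : 0 < ε) (t r : ℝ) :
    |smabs ε t - (|r|)| ≤ ε + |t - r| := by
  have h1 : |t| ≤ smabs ε t := Real.abs_le_sqrt (by nlinarith)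
  have h2 : smabs ε t ≤ |t| + ε := by
    refine Real.sqrt_le_iff.2 ⟨by positivity, ?_⟩
    nlinarith [sq_abs t, mul_nonneg (abs_nonneg t) hε.le]
  have h3 := abs_le.1 (abs_abs_sub_abs_le_abs_sub t r)
  rw [abs_le]
  constructor <;> linarith [h3.1, h3.2]

theorem tendsL1_ridge (a : V3) (lam : ℝ) {h ε : ℕ → ℝ} (hh : ∀ n, 0 < h n) (hε : ∀ n, 0 < ε n)
    (hh0 : Tendsto h atTop (𝓝 0)) (hε0 : Tendsto ε atTop (𝓝 0)) :
    TendsL1 Q3 (fun n => ridge a (ε n) (lam * h n)) (u0 a) := by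
  have hb : ∀ n, ∫⁻ x in Q3, ENNReal.ofReal (vnorm (ridge a (ε n) (lam * h n) x - u0 a x)) ≤
      ENNReal.ofReal ((ε n + |lam| * h n) * vnorm a) := by
    intro n
    calc _ ≤ ∫⁻ _ in Q3, ENNReal.ofReal ((ε n + |lam| * h n) * vnorm a) := by
          refine setLIntegral_mono' measurableSet_Q3 fun x hx => ENNReal.ofReal_le_ofReal ?_
          have hx3 : |x.2.2| ≤ 1 := by
            have h3 := hx.2.2
            simp only [II, mem_Ioo] at h3
            rw [abs_le]; constructor <;> linarith [h3.1, h3.2]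
          rw [ridge, u0, ub0, ← sub_smul, vnorm_smul]
          refine mul_le_mul_of_nonneg_right ?_ (vnorm_nonneg a)
          refine (abs_smabs_sub_abs_le (hε n) _ _).trans ?_
          rw [tilt_apply, add_sub_cancel_left, abs_mul, abs_mul, abs_of_pos (hh n)]
          exact add_le_add_right
            (mul_le_of_le_one_right (mul_nonneg (abs_nonneg _) (hh n).le) hx3) _
      _ = _ := by rw [setLIntegral_const, volume_Q3, mul_one]
  have hlim : Tendsto (fun n => ENNReal.ofReal ((ε n + |lam| * h n) * vnorm a)) atTop (𝓝 0) := by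
    have := ((hε0.add (hh0.const_mul |lam|)).mul_const (vnorm a))
    simpa using ENNReal.tendsto_ofReal this
  exact tendsto_of_tendsto_of_tendsto_of_le_of_le tendsto_const_nhds hlim (fun _ => zero_le) hb

theorem ae_fst_ne_zero : ∀ᵐ x : Pt ∂(volume.restrict Q3), x.1 ≠ 0 := by
  refine ae_restrict_of_ae ?_
  rw [ae_iff]
  have : {x : Pt | ¬ x.1 ≠ 0} = ({0} : Set ℝ) ×ˢ (univ : Set (ℝ × ℝ)) := by
    ext x; simp
  rw [this, Measure.volume_eq_prod, Measure.prod_prod]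
  simp

theorem tendsL1_pd_ridge (a : V3) (lam : ℝ) {h ε : ℕ → ℝ} (hh : ∀ n, 0 < h n)
    (hε : ∀ n, 0 < ε n) (hh0 : Tendsto h atTop (𝓝 0)) (hε0 : Tendsto ε atTop (𝓝 0)) :
    TendsL1 Q3 (fun n x => (h n)⁻¹ • pd e3 (ridge a (ε n) (lam * h n)) x) (b0 (lam • a)) := by
  set σ : Pt → ℝ := fun x => if 0 ≤ x.1 then 1 else -1 with hσ
  set q : ℕ → Pt → ℝ := fun n x =>
    tilt (lam * h n) x / smabs (ε n) (tilt (lam * h n) x) with hq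
  have hdiff : ∀ n x, vnorm ((h n)⁻¹ • pd e3 (ridge a (ε n) (lam * h n)) x - b0 (lam • a) x) =
      |q n x - σ x| * (|lam| * vnorm a) := by
    intro n x
    have hb : b0 (lam • a) x = (σ x * lam) • a := by
      simp only [b0, bb0, hσ]; split_ifs <;> simp
    have hhn := (hh n).ne'
    rw [pd_ridge_one (hε n), hb, smul_smul, ← sub_smul, vnorm_smul, tilt_e3, ← mul_assoc |q n x - σ x|,
      ← abs_mul]
    congr 2
    simp only [hq]
    field_simp
  have hσ1 : ∀ x, |σ x| ≤ 1 := fun x => by simp only [hσ]; split_ifs <;> simp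
  have hσm : Measurable σ :=
    Measurable.ite (measurableSet_le measurable_const measurable_fst) measurable_const
      measurable_const
  have hqm : ∀ n, Measurable (q n) := fun n => by
    have h1 := (tilt (lam * h n)).continuous.measurable
    have h2 := (contDiff_smabs (hε n)).continuous.measurable
    exact h1.div (h2.comp h1)
  unfold TendsL1
  simp only [hdiff]
  have key := tendsto_lintegral_of_dominated_convergence (μ := volume.restrict Q3)
    (F := fun n x => ENNReal.ofReal (|q n x - σ x| * (|lam| * vnorm a))) (f := fun _ => 0)
    (fun _ => ENNReal.ofReal (2 * (|lam| * vnorm a)))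
    (fun n => (((hqm n).sub hσm).abs.mul_const _).ennreal_ofReal)
    (fun n => Eventually.of_forall fun x => ?_) ?_ ?_
  · simpa using key
  · refine ENNReal.ofReal_le_ofReal (mul_le_mul_of_nonneg_right ?_
      (mul_nonneg (abs_nonneg _) (vnorm_nonneg a)))
    have h1 := abs_div_smabs_le (hε n) (tilt (lam * h n) x)
    have h2 := abs_sub (q n x) (σ x)
    have h3 := hσ1 x
    have h4 : |q n x| ≤ 1 := h1
    linarith
  · rw [setLIntegral_const, volume_Q3, mul_one]; exact ENNReal.ofReal_ne_top
  · filter_upwards [ae_fst_ne_zero] with x hx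
    have ht : Tendsto (fun n => tilt (lam * h n) x) atTop (𝓝 x.1) := by
      simp only [tilt_apply]
      simpa using ((hh0.const_mul lam).mul_const x.2.2).const_add x.1
    have hs : Tendsto (fun n => smabs (ε n) (tilt (lam * h n) x)) atTop (𝓝 |x.1|) := by
      have := ((ht.pow 2).add (hε0.pow 2)).sqrt
      simpa [smabs, Real.sqrt_sq_eq_abs] using this
    have hd : Tendsto (fun n => q n x) atTop (𝓝 (σ x)) := by
      have := ht.div hs (abs_ne_zero.2 hx)
      have e : x.1 / |x.1| = σ x := by
        simp only [hσ]
        split_ifs with h0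
        · rw [abs_of_nonneg h0, div_self hx]
        · rw [abs_of_neg (not_le.1 h0), div_neg, div_self hx]
      rwa [e] at this
    have := ENNReal.tendsto_ofReal (((hd.sub_const (σ x)).abs).mul_const (|lam| * vnorm a))
    simpa using this

theorem KstarInf_lt_top {p : ℝ} (hp : 2 ≤ p) {A B : M33} {W : M33 → ℝ} {a : V3} {lam : ℝ}
    (h2 : H2 W p) (h3 : H3 W A B p) (hAB : A = -B) (hA0 : A 0 = a) (hA1 : A 1 = 0)
    (hA2 : A 2 = lam • a) : KstarInf W a (A 2) < ⊤ := by
  obtain ⟨K, hK0, hK⟩ := exists_W_smul_le hp h2 h3 hAB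
  set h : ℕ → ℝ := fun n => 1 / ((n : ℝ) + 1) with hh
  set ε : ℕ → ℝ := fun n => h n ^ 2 with hε
  have hpos : ∀ n, 0 < h n := fun n => by simp only [hh]; positivity
  have εpos : ∀ n, 0 < ε n := fun n => pow_pos (hpos n) 2
  have hh0 : Tendsto h atTop (𝓝 0) := tendsto_one_div_add_atTop_nhds_zero_nat
  have hε0 : Tendsto ε atTop (𝓝 0) := by simpa using hh0.pow 2
  have hratio : Tendsto (fun n => h n / ε n) atTop atTop := by
    have e : ∀ n, h n / ε n = (n : ℝ) + 1 := fun n => by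
      simp only [hε, hh]; field_simp
    simp only [e]
    exact tendsto_atTop_add_const_right _ _ tendsto_natCast_atTop_atTop
  refine lt_of_le_of_lt (sInf_le ⟨h, ε, fun n => ridge a (ε n) (lam * h n), hpos, εpos, hh0, hε0, hratio,
    fun n => (contDiff_ridge (εpos n) _ a).contDiffOn, tendsL1_ridge a lam hpos εpos hh0 hε0,
    by rw [hA2]; exact tendsL1_pd_ridge a lam hpos εpos hh0 hε0, rfl⟩) ?_
  refine lt_of_le_of_lt (b := ENNReal.ofReal (K + (1 + lam ^ 2) ^ 2 * vnorm a ^ 2) *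
    ENNReal.ofReal Real.pi) ?_ (ENNReal.mul_lt_top ENNReal.ofReal_lt_top ENNReal.ofReal_lt_top)
  exact liminf_le_of_le (by isBoundedDefault) fun b hb => by
    obtain ⟨n, hn⟩ := hb.exists
    exact hn.trans (F_ridge_le hA0 hA1 hA2 hK0 hK (hpos n) (εpos n))

/-- Lemma 6.1: 0 < K*_∞ < ∞ for compatible supercritical wells. -/
theorem statement15 (p : ℝ) (hp : 2 ≤ p) (A B : M33) (W : M33 → ℝ)
    (a : V3) (ha : a ≠ 0) (lam : ℝ)
    (hWc : Continuous W) (h1 : H1 W A B) (h2 : H2 W p) (h3 : H3 W A B p)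
    (hAB : A = -B) (hA0 : A 0 = a) (hA1 : A 1 = 0) (hA2 : A 2 = lam • a) :
    0 < KstarInf W a (A 2) ∧ KstarInf W a (A 2) < ⊤ := by
  exact ⟨KstarInf_pos hp ha hWc h1 h2 hAB hA0, KstarInf_lt_top hp h2 h3 hAB hA0 hA1 hA2⟩
end
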